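/- Suppose d ≥ 1, 0 < α < d and α < min{1, d/3}. Then the percolation probability has mean-field behaviour near criticality: there are constants 0 < c₁ ≤ C₁ < ∞ and ε₀ > 0 (depending only on d, α, c, C) such that c₁ ε ≤ ℙ_{β_c+ε}(|K| = ∞) ≤ C₁ ε for every 0 < ε < ε₀. -/

import Mathlib

open MeasureTheory ENNReal

namespace LRP

/-- The vertex set `ℤ^d`. -/
abbrev V (d : ℕ) : Type := Fin d → ℤ

/-- The `ℓ^∞` norm of a lattice point, as a natural number. -/
def normInf {d : ℕ} (x : V d) : ℕ := Finset.univ.sup fun i => (x i).natAbs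

/-- A percolation configuration: each (unordered) pair of vertices is open or closed. -/
abbrev Config (d : ℕ) : Type := Sym2 (V d) → Bool

/-- The probability `1 - exp (-β J(x,y))` that the edge `e = {x,y}` is open
(the symmetrization `(J x y + J y x)/2` equals `J x y` for symmetric `J`). -/
noncomputable def edgeProb {d : ℕ} (J : V d → V d → ℝ) (β : ℝ) (e : Sym2 (V d)) : ℝ≥0∞ :=
  ENNReal.ofReal (1 - Real.exp (-β *
    Sym2.lift ⟨fun x y => (J x y + J y x) / 2, fun x y => by dsimp only; rw [add_comm]⟩ e))

/-- `IsLRP J P` asserts that for each `β`, `P β` is the law of long-range percolation on `ℤ^d`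
with kernel `J` at inverse temperature `β`: distinct edges are open independently, edge `{x,y}`
being open with probability `1 - exp (-β J(x,y))`.  This is expressed by prescribing the
probability of every finite cylinder event, which characterizes the measure uniquely. -/
def IsLRP {d : ℕ} (J : V d → V d → ℝ) (P : ℝ → Measure (Config d)) : Prop :=
  ∀ (β : ℝ) (s : Finset (Sym2 (V d))) (f : Sym2 (V d) → Bool),
    P β {ω | ∀ e ∈ s, ω e = f e} =
      ∏ e ∈ s, (if f e then edgeProb J β e else 1 - edgeProb J β e)

/-- Two vertices are adjacent if they are distinct and the edge between them is open. -/
def adj {d : ℕ} (ω : Config d) (x y : V d) : Prop := x ≠ y ∧ ω s(x, y) = true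

/-- `x ↔ y`: the vertices are connected by a path of open edges. -/
def conn {d : ℕ} (ω : Config d) (x y : V d) : Prop := Relation.ReflTransGen (adj ω) x y

/-- `x ↔ y` inside `A`: connected by an open path all of whose vertices lie in `A`. -/
def connIn {d : ℕ} (ω : Config d) (A : Set (V d)) (x y : V d) : Prop :=
  x ∈ A ∧ y ∈ A ∧ Relation.ReflTransGen (fun a b => a ∈ A ∧ b ∈ A ∧ adj ω a b) x y

/-- The cluster of `x`. -/
def cluster {d : ℕ} (ω : Config d) (x : V d) : Set (V d) := {y | conn ω x y}

/-- The critical point `β_c`. -/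
noncomputable def betaC {d : ℕ} (P : ℝ → Measure (Config d)) : ℝ :=
  sInf {β : ℝ | 0 ≤ β ∧ 0 < P β {ω | ∃ x, (cluster ω x).Infinite}}

/-- The two-point function `ℙ_β(x ↔ y)`. -/
noncomputable def twoPoint {d : ℕ} (P : ℝ → Measure (Config d)) (β : ℝ) (x y : V d) : ℝ≥0∞ :=
  P β {ω | conn ω x y}

/-- The susceptibility `χ(β) = Σ_x ℙ_β(0 ↔ x)`. -/
noncomputable def chi {d : ℕ} (P : ℝ → Measure (Config d)) (β : ℝ) : ℝ≥0∞ :=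
  ∑' x : V d, twoPoint P β 0 x

/-- `Σ_{x ∈ [-n,n]^d} ℙ_β(0 ↔ x)`. -/
noncomputable def boxSum {d : ℕ} (P : ℝ → Measure (Config d)) (β : ℝ) (n : ℕ) : ℝ≥0∞ :=
  ∑' x : V d, if normInf x ≤ n then twoPoint P β 0 x else 0

/-- The correlation length `ξ(β) = inf {r ≥ 1 : Σ_{x ∈ [-r,r]^d} ℙ_β(0↔x) ≥ χ(β)/2}`
(`= ∞` if no such `r` exists). -/
noncomputable def xi {d : ℕ} (P : ℝ → Measure (Config d)) (β : ℝ) : ℝ≥0∞ :=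
  sInf {r : ℝ≥0∞ | ∃ n : ℕ, r = (n : ℝ≥0∞) ∧ 1 ≤ n ∧ chi P β ≤ 2 * boxSum P β n}

/-- The triangle diagram `∇_β`. -/
noncomputable def triangle {d : ℕ} (P : ℝ → Measure (Config d)) (β : ℝ) : ℝ≥0∞ :=
  ∑' x : V d, ∑' y : V d, twoPoint P β 0 x * twoPoint P β x y * twoPoint P β y 0

/-- The standing assumptions on the kernel `J`: symmetric, integrable, translation-invariant,
with `c ‖x-y‖^{-d-α} ≤ J(x,y) ≤ C ‖x-y‖^{-d-α}` for distinct `x, y`, where `0 < α < d`. -/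
structure KernelHyp (d : ℕ) (J : V d → V d → ℝ) (α c C : ℝ) : Prop where
  d_pos : 1 ≤ d
  symm : ∀ x y, J x y = J y x
  transInv : ∀ x y z : V d, J (x + z) (y + z) = J x y
  nonneg : ∀ x y, 0 ≤ J x y
  integrable : Summable fun x : V d => J 0 x
  alpha_pos : 0 < α
  alpha_lt_d : α < (d : ℝ)
  c_pos : 0 < c
  c_le_C : c ≤ C
  lower : ∀ x y : V d, x ≠ y → c * (normInf (x - y) : ℝ) ^ (-(d : ℝ) - α) ≤ J x y
  upper : ∀ x y : V d, x ≠ y → J x y ≤ C * (normInf (x - y) : ℝ) ^ (-(d : ℝ) - α)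

set_option linter.unusedSectionVars false
set_option linter.unusedVariables false
section helpers
open Finset (sum_nonneg mul_sum sum_congr mem_powerset sum_le_sum sum_add_distrib sum_comm mem_insert prod_congr sdiff_subset mem_filter subset_union_left subset_insert disjoint_left mk_mem_sym2_iff mem_sdiff filter_subset sym2_mono mem_map sum_map card_pos card_le_card sum_le_sum_of_subset_of_nonneg sum_mul mem_univ le_sup mem_image mem_product mem_union_right mem_union union_subset mem_insert_of_mem mem_insert_self sum_const sum_filter_add_sum_filter_not)

section basics
open scoped Classical
variable {E : Type*} [DecidableEq E]

noncomputable def ind (A : Prop) : ℝ := if A then 1 else 0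
theorem ind_true {A : Prop} (h : A) : ind A = 1 := by simp [ind, h]
theorem ind_false {A : Prop} (h : ¬A) : ind A = 0 := by simp [ind, h]
theorem ind_nonneg (A : Prop) : 0 ≤ ind A := by unfold ind; split_ifs <;> norm_num
theorem ind_le_one (A : Prop) : ind A ≤ 1 := by unfold ind; split_ifs <;> norm_num
theorem ind_mono {A B : Prop} (h : A → B) : ind A ≤ ind B := by
  unfold ind; split_ifs <;> first | (exfalso; tauto; done) | norm_num
theorem ind_and (A B : Prop) : ind (A ∧ B) = ind A * ind B := by
  unfold ind; split_ifs <;> first | (exfalso; tauto; done) | norm_num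
theorem ind_not (A : Prop) : ind (¬A) = 1 - ind A := by
  unfold ind; split_ifs <;> norm_num
theorem ind_or_le (A B : Prop) : ind (A ∨ B) ≤ ind A + ind B := by
  unfold ind; split_ifs <;> first | (exfalso; tauto; done) | norm_num
theorem ind_congr {A B : Prop} (h : A ↔ B) : ind A = ind B := by rw [propext h]
theorem ind_exists_le {ι : Type*} (s : Finset ι) (A : ι → Prop) (P : Prop)
    (h : P → ∃ i ∈ s, A i) : ind P ≤ ∑ i ∈ s, ind (A i) := by
  by_cases hp : P
  · obtain ⟨i, hi, hA⟩ := h hp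
    calc ind P ≤ ind (A i) := by rw [ind_true hA]; exact ind_le_one _
      _ ≤ _ := Finset.single_le_sum (f := fun i => ind (A i)) (fun j _ => ind_nonneg _) hi
  · rw [ind_false hp]; exact sum_nonneg fun j _ => ind_nonneg _

noncomputable def Ex (r : E → ℝ) (S : Finset E) (f : Finset E → ℝ) : ℝ :=
  ∑ T ∈ S.powerset, (∏ e ∈ T, (1 - Real.exp (-r e))) * (∏ e ∈ S \ T, Real.exp (-r e)) * f T
noncomputable def Pr (r : E → ℝ) (S : Finset E) (A : Finset E → Prop) : ℝ :=
  Ex r S fun T => ind (A T)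
def Dep {X : Type*} (π : E → Prop) (f : Finset E → X) : Prop :=
  ∀ T T', (∀ e, π e → (e ∈ T ↔ e ∈ T')) → f T = f T'

theorem Ex_empty (r : E → ℝ) (f) : Ex r ∅ f = f ∅ := by simp [Ex]
theorem Ex_insert (r : E → ℝ) {S : Finset E} {e : E} (he : e ∉ S) (f) :
    Ex r (insert e S) f = (1 - Real.exp (-r e)) * Ex r S (fun T => f (insert e T))
      + Real.exp (-r e) * Ex r S f := by
  unfold Ex
  rw [Finset.sum_powerset_insert he, add_comm]
  congr 1
  · rw [mul_sum]
    refine sum_congr rfl fun T hT => ?_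
    have heT : e ∉ T := fun h => he (mem_powerset.1 hT h)
    rw [Finset.prod_insert heT, Finset.insert_sdiff_insert, Finset.sdiff_insert_of_notMem he]
    ring
  · rw [mul_sum]
    refine sum_congr rfl fun T hT => ?_
    have heT : e ∉ T := fun h => he (mem_powerset.1 hT h)
    rw [Finset.insert_sdiff_of_notMem _ heT, Finset.prod_insert (by simp [he])]
    ring
theorem Ex_congr {r : E → ℝ} {S : Finset E} {f g : Finset E → ℝ} (h : ∀ T ⊆ S, f T = g T) :
    Ex r S f = Ex r S g :=
  sum_congr rfl fun T hT => by rw [h T (mem_powerset.1 hT)]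
theorem wt_nonneg {r : E → ℝ} (hr : ∀ e, 0 ≤ r e) (S T : Finset E) :
    0 ≤ (∏ e ∈ T, (1 - Real.exp (-r e))) * (∏ e ∈ S \ T, Real.exp (-r e)) := by
  refine mul_nonneg (Finset.prod_nonneg fun e _ => ?_) (Finset.prod_nonneg fun e _ => (Real.exp_pos _).le)
  have := Real.exp_le_one_iff.2 (neg_nonpos.2 (hr e)); linarith
theorem Ex_mono {r : E → ℝ} (hr : ∀ e, 0 ≤ r e) {S : Finset E} {f g : Finset E → ℝ}
    (h : ∀ T ⊆ S, f T ≤ g T) : Ex r S f ≤ Ex r S g :=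
  sum_le_sum fun T hT =>
    mul_le_mul_of_nonneg_left (h T (mem_powerset.1 hT)) (wt_nonneg hr S T)
theorem Ex_add (r : E → ℝ) (S : Finset E) (f g : Finset E → ℝ) :
    Ex r S (fun T => f T + g T) = Ex r S f + Ex r S g := by
  simp only [Ex, mul_add, sum_add_distrib]
theorem Ex_sub (r : E → ℝ) (S : Finset E) (f g : Finset E → ℝ) :
    Ex r S (fun T => f T - g T) = Ex r S f - Ex r S g := by
  simp only [Ex, mul_sub, Finset.sum_sub_distrib]
theorem Ex_mul (r : E → ℝ) (S : Finset E) (a : ℝ) (f : Finset E → ℝ) :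
    Ex r S (fun T => a * f T) = a * Ex r S f := by
  simp only [Ex, mul_sum]; exact sum_congr rfl fun T _ => by ring
theorem Ex_sum {ι : Type*} (s : Finset ι) (r : E → ℝ) (S : Finset E) (f : ι → Finset E → ℝ) :
    Ex r S (fun T => ∑ i ∈ s, f i T) = ∑ i ∈ s, Ex r S (f i) := by
  simp only [Ex, mul_sum]; exact sum_comm
theorem Ex_const (r : E → ℝ) (S : Finset E) (a : ℝ) : Ex r S (fun _ => a) = a := by
  induction S using Finset.induction_on with
  | empty => exact Ex_empty _ _
  | insert e S he ih => rw [Ex_insert r he, ih]; ring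
theorem Ex_nonneg {r : E → ℝ} (hr : ∀ e, 0 ≤ r e) {S : Finset E} {f : Finset E → ℝ}
    (h : ∀ T ⊆ S, 0 ≤ f T) : 0 ≤ Ex r S f :=
  sum_nonneg fun T hT => mul_nonneg (wt_nonneg hr S T) (h T (mem_powerset.1 hT))
theorem Pr_nonneg {r : E → ℝ} (hr : ∀ e, 0 ≤ r e) (S : Finset E) (A) : 0 ≤ Pr r S A :=
  Ex_nonneg hr fun _ _ => ind_nonneg _
theorem Pr_mono {r : E → ℝ} (hr : ∀ e, 0 ≤ r e) {S : Finset E} {A B : Finset E → Prop}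
    (h : ∀ T ⊆ S, A T → B T) : Pr r S A ≤ Pr r S B := Ex_mono hr fun T hT => ind_mono (h T hT)
theorem Pr_congr {r : E → ℝ} {S : Finset E} {A B : Finset E → Prop}
    (h : ∀ T ⊆ S, (A T ↔ B T)) : Pr r S A = Pr r S B := Ex_congr fun T hT => ind_congr (h T hT)
theorem Pr_le_one {r : E → ℝ} (hr : ∀ e, 0 ≤ r e) (S : Finset E) (A) : Pr r S A ≤ 1 := by
  rw [← Ex_const r S 1]; exact Ex_mono hr fun _ _ => ind_le_one _
theorem Pr_true {r : E → ℝ} {S : Finset E} {A : Finset E → Prop} (h : ∀ T ⊆ S, A T) :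
    Pr r S A = 1 := by
  rw [← Ex_const r S 1]; exact Ex_congr fun T hT => ind_true (h T hT)
theorem Pr_false {r : E → ℝ} {S : Finset E} {A : Finset E → Prop} (h : ∀ T ⊆ S, ¬ A T) :
    Pr r S A = 0 := by
  rw [← Ex_const r S 0]; exact Ex_congr fun T hT => ind_false (h T hT)
theorem Pr_not (r : E → ℝ) (S : Finset E) (A : Finset E → Prop) :
    Pr r S (fun T => ¬ A T) = 1 - Pr r S A := by
  unfold Pr
  rw [Ex_congr (g := fun T => 1 - ind (A T)) (fun T _ => ind_not _), Ex_sub, Ex_const]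
theorem Pr_or_le {r : E → ℝ} (hr : ∀ e, 0 ≤ r e) (S : Finset E) (A B : Finset E → Prop) :
    Pr r S (fun T => A T ∨ B T) ≤ Pr r S A + Pr r S B := by
  unfold Pr; rw [← Ex_add]; exact Ex_mono hr fun T _ => ind_or_le _ _
theorem Pr_exists_le {r : E → ℝ} (hr : ∀ e, 0 ≤ r e) (S : Finset E) {ι : Type*} (s : Finset ι)
    (A : ι → Finset E → Prop) (P : Finset E → Prop) (h : ∀ T ⊆ S, P T → ∃ i ∈ s, A i T) :
    Pr r S P ≤ ∑ i ∈ s, Pr r S (A i) := by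
  unfold Pr; rw [← Ex_sum]
  exact Ex_mono hr fun T hT => ind_exists_le s (fun i => A i T) _ (h T hT)
theorem Ex_partition {X : Type*} (s : Finset X) (D : Finset E → X) {r : E → ℝ} {S : Finset E}
    (h : ∀ T ⊆ S, D T ∈ s) (f : Finset E → ℝ) :
    Ex r S f = ∑ x ∈ s, Ex r S (fun T => ind (D T = x) * f T) := by
  rw [← Ex_sum]
  refine Ex_congr fun T hT => ?_
  rw [Finset.sum_eq_single (D T)]
  · rw [ind_true rfl, one_mul]
  · intro x _ hx; rw [ind_false (Ne.symm hx), zero_mul]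
  · intro hx; exact absurd (h T hT) hx

theorem Ex_union (r : E → ℝ) {S S' : Finset E} (h : Disjoint S S') (f : Finset E → ℝ) :
    Ex r (S ∪ S') f = Ex r S (fun T => Ex r S' (fun T' => f (T ∪ T'))) := by
  induction S using Finset.induction_on generalizing f with
  | empty => simp [Ex_empty]
  | insert e S he ih =>
    rw [Finset.disjoint_insert_left] at h
    rw [Finset.insert_union, Ex_insert r (by simp [he, h.1]), Ex_insert r he, ih h.2, ih h.2]
    simp only [Finset.insert_union]
theorem Dep.mono {X : Type*} {π π' : E → Prop} {f : Finset E → X} (h : Dep π f) (hp : ∀ e, π e → π' e) :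
    Dep π' f := fun T T' hT => h T T' fun e he => hT e (hp e he)
theorem Dep.ins {X : Type*} {π : E → Prop} {f : Finset E → X} (h : Dep π f) (e : E) :
    Dep π (fun T => f (insert e T)) := fun T T' hT => h _ _ fun e' he' => by
  simp only [mem_insert, hT e' he']
theorem Dep.ins_eq {X : Type*} {π : E → Prop} {f : Finset E → X} (h : Dep π f) {e : E} (he : ¬ π e) (T) :
    f (insert e T) = f T := h _ _ fun e' he' => by
  rw [mem_insert]; constructor
  · rintro (rfl | h); exacts [absurd he' he, h]
  · exact Or.inr
theorem Dep.ex_insert {π : E → Prop} {f : Finset E → ℝ} (h : Dep π f) {e : E} (he : ¬ π e)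
    (r : E → ℝ) {S : Finset E} (heS : e ∉ S) : Ex r (insert e S) f = Ex r S f := by
  rw [Ex_insert r heS, Ex_congr (f := fun T => f (insert e T)) (fun T _ => h.ins_eq he T)]; ring
theorem Ex_indep {π : E → Prop} {f g : Finset E → ℝ} (hf : Dep π f) (hg : Dep (fun e => ¬ π e) g)
    (r : E → ℝ) (S : Finset E) : Ex r S (fun T => f T * g T) = Ex r S f * Ex r S g := by
  induction S using Finset.induction_on generalizing f g with
  | empty => simp [Ex_empty]
  | insert e S he ih =>
    by_cases hp : π e
    · rw [hg.ex_insert (not_not.2 hp) r he, Ex_insert r he, Ex_insert r he]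
      rw [add_mul, mul_assoc, mul_assoc, ← ih (hf.ins e) hg, ← ih hf hg]
      congr 2
      exact Ex_congr fun T _ => by rw [hg.ins_eq (not_not.2 hp)]
    · rw [hf.ex_insert hp r he, Ex_insert r he, Ex_insert r he, mul_add, mul_left_comm,
        mul_left_comm (Ex r S f), ← ih hf hg, ← ih hf (hg.ins e)]
      congr 2
      exact Ex_congr fun T _ => by rw [hf.ins_eq hp]
theorem Dep.ind {π : E → Prop} {A : Finset E → Prop} (h : Dep π A) : Dep π (fun T => ind (A T)) :=
  fun T T' hT => by simp only [h T T' hT]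
theorem Dep.mul {π : E → Prop} {f g : Finset E → ℝ} (hf : Dep π f) (hg : Dep π g) :
    Dep π (fun T => f T * g T) := fun T T' hT => by simp only [hf T T' hT, hg T T' hT]
theorem Pr_indep {π : E → Prop} {A B : Finset E → Prop} (hf : Dep π A) (hg : Dep (fun e => ¬ π e) B)
    (r : E → ℝ) (S : Finset E) : Pr r S (fun T => A T ∧ B T) = Pr r S A * Pr r S B := by
  unfold Pr; rw [← Ex_indep hf.ind hg.ind]; exact Ex_congr fun T _ => ind_and _ _
theorem Ex_filter {π : E → Prop} {f : Finset E → ℝ} (hf : Dep π f) (r : E → ℝ) (S : Finset E) :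
    Ex r S f = Ex r (S.filter π) f := by
  induction S using Finset.induction_on generalizing f with
  | empty => simp
  | insert e S he ih =>
    by_cases hp : π e
    · rw [Finset.filter_insert, if_pos hp, Ex_insert r he, Ex_insert r (by simp [he]), ih hf, ih (hf.ins e)]
    · rw [Finset.filter_insert, if_neg hp, hf.ex_insert hp r he, ih hf]
theorem Ex_rate_congr {r r' : E → ℝ} {S : Finset E} (h : ∀ e ∈ S, r e = r' e) (f) :
    Ex r S f = Ex r' S f := by
  unfold Ex
  refine sum_congr rfl fun T hT => ?_
  rw [mem_powerset] at hT
  congr 2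
  · exact prod_congr rfl fun e he => by rw [h e (hT he)]
  · exact prod_congr rfl fun e he => by rw [h e (sdiff_subset he)]
theorem Ex_dep_congr {π : E → Prop} {f : Finset E → ℝ} (hf : Dep π f) {r r' : E → ℝ} {S S' : Finset E}
    (hS : ∀ e, π e → (e ∈ S ↔ e ∈ S')) (hr : ∀ e ∈ S, π e → r e = r' e) : Ex r S f = Ex r' S' f := by
  rw [Ex_filter hf r S, Ex_filter hf r' S']
  have : S.filter π = S'.filter π := by
    ext e; simp only [mem_filter]
    constructor
    · rintro ⟨h1, h2⟩; exact ⟨(hS e h2).1 h1, h2⟩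
    · rintro ⟨h1, h2⟩; exact ⟨(hS e h2).2 h1, h2⟩
  rw [← this]
  exact Ex_rate_congr (fun e he => hr e (mem_filter.1 he).1 (mem_filter.1 he).2) _
theorem Pr_dep_congr {π : E → Prop} {A : Finset E → Prop} (hf : Dep π A) {r r' : E → ℝ} {S S' : Finset E}
    (hS : ∀ e, π e → (e ∈ S ↔ e ∈ S')) (hr : ∀ e ∈ S, π e → r e = r' e) : Pr r S A = Pr r' S' A :=
  Ex_dep_congr hf.ind hS hr
theorem Ex_sprinkle (r r' : E → ℝ) (S : Finset E) (f : Finset E → ℝ) :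
    Ex (fun e => r e + r' e) S f = Ex r S (fun T => Ex r' S (fun T' => f (T ∪ T'))) := by
  induction S using Finset.induction_on generalizing f with
  | empty => simp [Ex_empty]
  | insert e S he ih =>
    rw [Ex_insert _ he, ih, ih, Ex_insert r he]
    simp only [Ex_insert r' he]
    simp only [Finset.insert_union, Finset.union_insert, Finset.insert_idem, Ex_add, Ex_mul]
    rw [neg_add, Real.exp_add]; ring
theorem Ex_rate_mono {r r' : E → ℝ} (hr : ∀ e, 0 ≤ r e) (h : ∀ e, r e ≤ r' e) {S : Finset E}
    {f : Finset E → ℝ} (hf : ∀ T T', T ⊆ T' → f T ≤ f T') : Ex r S f ≤ Ex r' S f := by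
  have : r' = fun e => r e + (r' e - r e) := by ext e; ring
  rw [this, Ex_sprinkle]
  refine Ex_mono hr fun T _ => ?_
  rw [← Ex_const (fun e => r' e - r e) S (f T)]
  exact Ex_mono (fun e => sub_nonneg.2 (h e)) fun T' _ => hf _ _ subset_union_left
def Inc (A : Finset E → Prop) : Prop := ∀ T T', T ⊆ T' → A T → A T'
theorem Pr_rate_mono {r r' : E → ℝ} (hr : ∀ e, 0 ≤ r e) (h : ∀ e, r e ≤ r' e) {S : Finset E}
    {A : Finset E → Prop} (hA : Inc A) : Pr r S A ≤ Pr r' S A :=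
  Ex_rate_mono hr h fun T T' hT => ind_mono (hA T T' hT)
theorem Ex_map {E' : Type*} [DecidableEq E'] (φ : E ↪ E') (r : E' → ℝ) (S : Finset E) (f) :
    Ex r (S.map φ) f = Ex (fun e => r (φ e)) S (fun T => f (T.map φ)) := by
  induction S using Finset.induction_on generalizing f with
  | empty => simp [Ex_empty]
  | insert e S he ih =>
    rw [Finset.map_insert, Ex_insert r (by simpa using he), Ex_insert _ he, ih, ih]
    simp only [Finset.map_insert]
theorem Pr_none {r : E → ℝ} {S F : Finset E} (hF : F ⊆ S) :
    Pr r S (fun T => ∀ e ∈ F, e ∉ T) = Real.exp (-∑ e ∈ F, r e) := by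
  have hd : Dep (fun e => e ∈ F) (fun T : Finset E => ∀ e ∈ F, e ∉ T) := fun T T' h => by
    refine propext (forall₂_congr fun e he => ?_); rw [h e he]
  rw [Pr_dep_congr hd (S' := F) (r' := r) (fun e he => ⟨fun _ => he, fun _ => hF he⟩) (fun _ _ _ => rfl)]
  unfold Pr Ex
  rw [Finset.sum_eq_single ∅]
  all_goals beta_reduce
  · rw [ind_true (by simp)]; simp [Real.exp_sum, ← Finset.sum_neg_distrib]
  · intro T hT hne
    obtain ⟨e, he⟩ := Finset.nonempty_iff_ne_empty.2 hne
    rw [ind_false (fun h => h e (mem_powerset.1 hT he) he), mul_zero]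
  · simp
theorem Pr_mem {r : E → ℝ} {S : Finset E} {e : E} (he : e ∈ S) :
    Pr r S (fun T => e ∈ T) = 1 - Real.exp (-r e) := by
  have := Pr_none (r := r) (S := S) (F := {e}) (by simpa using he)
  have h2 := Pr_not r S (fun T => e ∉ T)
  simp only [not_not] at h2
  rw [h2]; simp only [Finset.mem_singleton, forall_eq, Finset.sum_singleton] at this; rw [this]
theorem Pr_mem_le {r : E → ℝ} (hr : ∀ e, 0 ≤ r e) {S : Finset E} {e : E} :
    Pr r S (fun T => e ∈ T) ≤ r e := by
  by_cases he : e ∈ S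
  · rw [Pr_mem he]; linarith [Real.add_one_le_exp (-r e)]
  · rw [Pr_false (fun T hT h => he (hT h))]; exact hr e

/-- disjoint occurrence -/
def dj (A B : Finset E → Prop) (T : Finset E) : Prop :=
  ∃ F₁ F₂, F₁ ⊆ T ∧ F₂ ⊆ T ∧ Disjoint F₁ F₂ ∧ A F₁ ∧ B F₂
theorem dj_inc (A B : Finset E → Prop) : Inc (dj A B) := by
  rintro T T' h ⟨F, G, h1, h2, h3⟩; exact ⟨F, G, h1.trans h, h2.trans h, h3⟩
theorem dj_mono {A B A' B' : Finset E → Prop} (hA : ∀ T, A T → A' T) (hB : ∀ T, B T → B' T) {T}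
    (h : dj A B T) : dj A' B' T := by
  obtain ⟨F, G, h1, h2, h3, h4, h5⟩ := h; exact ⟨F, G, h1, h2, h3, hA _ h4, hB _ h5⟩
theorem BK {r : E → ℝ} (hr : ∀ e, 0 ≤ r e) (S : Finset E) {A B : Finset E → Prop} (hA : Inc A) (hB : Inc B) :
    Pr r S (dj A B) ≤ Pr r S A * Pr r S B := by
  induction S using Finset.induction_on generalizing A B with
  | empty =>
    unfold Pr; rw [Ex_empty, Ex_empty, Ex_empty, ← ind_and]
    refine ind_mono ?_
    rintro ⟨F, G, h1, h2, h3, h4, h5⟩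
    rw [Finset.subset_empty] at h1 h2; subst h1; subst h2; exact ⟨h4, h5⟩
  | insert e S he ih =>
    have hins : ∀ X : Finset E → Prop, Pr r (insert e S) X = (1 - Real.exp (-r e)) *
      Pr r S (fun T => X (insert e T)) + Real.exp (-r e) * Pr r S X := fun X => Ex_insert r he _
    rw [hins, hins A, hins B]
    set A1 : Finset E → Prop := fun T => A (insert e T)
    set B1 : Finset E → Prop := fun T => B (insert e T)
    have hA1 : Inc A1 := fun T T' h => hA _ _ (Finset.insert_subset_insert _ h)
    have hB1 : Inc B1 := fun T T' h => hB _ _ (Finset.insert_subset_insert _ h)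
    have hAA : ∀ T, A T → A1 T := fun T => hA _ _ (subset_insert _ _)
    have hBB : ∀ T, B T → B1 T := fun T => hB _ _ (subset_insert _ _)
    have key : ∀ T ⊆ S, dj A B (insert e T) → dj A1 B T ∨ dj A B1 T := by
      rintro T hT ⟨F, G, h1, h2, h3, h4, h5⟩
      by_cases hG : e ∈ G
      · have hF : e ∉ F := fun h => disjoint_left.1 h3 h hG
        right
        refine ⟨F, G.erase e, ?_, ?_, h3.mono_right (Finset.erase_subset _ _), h4, ?_⟩
        · intro x hx; rcases mem_insert.1 (h1 hx) with rfl | h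
          exacts [absurd hx hF, h]
        · intro x hx; rw [Finset.mem_erase] at hx
          exact (mem_insert.1 (h2 hx.2)).resolve_left hx.1
        · show B _; rwa [Finset.insert_erase hG]
      · left
        refine ⟨F.erase e, G, ?_, ?_, h3.mono_left (Finset.erase_subset _ _), ?_, h5⟩
        · intro x hx; rw [Finset.mem_erase] at hx
          exact (mem_insert.1 (h1 hx.2)).resolve_left hx.1
        · intro x hx; rcases mem_insert.1 (h2 hx) with rfl | h
          exacts [absurd hx hG, h]
        · refine hA _ _ ?_ h4
          intro x hx; by_cases hxe : x = e <;> simp [hxe, hx]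
    set U := Pr r S (fun T => dj A1 B T ∨ dj A B1 T)
    have u0 : Pr r S (fun T => dj A B (insert e T)) ≤ U := Pr_mono hr key
    have u1 : U ≤ Pr r S (dj A1 B1) := Pr_mono hr fun T _ h => by
      rcases h with h | h
      · exact dj_mono (fun _ => id) hBB h
      · exact dj_mono hAA (fun _ => id) h
    have u2 : U + Pr r S (dj A B) ≤ Pr r S (dj A1 B) + Pr r S (dj A B1) := by
      show Ex _ _ _ + Ex _ _ _ ≤ Ex _ _ _ + Ex _ _ _
      rw [← Ex_add, ← Ex_add]
      refine Ex_mono hr fun T _ => ?_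
      have h1 : dj A B T → dj A1 B T := dj_mono hAA (fun _ => id)
      have h2 : dj A B T → dj A B1 T := dj_mono (fun _ => id) hBB
      unfold ind; split_ifs <;> first | (exfalso; tauto; done) | norm_num
    have i00 := ih hA hB
    have i01 := ih hA hB1
    have i10 := ih hA1 hB
    have i11 := ih hA1 hB1
    have ma : Pr r S A ≤ Pr r S A1 := Pr_mono hr fun T _ => hAA T
    have mb : Pr r S B ≤ Pr r S B1 := Pr_mono hr fun T _ => hBB T
    have hq := (Real.exp_pos (-r e)).le
    have hq1 : Real.exp (-r e) ≤ 1 := Real.exp_le_one_iff.2 (neg_nonpos.2 (hr e))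
    set q := Real.exp (-r e)
    generalize Pr r S A = a0 at *
    generalize Pr r S A1 = a1 at *
    generalize Pr r S B = b0 at *
    generalize Pr r S B1 = b1 at *
    have hab := mul_nonneg (sub_nonneg.2 ma) (sub_nonneg.2 mb)
    have v0 := mul_le_mul_of_nonneg_left u0 (sub_nonneg.2 hq1)
    rcases le_total (1 - q) q with hc | hc
    · have v1 := mul_le_mul_of_nonneg_left u2 (sub_nonneg.2 hq1)
      have v2 := mul_le_mul_of_nonneg_left (add_le_add i10 i01) (sub_nonneg.2 hq1)
      have v3 := mul_le_mul_of_nonneg_left i00 (sub_nonneg.2 hc)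
      have v4 := mul_nonneg (sq_nonneg (1 - q)) hab
      nlinarith
    · have v1 := mul_le_mul_of_nonneg_left u2 hq
      have v2 := mul_le_mul_of_nonneg_left (add_le_add i10 i01) hq
      have v3 := mul_le_mul_of_nonneg_left (u1.trans i11) (sub_nonneg.2 hc)
      have v4 := mul_nonneg (sq_nonneg q) hab
      nlinarith
end basics

section graph
open scoped Classical
variable {E : Type*} [DecidableEq E] {U : Type*} [DecidableEq U]

theorem Ex_cond {X : Type*} (s : Finset X) (D : Finset E → X) {r : E → ℝ} {S : Finset E}
    (hD : ∀ T ⊆ S, D T ∈ s) (F : X → Finset E → ℝ)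
    (h : ∀ x ∈ s, ∃ π : E → Prop, Dep π (fun T => D T = x) ∧ Dep (fun e => ¬ π e) (F x)) :
    Ex r S (fun T => F (D T) T) = Ex r S (fun T => Ex r S (F (D T))) := by
  rw [Ex_partition s D hD, Ex_partition s D hD]
  refine sum_congr rfl fun x hx => ?_
  obtain ⟨π, h1, h2⟩ := h x hx
  rw [Ex_congr (g := fun T => ind (D T = x) * F x T), Ex_indep h1.ind h2, mul_comm, ← Ex_mul]
  · refine Ex_congr fun T _ => ?_
    by_cases hx : D T = x
    · rw [hx]; ring
    · rw [ind_false hx]; ring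
  · intro T _
    by_cases hx : D T = x
    · rw [hx]
    · rw [ind_false hx]; ring

def cn (T : Finset (Sym2 U)) (B : Finset U) (x y : U) : Prop :=
  x ∈ B ∧ Relation.ReflTransGen (fun a b => a ∈ B ∧ b ∈ B ∧ s(a, b) ∈ T) x y
variable {T T' : Finset (Sym2 U)} {B B' C : Finset U} {x y z a b : U}
theorem cn_refl (h : x ∈ B) : cn T B x x := ⟨h, .refl⟩
theorem cn.left (h : cn T B x y) : x ∈ B := h.1
theorem cn.right (h : cn T B x y) : y ∈ B := by
  obtain ⟨h1, h2⟩ := h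
  induction h2 with
  | refl => exact h1
  | tail _ h _ => exact h.2.1
theorem cn.trans (h : cn T B x y) (h' : cn T B y z) : cn T B x z := ⟨h.1, h.2.trans h'.2⟩
theorem cn_edge (hx : x ∈ B) (hy : y ∈ B) (h : s(x, y) ∈ T) : cn T B x y :=
  ⟨hx, .single ⟨hx, hy, h⟩⟩
theorem cn.step (h : cn T B x y) (hz : z ∈ B) (h' : s(y, z) ∈ T) : cn T B x z :=
  h.trans (cn_edge h.right hz h')
theorem cn.symm (h : cn T B x y) : cn T B y x := by
  refine ⟨h.right, ?_⟩
  have h2 := h.2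
  clear h
  induction h2 with
  | refl => exact .refl
  | tail _ h ih => exact .head ⟨h.2.1, h.1, by rw [Sym2.eq_swap]; exact h.2.2⟩ ih
theorem cn_comm : cn T B x y ↔ cn T B y x := ⟨cn.symm, cn.symm⟩
theorem cn.mono (h : cn T B x y) (hT : T ⊆ T') (hB : B ⊆ B') : cn T' B' x y :=
  ⟨hB h.1, Relation.ReflTransGen.mono (fun _ _ h => ⟨hB h.1, hB h.2.1, hT h.2.2⟩) _ _ h.2⟩
theorem cn_inc (B : Finset U) (x y : U) : Inc (fun T => cn T B x y) := fun _ _ h h' => h'.mono h subset_rfl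
/-- induction from the left end, all vertices reached satisfy `p` -/
theorem cn.ind_on {p : U → Prop} (h : cn T B x y) (hx : p x)
    (hs : ∀ a b, cn T B x a → p a → b ∈ B → s(a, b) ∈ T → p b) : p y := by
  obtain ⟨h1, h2⟩ := h
  induction h2 with
  | refl => exact hx
  | tail h' h ih => exact hs _ _ ⟨h1, h'⟩ ih h.2.1 h.2.2
theorem cn.agree (h : cn T B x y) (hT : ∀ a b, cn T B x a → b ∈ B → a ≠ b → s(a, b) ∈ T → s(a, b) ∈ T') :
    cn T' B x y := by
  refine h.ind_on (p := fun v => cn T' B x v) (cn_refl h.1) fun a b h1 h2 h3 h4 => ?_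
  by_cases hab : a = b
  · exact hab ▸ h2
  · exact h2.step h3 (hT a b h1 h3 hab h4)
def inner (B : Finset U) (e : Sym2 U) : Prop := e ∈ B.sym2 ∧ ¬ e.IsDiag
theorem inner_mk (ha : a ∈ B) (hb : b ∈ B) (h : a ≠ b) : inner B s(a, b) :=
  ⟨mk_mem_sym2_iff.2 ⟨ha, hb⟩, by simpa using h⟩
theorem cn_dep (B : Finset U) (x y : U) : Dep (inner B) (fun T => cn T B x y) := by
  intro T T' h
  refine propext ⟨fun hc => hc.agree fun a b h1 h2 h3 h4 => ?_, fun hc => hc.agree fun a b h1 h2 h3 h4 => ?_⟩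
  · exact (h _ (inner_mk h1.right h2 h3)).1 h4
  · exact (h _ (inner_mk h1.right h2 h3)).2 h4
theorem cn.last_exit (h : cn T B x y) (hx : x ∈ C) (hy : y ∉ C) :
    ∃ a ∈ C, ∃ b ∈ B \ C, s(a, b) ∈ T ∧ cn T B x a ∧ cn T (B \ C) b y := by
  have : y ∈ C ∨ ∃ a ∈ C, ∃ b ∈ B \ C, s(a, b) ∈ T ∧ cn T B x a ∧ cn T (B \ C) b y := by
    refine h.ind_on (p := fun y => y ∈ C ∨ ∃ a ∈ C, ∃ b ∈ B \ C, s(a, b) ∈ T ∧ cn T B x a ∧ cn T (B \ C) b y)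
      (Or.inl hx) fun u v h1 h2 h3 h4 => ?_
    by_cases hv : v ∈ C
    · exact Or.inl hv
    right
    have hvB : v ∈ B \ C := mem_sdiff.2 ⟨h3, hv⟩
    by_cases hu : u ∈ C
    · exact ⟨u, hu, v, hvB, h4, h1, cn_refl hvB⟩
    · obtain ⟨a, ha, b, hb, hab, hxa, hbu⟩ := h2.resolve_left hu
      exact ⟨a, ha, b, hb, hab, hxa, hbu.step hvB h4⟩
  exact this.resolve_left hy

noncomputable def clS (σ : U → Prop) (T : Finset (Sym2 U)) (B : Finset U) : Finset U :=
  B.filter fun y => ∃ a, σ a ∧ cn T B a y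
noncomputable def cl (T : Finset (Sym2 U)) (B : Finset U) (x : U) : Finset U := B.filter (cn T B x)
theorem mem_clS {σ : U → Prop} : y ∈ clS σ T B ↔ ∃ a, σ a ∧ cn T B a y := by
  simp only [clS, mem_filter, and_iff_right_iff_imp]
  rintro ⟨a, _, h⟩; exact h.right
theorem mem_cl : y ∈ cl T B x ↔ cn T B x y := by
  simp only [cl, mem_filter, and_iff_right_iff_imp]; exact cn.right
theorem clS_sub (σ : U → Prop) (T) (B : Finset U) : clS σ T B ⊆ B := filter_subset _ _
theorem cl_sub (T) (B : Finset U) (x) : cl T B x ⊆ B := filter_subset _ _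
theorem cl_eq_clS : cl T B x = clS (fun a => a = x) T B := by
  ext y; simp [mem_cl, mem_clS]
def touch (D : Finset U) (e : Sym2 U) : Prop := ∃ y ∈ D, y ∈ e
theorem touch_left (h : a ∈ C) : touch C s(a, b) := ⟨a, h, Sym2.mem_mk_left _ _⟩
theorem touch_right (h : b ∈ C) : touch C s(a, b) := ⟨b, h, Sym2.mem_mk_right _ _⟩
theorem explore {σ : U → Prop} {D : Finset U} (h : clS σ T B = D)
    (hT : ∀ e, inner B e → touch D e → (e ∈ T ↔ e ∈ T')) : clS σ T' B = D := by
  ext y; rw [← h, mem_clS, mem_clS]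
  constructor
  · rintro ⟨a, ha, hc⟩
    refine ⟨a, ha, ?_⟩
    refine hc.ind_on (p := fun v => cn T B a v) (cn_refl hc.1) fun u v h1 h2 h3 h4 => ?_
    by_cases huv : u = v
    · exact huv ▸ h2
    refine h2.step h3 ((hT _ (inner_mk h1.right h3 huv) (touch_left ?_)).2 h4)
    rw [← h, mem_clS]; exact ⟨a, ha, h2⟩
  · rintro ⟨a, ha, hc⟩
    refine ⟨a, ha, hc.agree fun u v h1 h2 h3 h4 => ?_⟩
    refine (hT _ (inner_mk h1.right h2 h3) (touch_left ?_)).1 h4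
    rw [← h, mem_clS]; exact ⟨a, ha, h1⟩
theorem clS_dep {σ : Finset (Sym2 U) → U → Prop} {D : Finset U} {π : Sym2 U → Prop} (B : Finset U) (hσ : Dep π σ)
    (hπ : ∀ e, inner B e → touch D e → π e) : Dep π (fun T => clS (σ T) T B = D) := by
  intro T T' h
  have := hσ T T' h
  refine propext ⟨fun hc => ?_, fun hc => ?_⟩
  · beta_reduce; rw [← this]; exact explore hc fun e he ht => h e (hπ e he ht)
  · beta_reduce; rw [this]; exact explore hc fun e he ht => (h e (hπ e he ht)).symm
theorem cl_dep {D : Finset U} (B : Finset U) (x : U) :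
    Dep (fun e => inner B e ∧ touch D e) (fun T => cl T B x = D) := by
  simp only [cl_eq_clS]
  exact clS_dep B (fun _ _ _ => rfl) fun e h1 h2 => ⟨h1, h2⟩

/-- two-point function in the box `B` -/
noncomputable def tau (r : Sym2 U → ℝ) (B : Finset U) (x y : U) : ℝ := Pr r B.sym2 fun T => cn T B x y
variable {r r' : Sym2 U → ℝ}
theorem Pr_cn {S : Finset (Sym2 U)} (hS : B.sym2 ⊆ S) : Pr r S (fun T => cn T B x y) = tau r B x y :=
  Pr_dep_congr (cn_dep B x y) (fun _ he => ⟨fun _ => he.1, fun h => hS h⟩) fun _ _ _ => rfl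
theorem tau_rate (h : ∀ e, inner B e → r e = r' e) : tau r B x y = tau r' B x y :=
  Pr_dep_congr (cn_dep B x y) (fun _ _ => Iff.rfl) fun e _ he => h e he
theorem tau_nonneg (hr : ∀ e, 0 ≤ r e) : 0 ≤ tau r B x y := Pr_nonneg hr _ _
theorem tau_le_one (hr : ∀ e, 0 ≤ r e) : tau r B x y ≤ 1 := Pr_le_one hr _ _
theorem tau_comm : tau r B x y = tau r B y x := Pr_congr fun _ _ => cn_comm
theorem tau_refl (h : x ∈ B) : tau r B x x = 1 := Pr_true fun _ _ => cn_refl h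
theorem tau_mono (hr : ∀ e, 0 ≤ r e) (h : B ⊆ B') : tau r B x y ≤ tau r B' x y := by
  rw [← Pr_cn (r := r) (B := B) (sym2_mono h)]
  exact Pr_mono hr fun _ _ hc => hc.mono subset_rfl h
theorem tau_zero_left (h : x ∉ B) : tau r B x y = 0 := Pr_false fun _ _ hc => h hc.left
theorem tau_zero_right (h : y ∉ B) : tau r B x y = 0 := Pr_false fun _ _ hc => h hc.right
theorem tau_rate_mono (hr : ∀ e, 0 ≤ r e) (h : ∀ e, r e ≤ r' e) : tau r B x y ≤ tau r' B x y :=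
  Pr_rate_mono hr h (cn_inc B x y)
theorem Ex_card_cl {S : Finset (Sym2 U)} (hS : B.sym2 ⊆ S) (f : U → ℝ) :
    Ex r S (fun T => ∑ y ∈ cl T B x, f y) = ∑ y ∈ B, tau r B x y * f y := by
  rw [Ex_congr (g := fun T => ∑ y ∈ B, f y * ind (cn T B x y)), Ex_sum]
  · refine sum_congr rfl fun y _ => ?_
    rw [Ex_mul, ← Pr_cn hS, mul_comm]; rfl
  · intro T _
    rw [cl, Finset.sum_filter]
    refine sum_congr rfl fun y _ => ?_
    unfold ind; split_ifs <;> simp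

theorem exit_gen (hr : ∀ e, 0 ≤ r e) (hC : C ⊆ B) (hx : x ∈ C) :
    Pr r B.sym2 (fun T => cn T B x y ∧ ¬ cn T C x y) ≤ ∑ a ∈ C, ∑ b ∈ B \ C, tau r C x a * r s(a, b) * tau r B b y := by
  have hCS : C.sym2 ⊆ B.sym2 := sym2_mono hC
  set F : Finset U → Finset (Sym2 U) → ℝ := fun D T =>
    ∑ a ∈ D, ∑ b ∈ B \ C, ind (s(a, b) ∈ T) * ind (cn T (B \ D) b y) with hF
  have h1 : Pr r B.sym2 (fun T => cn T B x y ∧ ¬ cn T C x y) ≤ Ex r B.sym2 (fun T => F (cl T C x) T) := by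
    refine Ex_mono hr fun T _ => ?_
    by_cases h : cn T B x y ∧ ¬ cn T C x y
    · rw [ind_true h]
      have hxD : x ∈ cl T C x := mem_cl.2 (cn_refl hx)
      have hyD : y ∉ cl T C x := fun hh => h.2 (mem_cl.1 hh)
      obtain ⟨a, ha, b, hb, hab, -, hby⟩ := h.1.last_exit hxD hyD
      have hbC : b ∈ B \ C := by
        refine mem_sdiff.2 ⟨(mem_sdiff.1 hb).1, fun hbC => (mem_sdiff.1 hb).2 ?_⟩
        exact mem_cl.2 ((mem_cl.1 ha).step hbC hab)
      have e1 : (1 : ℝ) = ind (s(a, b) ∈ T) * ind (cn T (B \ cl T C x) b y) := by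
        rw [ind_true hab, ind_true hby, one_mul]
      rw [e1]
      refine le_trans ?_ (Finset.single_le_sum (f := fun a => ∑ b ∈ B \ C, ind (s(a, b) ∈ T) * ind (cn T (B \ cl T C x) b y))
        (fun i _ => sum_nonneg fun j _ => mul_nonneg (ind_nonneg _) (ind_nonneg _)) ha)
      exact Finset.single_le_sum (f := fun b => ind (s(a, b) ∈ T) * ind (cn T (B \ cl T C x) b y))
        (fun i _ => mul_nonneg (ind_nonneg _) (ind_nonneg _)) hbC
    · rw [ind_false h]
      exact sum_nonneg fun i _ => sum_nonneg fun j _ => mul_nonneg (ind_nonneg _) (ind_nonneg _)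
  refine h1.trans ?_
  rw [Ex_cond C.powerset (fun T => cl T C x) (fun T _ => mem_powerset.2 (cl_sub _ _ _)) F]
  · have h2 : ∀ T ⊆ B.sym2, Ex r B.sym2 (F (cl T C x)) ≤ ∑ a ∈ cl T C x, ∑ b ∈ B \ C, r s(a, b) * tau r B b y := by
      intro T _
      have hD := cl_sub T C x
      generalize cl T C x = D at *
      rw [hF]; dsimp only
      rw [Ex_sum]
      refine sum_le_sum fun a ha => ?_
      rw [Ex_sum]
      refine sum_le_sum fun b hb => ?_
      have i1 : Dep (fun e => e = s(a, b)) (fun T => ind (s(a, b) ∈ T)) :=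
        Dep.ind fun T T' h => propext (h _ rfl)
      have i2 : Dep (fun e => ¬ (e = s(a, b))) (fun T => ind (cn T (B \ D) b y)) :=
        Dep.ind ((cn_dep (B \ D) b y).mono fun e he => by
          rintro rfl
          have := (mk_mem_sym2_iff.1 he.1).1
          exact (mem_sdiff.1 this).2 ha)
      rw [Ex_indep i1 i2]
      refine mul_le_mul (Pr_mem_le hr) ?_ (Pr_nonneg hr _ _) (hr _)
      have : Ex r B.sym2 (fun T => ind (cn T (B \ D) b y)) = tau r (B \ D) b y :=
        Pr_cn (sym2_mono sdiff_subset)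
      rw [this]; exact tau_mono hr sdiff_subset
    refine (Ex_mono hr h2).trans (le_of_eq ?_)
    rw [Ex_card_cl hCS]
    refine sum_congr rfl fun a _ => ?_
    rw [mul_sum]
    exact sum_congr rfl fun b _ => by ring
  · intro D hD
    refine ⟨_, cl_dep C x, ?_⟩
    intro T T' h
    simp only [hF]
    refine sum_congr rfl fun a ha => sum_congr rfl fun b hb => ?_
    have hbC := (mem_sdiff.1 hb).2
    have e1 : (s(a, b) ∈ T ↔ s(a, b) ∈ T') := h _ fun hh => hbC (mk_mem_sym2_iff.1 hh.1.1).2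
    have e2 : cn T (B \ D) b y = cn T' (B \ D) b y := by
      refine cn_dep _ _ _ T T' fun e he => h e ?_
      rintro ⟨-, v, hv, hve⟩
      exact (mem_sdiff.1 (Finset.mem_sym2_iff.1 he.1 v hve)).2 hv
    rw [ind_congr e1, e2]
theorem exit_lemma (hr : ∀ e, 0 ≤ r e) (hC : C ⊆ B) (hx : x ∈ C) (hy : y ∈ B \ C) :
    tau r B x y ≤ ∑ a ∈ C, ∑ b ∈ B \ C, tau r C x a * r s(a, b) * tau r B b y := by
  refine le_trans (le_of_eq ?_) (exit_gen hr hC hx)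
  exact Pr_congr fun T _ => ⟨fun h => ⟨h, fun h' => (mem_sdiff.1 hy).2 h'.right⟩, fun h => h.1⟩
end graph

section lattice
open scoped Classical
variable {U : Type*} [DecidableEq U]

theorem cn_map (t : U ↪ U) {T : Finset (Sym2 U)} {B : Finset U} {x y : U} :
    cn (T.map t.sym2Map) (B.map t) (t x) (t y) ↔ cn T B x y := by
  constructor
  · intro h
    have := h.ind_on (p := fun w => ∃ v, w = t v ∧ cn T B x v)
      ⟨x, rfl, cn_refl (by simpa using h.left)⟩ (by
        rintro a b - ⟨v, rfl, hv⟩ hb hab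
        obtain ⟨w, hw, rfl⟩ := mem_map.1 hb
        refine ⟨w, rfl, hv.step hw ?_⟩
        obtain ⟨e, he, hee⟩ := mem_map.1 hab
        have : t.sym2Map s(v, w) = s(t v, t w) := rfl
        rw [← this] at hee
        rwa [← t.sym2Map.injective hee])
    obtain ⟨v, hv, hc⟩ := this
    rwa [t.injective hv]
  · rintro ⟨h1, h2⟩
    refine ⟨by simpa using h1, ?_⟩
    refine Relation.ReflTransGen.lift t ?_ _ _ h2
    rintro a b ⟨ha, hb, hab⟩
    exact ⟨by simpa using ha, by simpa using hb, mem_map.2 ⟨_, hab, rfl⟩⟩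
theorem Pr_map (t : U ↪ U) {r : Sym2 U → ℝ} (hr : ∀ e, r (t.sym2Map e) = r e) (B : Finset U)
    (A : Finset (Sym2 U) → Prop) :
    Pr r (B.map t).sym2 A = Pr r B.sym2 (fun T => A (T.map t.sym2Map)) := by
  unfold Pr; rw [Finset.sym2_map, Ex_map]; simp only [hr]
theorem tau_map (t : U ↪ U) {r : Sym2 U → ℝ} (hr : ∀ e, r (t.sym2Map e) = r e) (B : Finset U) (x y : U) :
    tau r (B.map t) (t x) (t y) = tau r B x y := by
  unfold tau; rw [Pr_map t hr]; simp only [cn_map]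

variable {d : ℕ} {J : V d → V d → ℝ} {α c C : ℝ}
noncomputable def Jsym (J : V d → V d → ℝ) (e : Sym2 (V d)) : ℝ :=
  Sym2.lift ⟨fun x y => (J x y + J y x) / 2, fun x y => by dsimp only; rw [add_comm]⟩ e
noncomputable def Rt (J : V d → V d → ℝ) (β h : ℝ) (e : Sym2 (V d)) : ℝ :=
  if e.IsDiag then h else β * Jsym J e
theorem Jsym_mk (hJ : KernelHyp d J α c C) (x y : V d) : Jsym J s(x, y) = J x y := by
  simp [Jsym, hJ.symm y x]
theorem Jsym_nonneg (hJ : KernelHyp d J α c C) (e) : 0 ≤ Jsym J e := by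
  induction e using Sym2.ind with | _ x y => rw [Jsym_mk hJ]; exact hJ.nonneg x y
theorem Rt_mk (hJ : KernelHyp d J α c C) (β h : ℝ) {x y : V d} (hxy : x ≠ y) : Rt J β h s(x, y) = β * J x y := by
  simp [Rt, hxy, Jsym_mk hJ]
theorem Rt_loop (β h : ℝ) (x : V d) : Rt J β h s(x, x) = h := by
  simp [Rt]
theorem Rt_nonneg (hJ : KernelHyp d J α c C) {β h : ℝ} (hβ : 0 ≤ β) (hh : 0 ≤ h) (e) : 0 ≤ Rt J β h e := by
  unfold Rt; split_ifs; exacts [hh, mul_nonneg hβ (Jsym_nonneg hJ e)]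
theorem Rt_mono (hJ : KernelHyp d J α c C) {β h β' h' : ℝ} (hβ : β ≤ β') (hh : h ≤ h') (e) :
    Rt J β h e ≤ Rt J β' h' e := by
  unfold Rt; split_ifs; exacts [hh, mul_le_mul_of_nonneg_right hβ (Jsym_nonneg hJ e)]
theorem Rt_add (β h β' h' : ℝ) : Rt J (β + β') (h + h') = fun e => Rt J β h e + Rt J β' h' e := by
  ext e; unfold Rt; split_ifs <;> ring
def sh (z : V d) : V d ↪ V d := ⟨fun x => x + z, fun x y h => by simpa using h⟩
theorem sh_apply (z x : V d) : sh z x = x + z := rfl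
theorem Rt_sh (hJ : KernelHyp d J α c C) (β h : ℝ) (z : V d) (e) : Rt J β h ((sh z).sym2Map e) = Rt J β h e := by
  induction e using Sym2.ind with
  | _ x y =>
    have : (sh z).sym2Map s(x, y) = s(x + z, y + z) := rfl
    rw [this]
    by_cases hxy : x = y
    · subst hxy; rw [Rt_loop, Rt_loop]
    · rw [Rt_mk hJ _ _ hxy, Rt_mk hJ _ _ (by simpa using hxy), hJ.transInv]
/-- two-point function -/
noncomputable def tt (J : V d → V d → ℝ) (β : ℝ) (B : Finset (V d)) (x y : V d) : ℝ := tau (Rt J β 0) B x y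
theorem tt_eq (β h : ℝ) (B : Finset (V d)) (x y : V d) : tau (Rt J β h) B x y = tt J β B x y :=
  tau_rate fun e he => by simp [Rt, he.2]
theorem Pr_tt {β h : ℝ} {B : Finset (V d)} {S} (hS : B.sym2 ⊆ S) (x y : V d) :
    Pr (Rt J β h) S (fun T => cn T B x y) = tt J β B x y := by rw [Pr_cn hS, tt_eq]
theorem tt_sh (hJ : KernelHyp d J α c C) (β : ℝ) (B : Finset (V d)) (x y z : V d) :
    tt J β (B.map (sh z)) (x + z) (y + z) = tt J β B x y := tau_map (sh z) (Rt_sh hJ β 0 z) B x y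
section
variable (hJ : KernelHyp d J α c C) {β β' : ℝ} (hβ : 0 ≤ β) {B B' : Finset (V d)} {x y : V d}
include hJ hβ
theorem tt_nonneg : 0 ≤ tt J β B x y := tau_nonneg (Rt_nonneg hJ hβ le_rfl)
theorem tt_le_one : tt J β B x y ≤ 1 := tau_le_one (Rt_nonneg hJ hβ le_rfl)
theorem tt_mono (h : B ⊆ B') : tt J β B x y ≤ tt J β B' x y := tau_mono (Rt_nonneg hJ hβ le_rfl) h
theorem tt_rate (h : β ≤ β') : tt J β B x y ≤ tt J β' B x y :=
  tau_rate_mono (Rt_nonneg hJ hβ le_rfl) (Rt_mono hJ h le_rfl)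
theorem tt_exit {C : Finset (V d)} (hC : C ⊆ B) (hx : x ∈ C) (hy : y ∈ B \ C) :
    tt J β B x y ≤ ∑ a ∈ C, ∑ b ∈ B \ C, tt J β C x a * (β * J a b) * tt J β B b y := by
  refine (exit_lemma (Rt_nonneg hJ hβ le_rfl) hC hx hy).trans (le_of_eq ?_)
  refine sum_congr rfl fun a ha => sum_congr rfl fun b hb => ?_
  rw [Rt_mk hJ]; · rfl
  rintro rfl; exact (mem_sdiff.1 hb).2 ha
end
theorem tt_comm {β : ℝ} {B : Finset (V d)} {x y : V d} : tt J β B x y = tt J β B y x := tau_comm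
noncomputable def jt (J : V d → V d → ℝ) : ℝ := ∑' x, J 0 x
theorem sum_J_le (hJ : KernelHyp d J α c C) (x : V d) (Y : Finset (V d)) : ∑ y ∈ Y, J x y ≤ jt J := by
  have : ∑ y ∈ Y, J x y = ∑ y ∈ Y.map (sh (-x)), J 0 y := by
    rw [sum_map]
    refine sum_congr rfl fun y _ => ?_
    rw [sh_apply, ← hJ.transInv x y (-x)]; simp
  rw [this]; exact hJ.integrable.sum_le_tsum _ fun y _ => hJ.nonneg 0 y
theorem jt_nonneg (hJ : KernelHyp d J α c C) : 0 ≤ jt J := tsum_nonneg fun y => hJ.nonneg 0 y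

def Sub (J : V d → V d → ℝ) (β : ℝ) : Prop := ∃ S : Finset (V d), 0 ∈ S ∧ ∀ Y : Finset (V d), Disjoint S Y →
  ∑ x ∈ S, ∑ y ∈ Y, tt J β S 0 x * (β * J x y) ≤ 1 / 2
theorem Sub.anti (hJ : KernelHyp d J α c C) {β β' : ℝ} (hβ : 0 ≤ β) (h : β ≤ β') (hs : Sub J β') : Sub J β := by
  obtain ⟨S, h0, hS⟩ := hs
  refine ⟨S, h0, fun Y hY => le_trans ?_ (hS Y hY)⟩
  refine sum_le_sum fun x _ => sum_le_sum fun y _ => ?_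
  have := hJ.nonneg x y
  exact mul_le_mul (tt_rate hJ hβ h) (by gcongr) (by positivity) (tt_nonneg hJ (hβ.trans h))
/-- uniform bound on the finite-volume susceptibility -/
def Chi (J : V d → V d → ℝ) (β K : ℝ) : Prop := ∀ (B : Finset (V d)) (x : V d), ∑ y ∈ B, tt J β B x y ≤ K
theorem Sub.chi (hJ : KernelHyp d J α c C) {β : ℝ} (hβ : 0 ≤ β) (hs : Sub J β) : ∃ K, 0 < K ∧ Chi J β K := by
  obtain ⟨S, h0, hS⟩ := hs
  have hSpos : 0 < S.card := card_pos.2 ⟨0, h0⟩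
  refine ⟨2 * S.card, by positivity, fun B x => ?_⟩
  by_cases hx : x ∈ B
  swap
  · have : ∀ y ∈ B, tt J β B x y = 0 := fun y _ => tau_zero_left hx
    rw [Finset.sum_eq_zero this]; positivity
  obtain ⟨x0, hx0, hmax⟩ := Finset.exists_max_image B (fun x => ∑ y ∈ B, tt J β B x y) ⟨x, hx⟩
  refine (hmax x hx).trans ?_
  set X := ∑ y ∈ B, tt J β B x0 y with hX
  set D := S.map (sh x0) ∩ B with hD
  have hDB : D ⊆ B := Finset.inter_subset_right
  have hxD : x0 ∈ D := Finset.mem_inter.2 ⟨mem_map.2 ⟨0, h0, by simp [sh_apply]⟩, hx0⟩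
  have h1 : ∑ y ∈ D, tt J β B x0 y ≤ S.card := by
    calc _ ≤ ∑ y ∈ D, (1:ℝ) := sum_le_sum fun _ _ => tt_le_one hJ hβ
      _ = D.card := by simp
      _ ≤ _ := by
        have : D.card ≤ (S.map (sh x0)).card := card_le_card Finset.inter_subset_left
        rw [Finset.card_map] at this; exact_mod_cast this
  have h2 : ∑ y ∈ B \ D, tt J β B x0 y ≤ X / 2 := by
    calc _ ≤ ∑ y ∈ B \ D, ∑ a ∈ D, ∑ b ∈ B \ D, tt J β D x0 a * (β * J a b) * tt J β B b y :=
          sum_le_sum fun y hy => tt_exit hJ hβ hDB hxD hy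
      _ = ∑ a ∈ D, ∑ b ∈ B \ D, tt J β D x0 a * (β * J a b) * ∑ y ∈ B \ D, tt J β B b y := by
          rw [sum_comm]; refine sum_congr rfl fun a _ => ?_
          rw [sum_comm]; refine sum_congr rfl fun b _ => ?_
          rw [mul_sum]
      _ ≤ ∑ a ∈ D, ∑ b ∈ B \ D, tt J β (S.map (sh x0)) x0 a * (β * J a b) * X := by
          refine sum_le_sum fun a _ => sum_le_sum fun b hb => ?_
          have := hJ.nonneg a b
          refine mul_le_mul (mul_le_mul_of_nonneg_right (tt_mono hJ hβ Finset.inter_subset_left) (by positivity)) ?_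
            (sum_nonneg fun _ _ => tt_nonneg hJ hβ) (mul_nonneg (tt_nonneg hJ hβ) (by positivity))
          exact (sum_le_sum_of_subset_of_nonneg sdiff_subset fun _ _ _ => tt_nonneg hJ hβ).trans
            (hmax b (mem_sdiff.1 hb).1)
      _ ≤ ∑ a ∈ S.map (sh x0), ∑ b ∈ B \ D, tt J β (S.map (sh x0)) x0 a * (β * J a b) * X := by
          refine sum_le_sum_of_subset_of_nonneg Finset.inter_subset_left fun a _ _ =>
            sum_nonneg fun b _ => ?_
          have := hJ.nonneg a b
          have : 0 ≤ X := sum_nonneg fun _ _ => tt_nonneg hJ hβ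
          exact mul_nonneg (mul_nonneg (tt_nonneg hJ hβ) (by positivity)) this
      _ = (∑ a ∈ S, ∑ b ∈ (B \ D).map (sh (-x0)), tt J β S 0 a * (β * J a b)) * X := by
          rw [sum_map, sum_mul]
          refine sum_congr rfl fun a _ => ?_
          rw [sum_map, sum_mul]
          refine sum_congr rfl fun b _ => ?_
          have e1 := tt_sh hJ β S 0 a x0
          rw [zero_add] at e1
          have e2 := hJ.transInv a (sh (-x0) b) x0
          rw [sh_apply, neg_add_cancel_right] at e2
          rw [sh_apply, sh_apply, e1, e2]
      _ ≤ 1 / 2 * X := by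
          refine mul_le_mul_of_nonneg_right (hS _ ?_) (sum_nonneg fun _ _ => tt_nonneg hJ hβ)
          rw [disjoint_left]
          intro v hv hv'
          obtain ⟨w, hw, rfl⟩ := mem_map.1 hv'
          rw [mem_sdiff] at hw
          refine hw.2 (Finset.mem_inter.2 ⟨mem_map.2 ⟨_, hv, ?_⟩, hw.1⟩)
          simp [sh_apply]
      _ = X / 2 := by ring
  have h3 := Finset.sum_sdiff hDB (f := fun y => tt J β B x0 y)
  rw [← hX] at h3
  linarith

noncomputable def bx (d m : ℕ) : Finset (V d) := Finset.Icc (fun _ => -(m:ℤ)) (fun _ => (m:ℤ))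
theorem mem_bx {m : ℕ} {x : V d} : x ∈ bx d m ↔ normInf x ≤ m := by
  simp only [bx, Finset.mem_Icc, Pi.le_def, normInf, Finset.sup_le_iff, mem_univ, true_imp_iff]
  rw [← forall_and]; exact forall_congr' fun i => by omega
theorem bx_mono {m n : ℕ} (h : m ≤ n) : bx d m ⊆ bx d n := fun x hx => mem_bx.2 ((mem_bx.1 hx).trans h)
theorem normInf_zero : normInf (0 : V d) = 0 := by simp [normInf]
theorem zero_mem_bx (m : ℕ) : (0 : V d) ∈ bx d m := mem_bx.2 (by simp [normInf_zero])
theorem sub_bx (S : Finset (V d)) : ∃ m, S ⊆ bx d m :=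
  ⟨S.sup normInf, fun _ hx => mem_bx.2 (le_sup hx)⟩

theorem exp_neg_quad {t : ℝ} (ht : 0 ≤ t) : Real.exp (-t) ≤ 1 - t + t ^ 2 / 2 := by
  have h := Real.quadratic_le_exp_of_nonneg ht
  have h2 : Real.exp (-t) * Real.exp t = 1 := by rw [← Real.exp_add]; simp
  have h3 : 0 < Real.exp (-t) := Real.exp_pos _
  have h4 : 0 ≤ 1 - t + t ^ 2 / 2 := by nlinarith [sq_nonneg (t - 1)]
  nlinarith [sq_nonneg t, mul_le_mul_of_nonneg_left h h4, mul_nonneg (sq_nonneg t) (sq_nonneg t)]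

noncomputable def psi (J : V d → V d → ℝ) (B A : Finset (V d)) (β : ℝ) : ℝ :=
  Pr (Rt J β 0) B.sym2 fun T => 0 ∉ clS (· ∈ A) T B
theorem dct_step (hJ : KernelHyp d J α c C) {B A : Finset (V d)} (h0B : (0 : V d) ∈ B) {β δ κ : ℝ} (hβ : 0 ≤ β) (hδ : 0 ≤ δ)
    (hAB : A ⊆ B) (hκ : ∀ S ⊆ B \ A, 0 ∈ S → κ ≤ ∑ x ∈ S, ∑ y ∈ B \ S, tt J β S 0 x * J x y) :
    psi J B A (β + δ) ≤ psi J B A β * Real.exp (-(δ * κ) + δ ^ 2 * (B.card * jt J) ^ 2 / 2) := by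
  set F : Finset (V d) → Finset (Sym2 (V d)) → ℝ := fun D T =>
    ind (0 ∉ D) * Real.exp (-(δ * ∑ x ∈ cl T (B \ D) 0, ∑ y ∈ D, J x y)) with hF
  have hr := Rt_nonneg hJ hβ (le_refl 0)
  have hr' := Rt_nonneg hJ hδ (le_refl 0)
  have s1 : psi J B A (β + δ) ≤ Ex (Rt J β 0) B.sym2 (fun T => F (clS (· ∈ A) T B) T) := by
    unfold psi Pr
    have : Rt J (β + δ) 0 = fun e => Rt J β 0 e + Rt J δ 0 e := by rw [← Rt_add, add_zero]
    rw [this, Ex_sprinkle]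
    refine Ex_mono hr fun T hT => ?_
    have hD := clS_sub (· ∈ A) T B
    by_cases h0 : 0 ∈ clS (· ∈ A) T B
    · have : F (clS (· ∈ A) T B) T = 0 := by simp only [hF]; rw [ind_false (not_not.2 h0), zero_mul]
      rw [this]
      refine (Pr_false fun T' _ h => h ?_).le
      obtain ⟨a, ha, hc⟩ := mem_clS.1 h0
      exact mem_clS.2 ⟨a, ha, hc.mono subset_union_left subset_rfl⟩
    · simp only [hF]; rw [ind_true h0, one_mul]
      set D := clS (· ∈ A) T B with hDD
      set K := cl T (B \ D) 0 with hK
      have hKD : ∀ x ∈ K, x ∉ D := fun x hx => (mem_sdiff.1 (cl_sub _ _ _ hx)).2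
      have hKB : ∀ x ∈ K, x ∈ B := fun x hx => (mem_sdiff.1 (cl_sub _ _ _ hx)).1
      have hinj : Set.InjOn (fun p : V d × V d => s(p.1, p.2)) (K ×ˢ D : Finset _) := by
        rintro ⟨a, b⟩ hab ⟨a', b'⟩ hab' h
        simp only [Finset.coe_product, Set.mem_prod, Finset.mem_coe] at hab hab'
        simp only [Sym2.eq_iff] at h
        rcases h with ⟨rfl, rfl⟩ | ⟨rfl, rfl⟩
        · rfl
        · exact absurd hab'.2 (hKD _ hab.1)
      have e1 : δ * ∑ x ∈ K, ∑ y ∈ D, J x y = ∑ e ∈ (K ×ˢ D).image (fun p => s(p.1, p.2)), Rt J δ 0 e := by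
        rw [Finset.sum_image hinj, Finset.sum_product, mul_sum]
        refine sum_congr rfl fun x hx => ?_
        rw [mul_sum]
        refine sum_congr rfl fun y hy => ?_
        rw [Rt_mk hJ]; intro h; dsimp only at h; exact hKD _ hx (h ▸ hy)
      rw [e1, ← Pr_none (S := B.sym2)]
      · refine Pr_mono hr' fun T' _ h e he heT => h ?_
        obtain ⟨⟨x, y⟩, hxy, rfl⟩ := mem_image.1 he
        rw [mem_product] at hxy
        obtain ⟨a, ha, hc⟩ := mem_clS.1 hxy.2
        refine mem_clS.2 ⟨a, ha, (hc.mono subset_union_left subset_rfl).trans ?_⟩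
        have h2 : cn (T ∪ T') B 0 x := (mem_cl.1 hxy.1).mono subset_union_left sdiff_subset
        exact (h2.step (hD hxy.2) (mem_union_right _ heT)).symm
      · intro e he
        obtain ⟨⟨x, y⟩, hxy, rfl⟩ := mem_image.1 he
        rw [mem_product] at hxy
        exact mk_mem_sym2_iff.2 ⟨hKB _ hxy.1, hD hxy.2⟩
  refine s1.trans ?_
  rw [Ex_cond B.powerset (fun T => clS (· ∈ A) T B) (fun T _ => mem_powerset.2 (clS_sub _ _ _)) F]
  · unfold psi Pr
    rw [mul_comm, ← Ex_mul]
    refine Ex_mono hr fun T hT => ?_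
    have hDB := clS_sub (· ∈ A) T B
    have hAD : A ⊆ clS (· ∈ A) T B := fun a ha => mem_clS.2 ⟨a, ha, cn_refl (hAB ha)⟩
    beta_reduce
    generalize clS (· ∈ A) T B = D at *
    simp only [hF]
    rw [Ex_mul, mul_comm]
    by_cases h0 : 0 ∈ D
    swap
    · simp only [ind_true h0, mul_one]
      have hM : ∀ T ⊆ B.sym2, (∑ x ∈ cl T (B \ D) 0, ∑ y ∈ D, J x y) ≤ B.card * jt J := by
        intro T _
        calc _ ≤ ∑ x ∈ cl T (B \ D) 0, jt J := sum_le_sum fun x _ => sum_J_le hJ x D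
          _ = (cl T (B \ D) 0).card * jt J := by simp
          _ ≤ _ := by
            have : (cl T (B \ D) 0).card ≤ B.card := card_le_card ((cl_sub _ _ _).trans sdiff_subset)
            have := jt_nonneg hJ
            gcongr
      have hN : ∀ T, 0 ≤ (∑ x ∈ cl T (B \ D) 0, ∑ y ∈ D, J x y) := fun T =>
        sum_nonneg fun x _ => sum_nonneg fun y _ => hJ.nonneg x y
      calc _ ≤ Ex (Rt J β 0) B.sym2 (fun T => (1 + δ ^ 2 * (B.card * jt J) ^ 2 / 2) -
              δ * (∑ x ∈ cl T (B \ D) 0, ∑ y ∈ D, J x y)) := by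
            refine Ex_mono hr fun T hT => (exp_neg_quad (mul_nonneg hδ (hN T))).trans ?_
            have := hM T hT
            have := pow_le_pow_left₀ (hN T) this 2
            have := mul_le_mul_of_nonneg_left this (sq_nonneg δ)
            rw [mul_pow]; linarith
        _ = (1 + δ ^ 2 * (B.card * jt J) ^ 2 / 2) - δ * ∑ x ∈ B \ D, ∑ y ∈ D, tt J β (B \ D) 0 x * J x y := by
            rw [Ex_sub, Ex_const, Ex_mul, Ex_card_cl (sym2_mono sdiff_subset)]
            simp only [mul_sum, tt_eq]
        _ ≤ (1 + δ ^ 2 * (B.card * jt J) ^ 2 / 2) - δ * κ := by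
            have := hκ (B \ D) (Finset.sdiff_subset_sdiff subset_rfl hAD) (mem_sdiff.2 ⟨h0B, h0⟩)
            rw [Finset.sdiff_sdiff_eq_self hDB] at this
            have := mul_le_mul_of_nonneg_left this hδ
            linarith
        _ ≤ _ := by
            refine le_trans ?_ (Real.add_one_le_exp _)
            linarith
    · rw [ind_false (not_not.2 h0)]; simp
  · intro D _
    refine ⟨fun e => inner B e ∧ touch D e, clS_dep B (fun _ _ _ => rfl) fun e h1 h2 => ⟨h1, h2⟩, ?_⟩
    intro T T' h
    simp only [hF]
    congr 4
    refine sum_congr ?_ fun _ _ => rfl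
    ext v
    rw [mem_cl, mem_cl]
    refine iff_of_eq (cn_dep _ _ _ T T' ?_)
    intro e he
    refine h e ?_
    rintro ⟨-, v, hv, hve⟩
    exact (mem_sdiff.1 (Finset.mem_sym2_iff.1 he.1 v hve)).2 hv

theorem dct (hJ : KernelHyp d J α c C) {β₁ β₂ : ℝ} (h1 : 0 < β₁) (h12 : β₁ < β₂) (hs : ¬ Sub J β₁) (n : ℕ) :
    ∃ m, n ≤ m ∧ psi J (bx d m) (bx d m \ bx d n) β₂ ≤ Real.exp (-((β₂ - β₁) / (2 * β₁))) := by
  unfold Sub at hs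
  push Not at hs
  have hs' : ∀ S : Finset (V d), ∃ Y : Finset (V d), 0 ∈ S →
      (Disjoint S Y ∧ 1 / 2 < ∑ x ∈ S, ∑ y ∈ Y, tt J β₁ S 0 x * (β₁ * J x y)) := by
    intro S
    by_cases h : 0 ∈ S
    · obtain ⟨Y, hY⟩ := hs S h; exact ⟨Y, fun _ => hY⟩
    · exact ⟨∅, fun h' => absurd h' h⟩
  choose Y hY using hs'
  obtain ⟨m0, hm0⟩ := sub_bx ((bx d n).powerset.biUnion Y)
  set m := max m0 n
  refine ⟨m, le_max_right _ _, ?_⟩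
  set B := bx d m
  have hnB : bx d n ⊆ B := bx_mono (le_max_right _ _)
  set κ := 1 / (2 * β₁) with hκd
  have hκ : ∀ β, β₁ ≤ β → ∀ S ⊆ B \ (B \ bx d n), 0 ∈ S → κ ≤ ∑ x ∈ S, ∑ y ∈ B \ S, tt J β S 0 x * J x y := by
    intro β hβ S hS h0
    rw [Finset.sdiff_sdiff_eq_self hnB] at hS
    obtain ⟨hd, hlt⟩ := hY S h0
    have : ∑ x ∈ S, ∑ y ∈ Y S, tt J β₁ S 0 x * (β₁ * J x y) = β₁ * ∑ x ∈ S, ∑ y ∈ Y S, tt J β₁ S 0 x * J x y := by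
      simp only [mul_sum]
      exact sum_congr rfl fun _ _ => sum_congr rfl fun _ _ => by ring
    rw [this] at hlt
    have h2 : κ ≤ ∑ x ∈ S, ∑ y ∈ Y S, tt J β₁ S 0 x * J x y := by
      rw [hκd, div_le_iff₀ (by positivity)]; linarith
    refine h2.trans (sum_le_sum fun x _ => ?_)
    have hYS : Y S ⊆ B \ S := by
      intro y hy
      refine mem_sdiff.2 ⟨bx_mono (le_max_left _ _) (hm0 (Finset.mem_biUnion.2 ⟨S, mem_powerset.2 hS, hy⟩)), ?_⟩
      exact Finset.disjoint_right.1 hd hy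
    calc _ ≤ ∑ y ∈ Y S, tt J β S 0 x * J x y := sum_le_sum fun y _ =>
          mul_le_mul_of_nonneg_right (tt_rate hJ h1.le hβ) (hJ.nonneg x y)
      _ ≤ _ := sum_le_sum_of_subset_of_nonneg hYS fun y _ _ =>
          mul_nonneg (tt_nonneg hJ (h1.le.trans hβ)) (hJ.nonneg x y)
  set M := ((B.card : ℝ) * jt J) ^ 2 / 2
  have hN : ∀ N : ℕ, 0 < N → psi J B (B \ bx d n) β₂ ≤ Real.exp (-((β₂ - β₁) * κ) + (β₂ - β₁) ^ 2 * M * (1 / (N:ℝ))) := by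
    intro N hN
    set δ := (β₂ - β₁) / N with hδd
    have hδ : 0 ≤ δ := div_nonneg (by linarith) (by positivity)
    have hk : ∀ k : ℕ, psi J B (B \ bx d n) (β₁ + k * δ) ≤ Real.exp (k * (-(δ * κ) + δ ^ 2 * M)) := by
      intro k
      induction k with
      | zero => simp only [Nat.cast_zero, zero_mul, add_zero, Real.exp_zero]; exact Pr_le_one (Rt_nonneg hJ h1.le le_rfl) _ _
      | succ k ih =>
        have hb : β₁ ≤ β₁ + k * δ := by have : 0 ≤ k * δ := by positivity
                                        linarith
        have := dct_step hJ (zero_mem_bx m) (h1.le.trans hb) hδ sdiff_subset (hκ _ hb)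
        have e : β₁ + ((k + 1 : ℕ) : ℝ) * δ = β₁ + k * δ + δ := by push_cast; ring
        rw [e]
        refine this.trans ?_
        have e2 : ((k + 1 : ℕ) : ℝ) * (-(δ * κ) + δ ^ 2 * M) = k * (-(δ * κ) + δ ^ 2 * M) + (-(δ * κ) + δ ^ 2 * M) := by
          push_cast; ring
        rw [e2, Real.exp_add (k * (-(δ * κ) + δ ^ 2 * M))]
        refine mul_le_mul ih (le_of_eq ?_) (Real.exp_pos _).le (Real.exp_pos _).le
        congr 2; simp only [M]; ring
    have := hk N
    have hN' : (N : ℝ) ≠ 0 := by positivity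
    have e : β₁ + (N:ℝ) * δ = β₂ := by rw [hδd]; field_simp; ring
    rw [e] at this
    refine this.trans (le_of_eq ?_)
    congr 1; rw [hδd]; field_simp
  have lim : Filter.Tendsto (fun N : ℕ => Real.exp (-((β₂ - β₁) * κ) + (β₂ - β₁) ^ 2 * M * (1 / (N:ℝ)))) Filter.atTop
      (nhds (Real.exp (-((β₂ - β₁) * κ) + (β₂ - β₁) ^ 2 * M * 0))) := by
    refine (Real.continuous_exp.tendsto _).comp ?_
    exact tendsto_const_nhds.add (tendsto_const_nhds.mul tendsto_one_div_atTop_nhds_zero_nat)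
  have := ge_of_tendsto lim (Filter.eventually_atTop.2 ⟨1, fun N hN' => hN N hN'⟩)
  refine this.trans (le_of_eq ?_)
  congr 1; rw [hκd]; ring
end lattice

section link
open scoped Classical
variable {d : ℕ} {J : V d → V d → ℝ} {α c C : ℝ}

noncomputable def oe (ω : Config d) (S : Finset (Sym2 (V d))) : Finset (Sym2 (V d)) := S.filter fun e => ω e = true
noncomputable def nd (B : Finset (V d)) : Finset (Sym2 (V d)) := B.sym2.filter fun e => ¬ e.IsDiag
theorem link (hJ : KernelHyp d J α c C) {P : ℝ → Measure (Config d)} (hP : IsLRP J P) {β : ℝ} (hβ : 0 ≤ β)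
    {S : Finset (Sym2 (V d))} (hS : ∀ e ∈ S, ¬ e.IsDiag) (A : Finset (Sym2 (V d)) → Prop) :
    P β {ω | A (oe ω S)} ≤ ENNReal.ofReal (Pr (Rt J β 0) S A) := by
  have hr := Rt_nonneg hJ hβ (le_refl 0)
  have h1 : {ω : Config d | A (oe ω S)} ⊆ ⋃ T ∈ S.powerset.filter A, {ω | ∀ e ∈ S, ω e = decide (e ∈ T)} := by
    intro ω hω
    simp only [Set.mem_iUnion, mem_filter, mem_powerset]
    refine ⟨oe ω S, ⟨filter_subset _ _, hω⟩, fun e he => ?_⟩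
    by_cases h : ω e = true <;> simp [oe, he, h]
  refine (measure_mono h1).trans ((measure_biUnion_finset_le _ _).trans ?_)
  have h2 : ∀ T ∈ S.powerset.filter A, P β {ω | ∀ e ∈ S, ω e = decide (e ∈ T)} =
      ENNReal.ofReal ((∏ e ∈ T, (1 - Real.exp (-Rt J β 0 e))) * (∏ e ∈ S \ T, Real.exp (-Rt J β 0 e))) := by
    intro T hT
    have hTS : T ⊆ S := mem_powerset.1 (mem_filter.1 hT).1
    rw [hP β S fun e => decide (e ∈ T)]
    have hep : ∀ e ∈ S, edgeProb J β e = ENNReal.ofReal (1 - Real.exp (-Rt J β 0 e)) := by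
      intro e he
      unfold edgeProb
      rw [Rt, if_neg (hS e he)]; congr 3; rw [neg_mul]; rfl
    have hle : ∀ e, Real.exp (-Rt J β 0 e) ≤ 1 := fun e => Real.exp_le_one_iff.2 (neg_nonpos.2 (hr e))
    rw [← Finset.prod_sdiff hTS, mul_comm, ENNReal.ofReal_mul, ENNReal.ofReal_prod_of_nonneg, ENNReal.ofReal_prod_of_nonneg]
    · congr 1
      · refine prod_congr rfl fun e he => ?_
        rw [if_pos (by simpa using he), hep e (hTS he)]
      · refine prod_congr rfl fun e he => ?_
        rw [mem_sdiff] at he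
        rw [if_neg (by simpa using he.2), hep e he.1, ← ENNReal.ofReal_one, ← ENNReal.ofReal_sub _ (by linarith [hle e])]
        congr 1; ring
    · exact fun e _ => (Real.exp_pos _).le
    · exact fun e _ => by linarith [hle e]
    · exact Finset.prod_nonneg fun e _ => by linarith [hle e]
  rw [sum_congr rfl h2, ← ENNReal.ofReal_sum_of_nonneg]
  · refine ENNReal.ofReal_le_ofReal (le_of_eq ?_)
    unfold Pr Ex
    rw [Finset.sum_filter]
    refine sum_congr rfl fun T _ => ?_
    beta_reduce
    by_cases hA : A T
    · rw [ind_true hA, if_pos hA, mul_one]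
    · rw [ind_false hA, if_neg hA, mul_zero]
  · exact fun T _ => wt_nonneg hr S T
theorem P_univ {P : ℝ → Measure (Config d)} (hP : IsLRP J P) (β : ℝ) : P β Set.univ = 1 := by
  have := hP β ∅ (fun _ => true)
  simpa using this
theorem conn_bx {ω : Config d} {x y : V d} (h : conn ω x y) :
    ∃ m0, ∀ m, m0 ≤ m → cn (oe ω (nd (bx d m))) (bx d m) x y := by
  unfold conn at h
  induction h with
  | refl => exact ⟨normInf x, fun m hm => cn_refl (mem_bx.2 hm)⟩
  | @tail b z _ hbc ih =>
    obtain ⟨m0, hm⟩ := ih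
    refine ⟨max m0 (normInf z), fun m h => ?_⟩
    have h1 := hm m ((le_max_left _ _).trans h)
    have hz : z ∈ bx d m := mem_bx.2 ((le_max_right _ _).trans h)
    refine h1.step hz ?_
    simp only [oe, nd, mem_filter, mk_mem_sym2_iff]
    exact ⟨⟨⟨h1.right, hz⟩, by simpa using hbc.1⟩, hbc.2⟩
theorem bx_conn {ω : Config d} {B : Finset (V d)} {x y : V d} (h : cn (oe ω (nd B)) B x y) : conn ω x y := by
  refine h.ind_on (p := fun v => conn ω x v) .refl fun a b _ h2 _ h4 => ?_
  simp only [oe, nd, mem_filter, Sym2.mk_isDiag_iff] at h4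
  exact Relation.ReflTransGen.tail h2 ⟨h4.1.2, h4.2⟩
theorem Pr_nd {A : Finset (Sym2 (V d)) → Prop} {B : Finset (V d)} (hA : Dep (inner B) A) (β h : ℝ) :
    Pr (Rt J β 0) (nd B) A = Pr (Rt J β h) B.sym2 A := by
  refine Pr_dep_congr hA (fun e he => ?_) fun e _ he => by simp [Rt, he.2]
  simp only [nd, mem_filter]; exact ⟨fun h => h.1, fun h => ⟨h, he.2⟩⟩
theorem cl_card_dep (B : Finset (V d)) (x : V d) (n : ℕ) : Dep (inner B) (fun T => n ≤ (cl T B x).card) := by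
  intro T T' h
  have : cl T B x = cl T' B x := by
    ext y; rw [mem_cl, mem_cl]; exact iff_of_eq (cn_dep B x y T T' h)
  simp only [this]
theorem measure_up (hJ : KernelHyp d J α c C) {P : ℝ → Measure (Config d)} (hP : IsLRP J P) {β : ℝ} (hβ : 0 ≤ β)
    {h ε : ℝ} {n : ℕ} {x : V d}
    (hm : ∀ m, Pr (Rt J β h) (bx d m).sym2 (fun T => n ≤ (cl T (bx d m) x).card) ≤ ε) :
    P β {ω | (cluster ω x).Infinite} ≤ ENNReal.ofReal ε := by
  have h1 : {ω : Config d | (cluster ω x).Infinite} ⊆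
      ⋃ m0 : ℕ, {ω | ∀ m ≥ m0, n ≤ (cl (oe ω (nd (bx d m))) (bx d m) x).card} := by
    intro ω hω
    obtain ⟨F, hF, hcard⟩ := Set.Infinite.exists_subset_card_eq hω n
    have : ∀ y ∈ F, ∃ m0, ∀ m, m0 ≤ m → cn (oe ω (nd (bx d m))) (bx d m) x y := fun y hy => conn_bx (hF hy)
    choose! g hg using this
    rw [Set.mem_iUnion]
    refine ⟨F.sup g, fun m hm => ?_⟩
    rw [← hcard]
    exact card_le_card fun y hy => mem_cl.2 (hg y hy m ((le_sup hy).trans hm))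
  refine (measure_mono h1).trans ?_
  rw [Directed.measure_iUnion]
  · refine iSup_le fun m => ?_
    have h2 : {ω : Config d | ∀ m' ≥ m, n ≤ (cl (oe ω (nd (bx d m'))) (bx d m') x).card} ⊆
      {ω | n ≤ (cl (oe ω (nd (bx d m))) (bx d m) x).card} := fun ω hω => hω m le_rfl
    refine (measure_mono h2).trans ?_
    refine (link hJ hP hβ (S := nd (bx d m)) (fun e he => (mem_filter.1 he).2)
      (fun T => n ≤ (cl T (bx d m) x).card)).trans (ENNReal.ofReal_le_ofReal ?_)
    rw [Pr_nd (cl_card_dep _ x n) β h]; exact hm m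
  · refine Monotone.directed_le fun a b hab ω hω m hm => hω m (le_trans hab hm)
theorem psi_dep (B A : Finset (V d)) : Dep (inner B) (fun T => 0 ∉ clS (· ∈ A) T B) := by
  intro T T' h
  simp only [mem_clS]
  refine propext (not_congr (exists_congr fun a => and_congr_right fun _ => iff_of_eq (cn_dep B a 0 T T' h)))
theorem measure_down (hJ : KernelHyp d J α c C) {P : ℝ → Measure (Config d)} (hP : IsLRP J P) {β : ℝ} (hβ : 0 ≤ β)
    {q : ℝ} (hq0 : 0 ≤ q) (hq : ∀ n, ∃ m, n ≤ m ∧ psi J (bx d m) (bx d m \ bx d n) β ≤ q) :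
    ENNReal.ofReal (1 - q) ≤ P β {ω | (cluster ω 0).Infinite} := by
  have h1 : P β {ω | (cluster ω 0).Infinite}ᶜ ≤ ENNReal.ofReal q := by
    have hs : {ω : Config d | (cluster ω 0).Infinite}ᶜ ⊆ ⋃ n : ℕ, {ω | cluster ω 0 ⊆ bx d n} := by
      intro ω hω
      simp only [Set.mem_compl_iff, Set.mem_ofPred_eq, Set.not_infinite] at hω
      obtain ⟨m, hm⟩ := sub_bx hω.toFinset
      exact Set.mem_iUnion.2 ⟨m, fun y hy => hm (by simpa using hy)⟩
    refine (measure_mono hs).trans ?_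
    rw [Directed.measure_iUnion]
    · refine iSup_le fun n => ?_
      obtain ⟨m, hm, hp⟩ := hq n
      have h2 : {ω : Config d | cluster ω 0 ⊆ bx d n} ⊆
          {ω | 0 ∉ clS (· ∈ bx d m \ bx d n) (oe ω (nd (bx d m))) (bx d m)} := by
        intro ω hω h
        obtain ⟨a, ha, hc⟩ := mem_clS.1 h
        exact (mem_sdiff.1 ha).2 (by simpa using hω (bx_conn hc.symm))
      refine (measure_mono h2).trans ?_
      refine (link hJ hP hβ (S := nd (bx d m)) (fun e he => (mem_filter.1 he).2)
        (fun T => 0 ∉ clS (· ∈ bx d m \ bx d n) T (bx d m))).trans (ENNReal.ofReal_le_ofReal ?_)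
      rw [Pr_nd (psi_dep _ _) β 0]; exact hp
    · exact Monotone.directed_le fun a b hab ω hω => Set.Subset.trans hω (by simpa using bx_mono hab)
  have h3 : 1 ≤ P β {ω | (cluster ω 0).Infinite} + ENNReal.ofReal q := by
    rw [← P_univ hP β, ← Set.union_compl_self {ω : Config d | (cluster ω 0).Infinite}]
    exact (measure_union_le _ _).trans (by gcongr)
  rw [ENNReal.ofReal_sub _ hq0, ENNReal.ofReal_one]
  exact tsub_le_iff_right.2 h3
theorem theta_lower (hJ : KernelHyp d J α c C) {P : ℝ → Measure (Config d)} (hP : IsLRP J P) {β₁ β₂ : ℝ}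
    (h1 : 0 < β₁) (h12 : β₁ < β₂) (hs : ¬ Sub J β₁) :
    ENNReal.ofReal (1 - Real.exp (-((β₂ - β₁) / (2 * β₁)))) ≤ P β₂ {ω | (cluster ω 0).Infinite} :=
  measure_down hJ hP (h1.le.trans h12.le) (Real.exp_pos _).le fun n => dct hJ h1 h12 hs n
theorem markov_chi (hJ : KernelHyp d J α c C) {β K : ℝ} (hβ : 0 ≤ β) (hK : Chi J β K) (B : Finset (V d)) (x : V d) (n : ℕ) :
    Pr (Rt J β 0) B.sym2 (fun T => n + 1 ≤ (cl T B x).card) ≤ K / (n + 1) := by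
  rw [le_div_iff₀ (by positivity), mul_comm]
  unfold Pr
  rw [← Ex_mul]
  refine le_trans (Ex_mono (g := fun T => ∑ y ∈ cl T B x, (1:ℝ)) (Rt_nonneg hJ hβ le_rfl) fun T _ => ?_) ?_
  · by_cases h : n + 1 ≤ (cl T B x).card
    · rw [ind_true h]; simp; exact_mod_cast h
    · rw [ind_false h]; simp
  · rw [Ex_card_cl subset_rfl]
    simpa [tt_eq] using hK B x
theorem Sub.no_perc (hJ : KernelHyp d J α c C) {P : ℝ → Measure (Config d)} (hP : IsLRP J P) {β : ℝ} (hβ : 0 ≤ β)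
    (hs : Sub J β) : P β {ω | ∃ x, (cluster ω x).Infinite} = 0 := by
  obtain ⟨K, hK0, hK⟩ := hs.chi hJ hβ
  have : {ω : Config d | ∃ x, (cluster ω x).Infinite} = ⋃ x, {ω | (cluster ω x).Infinite} := by ext; simp
  rw [this, measure_iUnion_null_iff]
  intro x
  have h1 : ∀ n : ℕ, P β {ω | (cluster ω x).Infinite} ≤ ENNReal.ofReal (K / (n + 1)) := fun n =>
    measure_up hJ hP hβ (h := 0) (n := n + 1) fun m => markov_chi hJ hβ hK _ _ _
  have lim : Filter.Tendsto (fun n : ℕ => ENNReal.ofReal (K / (n + 1))) Filter.atTop (nhds (ENNReal.ofReal 0)) := by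
    refine ENNReal.tendsto_ofReal ?_
    have := (tendsto_one_div_add_atTop_nhds_zero_nat (𝕜 := ℝ)).const_mul K
    simpa [div_eq_mul_inv] using this
  have := ge_of_tendsto' lim h1
  simpa using this
def PS (P : ℝ → Measure (Config d)) : Set ℝ := {β : ℝ | 0 ≤ β ∧ 0 < P β {ω | ∃ x, (cluster ω x).Infinite}}
theorem mem_PS (hJ : KernelHyp d J α c C) {P : ℝ → Measure (Config d)} (hP : IsLRP J P) {β₁ β₂ : ℝ}
    (h1 : 0 < β₁) (h12 : β₁ < β₂) (hs : ¬ Sub J β₁) : β₂ ∈ PS P := by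
  refine ⟨h1.le.trans h12.le, ?_⟩
  refine lt_of_lt_of_le ?_ ((theta_lower hJ hP h1 h12 hs).trans (measure_mono fun ω hω => ⟨0, hω⟩))
  rw [ENNReal.ofReal_pos, sub_pos, Real.exp_lt_one_iff]
  have : 0 < (β₂ - β₁) / (2 * β₁) := div_pos (by linarith) (by linarith)
  linarith
theorem PS_bdd (P : ℝ → Measure (Config d)) : BddBelow (PS P) := ⟨0, fun _ h => h.1⟩
theorem sub_of_lt (hJ : KernelHyp d J α c C) {P : ℝ → Measure (Config d)} (hP : IsLRP J P) {β : ℝ}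
    (h1 : 0 < β) (h : β < betaC P) : Sub J β := by
  by_contra hs
  have := csInf_le (PS_bdd P) (mem_PS hJ hP h1 (β₂ := (β + betaC P) / 2) (by linarith) hs)
  have : betaC P ≤ (β + betaC P) / 2 := this
  linarith
theorem not_sub_of_gt (hJ : KernelHyp d J α c C) {P : ℝ → Measure (Config d)} (hP : IsLRP J P) {β : ℝ}
    (hne : (PS P).Nonempty) (h : betaC P < β) : ¬ Sub J β := by
  intro hs
  obtain ⟨b, hb, hlt⟩ := exists_lt_of_csInf_lt hne h
  have := (hs.anti hJ hb.1 hlt.le).no_perc hJ hP hb.1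
  exact hb.2.ne' this
theorem betaC_pos (hJ : KernelHyp d J α c C) {P : ℝ → Measure (Config d)} (hP : IsLRP J P)
    (hne : (PS P).Nonempty) : 0 < betaC P := by
  have hj := jt_nonneg hJ
  refine lt_of_lt_of_le (b := 1 / (2 * (jt J + 1))) (by positivity) (le_csInf hne fun β hb => ?_)
  by_contra hlt
  push Not at hlt
  have hs : Sub J β := by
    refine ⟨{0}, by simp, fun Y _ => ?_⟩
    rw [Finset.sum_singleton, ← mul_sum, ← mul_sum]
    have h1 := sum_J_le hJ 0 Y
    have h2 : tt J β {0} 0 0 ≤ 1 := tt_le_one hJ hb.1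
    rw [lt_div_iff₀ (by positivity)] at hlt
    have h3 : 0 ≤ β * ∑ i ∈ Y, J 0 i := mul_nonneg hb.1 (sum_nonneg fun i _ => hJ.nonneg _ _)
    have h4 := mul_le_mul_of_nonneg_left h1 hb.1
    have h5 := mul_le_mul_of_nonneg_right h2 h3
    have := hb.1
    nlinarith
  exact hb.2.ne' (hs.no_perc hJ hP hb.1)
theorem lower_final (hJ : KernelHyp d J α c C) {P : ℝ → Measure (Config d)} (hP : IsLRP J P)
    (hne : (PS P).Nonempty) {ε : ℝ} (h0 : 0 < ε) (h1 : ε < betaC P) :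
    ENNReal.ofReal (1 / (16 * betaC P) * ε) ≤ P (betaC P + ε) {ω | (cluster ω 0).Infinite} := by
  have hb := betaC_pos hJ hP hne
  refine le_trans (ENNReal.ofReal_le_ofReal ?_) (theta_lower hJ hP (β₁ := betaC P + ε / 2) (by linarith) (by linarith)
    (not_sub_of_gt hJ hP hne (by linarith)))
  have ht : ε / (8 * betaC P) ≤ (betaC P + ε - (betaC P + ε / 2)) / (2 * (betaC P + ε / 2)) := by
    rw [div_le_div_iff₀ (by positivity) (by positivity)]; nlinarith
  have ht1 : ε / (8 * betaC P) ≤ 1 := by rw [div_le_one (by positivity)]; linarith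
  have ht0 : 0 ≤ ε / (8 * betaC P) := by positivity
  have e : 1 / (16 * betaC P) * ε = ε / (8 * betaC P) / 2 := by field_simp; norm_num
  rw [e]
  have h3 := exp_neg_quad ht0
  have h4 := Real.exp_le_exp.2 (neg_le_neg ht)
  nlinarith
end link

section split
open scoped Classical
variable {E : Type*} [DecidableEq E] {U : Type*} [DecidableEq U]

theorem cn.erase {T : Finset (Sym2 U)} {B : Finset U} {v w y : U} (h : cn T B v y) (hw : w ∈ B) :
    cn (T.erase s(v, w)) B v y ∨ cn (T.erase s(v, w)) B w y := by
  refine h.ind_on (p := fun y => cn (T.erase s(v, w)) B v y ∨ cn (T.erase s(v, w)) B w y)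
    (Or.inl (cn_refl h.left)) fun a b _ h2 h3 h4 => ?_
  by_cases he : s(a, b) = s(v, w)
  · rw [Sym2.eq_iff] at he
    rcases he with ⟨rfl, rfl⟩ | ⟨rfl, rfl⟩
    · exact Or.inr (cn_refl hw)
    · exact Or.inl (cn_refl h.left)
  · have : s(a, b) ∈ T.erase s(v, w) := Finset.mem_erase.2 ⟨he, h4⟩
    exact h2.imp (fun h => h.step h3 this) fun h => h.step h3 this
theorem cl_mono {T T' : Finset (Sym2 U)} {B B' : Finset U} (h : T ⊆ T') (hB : B ⊆ B') (x : U) : cl T B x ⊆ cl T' B' x :=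
  fun _ hy => mem_cl.2 ((mem_cl.1 hy).mono h hB)
theorem split_aux (T : Finset (Sym2 U)) (B : Finset U) (u : U) {n : ℕ} (hn : 1 ≤ n) (k : ℕ) :
    ∀ (F₁ F₂ : Finset (Sym2 U)) (v : U), F₂.card ≤ k → F₁ ⊆ T → F₂ ⊆ T → Disjoint F₁ F₂ → cn F₁ B u v →
      n ≤ (cl F₂ B v).card → 3 * n ≤ (cl F₁ B u ∪ cl F₂ B v).card →
      dj (fun F => n ≤ (cl F B u).card) (fun F => ∃ v ∈ B, n ≤ (cl F B v).card) T := by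
  induction k with
  | zero =>
    intro F₁ F₂ v hk h1 h2 hd hv hc hu
    have : F₂ = ∅ := by simpa using hk
    subst this
    have h3 : cl ∅ B v ⊆ {v} := fun y hy => by
      refine (mem_cl.1 hy).ind_on (p := fun y => y ∈ ({v} : Finset U)) (by simp) fun a b _ _ _ h => by simp at h
    have h4 := card_le_card h3
    have h5 := Finset.card_union_le (cl F₁ B u) (cl ∅ B v)
    rw [Finset.card_singleton] at h4
    exact ⟨F₁, ∅, h1, h2, hd, by omega, v, hv.right, hc⟩
  | succ k ih =>
    intro F₁ F₂ v hk h1 h2 hd hv hc hu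
    by_cases hlt : (cl F₂ B v).card < 2 * n
    · have h5 := Finset.card_union_le (cl F₁ B u) (cl F₂ B v)
      exact ⟨F₁, F₂, h1, h2, hd, by omega, v, hv.right, hc⟩
    push Not at hlt
    have hvB := hv.right
    obtain ⟨w, hw, hwv, he⟩ : ∃ w ∈ B, w ≠ v ∧ s(v, w) ∈ F₂ := by
      by_contra hcon
      push Not at hcon
      have h3 : cl F₂ B v ⊆ {v} := fun y hy => by
        refine (mem_cl.1 hy).ind_on (p := fun y => y ∈ ({v} : Finset U)) (by simp) fun a b _ h5 h6 h7 => ?_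
        rw [Finset.mem_singleton] at h5 ⊢
        subst h5
        by_contra hne
        exact hcon b h6 hne h7
      have h4 := card_le_card h3
      rw [Finset.card_singleton] at h4
      omega
    set F := F₂.erase s(v, w) with hF
    have hFF : F ⊆ F₂ := Finset.erase_subset _ _
    have hFk : F.card ≤ k := by rw [Finset.card_erase_of_mem he]; omega
    have hsub : cl F₂ B v ⊆ cl F B v ∪ cl F B w := fun y hy => by
      rw [mem_union, mem_cl, mem_cl]; exact (mem_cl.1 hy).erase hw
    by_cases hcw : cn F B v w
    · have hEq : cl F₂ B v ⊆ cl F B v := fun y hy => by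
        rcases mem_union.1 (hsub hy) with h | h
        · exact h
        · exact mem_cl.2 (hcw.trans (mem_cl.1 h))
      exact ih F₁ F v hFk h1 (hFF.trans h2) (hd.mono_right hFF) hv (hc.trans (card_le_card hEq))
        (hu.trans (card_le_card (Finset.union_subset_union subset_rfl hEq)))
    have key : ∀ p q, s(p, q) = s(v, w) → p ∈ B → q ∈ B → n ≤ (cl F B p).card → ¬ cn F B p q → (v = p ∨ v = q) →
        cl F₂ B v ⊆ cl F B p ∪ cl F B q →
        dj (fun F => n ≤ (cl F B u).card) (fun F => ∃ v ∈ B, n ≤ (cl F B v).card) T := by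
      intro p q hpq hp hq hcp hncn hvpq hsub'
      set G := F.filter (touch (cl F B p)) with hG
      have hGF : G ⊆ F := filter_subset _ _
      have hp1 : cl F B p ⊆ cl G B p := fun y hy => mem_cl.2 ((mem_cl.1 hy).agree fun a b h3 h4 h5 h6 =>
        mem_filter.2 ⟨h6, touch_left (mem_cl.2 h3)⟩)
      have heG : s(p, q) ∉ G := fun h => by rw [hpq] at h; exact Finset.notMem_erase _ _ (hGF h)
      have heN : s(p, q) ∈ F₁ ∪ F₂ \ G := mem_union_right _ (mem_sdiff.2 ⟨hpq ▸ he, heG⟩)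
      have hpqN : cn (F₁ ∪ F₂ \ G) B p q := cn_edge hp hq heN
      have huN : cn (F₁ ∪ F₂ \ G) B u v := hv.mono subset_union_left subset_rfl
      have hup : cn (F₁ ∪ F₂ \ G) B u p := by
        rcases hvpq with rfl | rfl
        · exact huN
        · exact huN.trans hpqN.symm
      have hq1 : cl F B q ⊆ cl (F₁ ∪ F₂ \ G) B u := fun y hy => by
        refine mem_cl.2 ((hup.trans hpqN).trans ((mem_cl.1 hy).agree fun a b h3 h4 h5 h6 => ?_))
        refine mem_union_right _ (mem_sdiff.2 ⟨hFF h6, fun hg => ?_⟩)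
        obtain ⟨z, hz, hze⟩ := (mem_filter.1 hg).2
        rw [mem_cl] at hz
        rw [Sym2.mem_iff] at hze
        rcases hze with rfl | rfl
        · exact hncn (hz.trans h3.symm)
        · exact hncn (hz.trans (h3.step h4 h6).symm)
      refine ih (F₁ ∪ F₂ \ G) G p ((card_le_card hGF).trans hFk)
        (union_subset h1 (sdiff_subset.trans h2)) ((hGF.trans hFF).trans h2) ?_ hup
        (hcp.trans (card_le_card hp1)) (hu.trans (card_le_card ?_))
      · rw [Finset.disjoint_union_left]
        exact ⟨hd.mono_right (hGF.trans hFF), Finset.sdiff_disjoint⟩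
      · refine union_subset ((cl_mono subset_union_left subset_rfl u).trans subset_union_left) ?_
        refine hsub'.trans (union_subset (hp1.trans Finset.subset_union_right) (hq1.trans subset_union_left))
    have h6 := card_le_card hsub
    have h7 := Finset.card_union_le (cl F B v) (cl F B w)
    by_cases hcase : n ≤ (cl F B v).card
    · exact key v w rfl hvB hw hcase hcw (Or.inl rfl) hsub
    · refine key w v Sym2.eq_swap hw hvB (by omega) (fun h => hcw h.symm) (Or.inr rfl) ?_
      rwa [Finset.union_comm]
theorem split_lemma {T : Finset (Sym2 U)} {B : Finset U} {u : U} {n : ℕ} (hn : 1 ≤ n) (h : 3 * n ≤ (cl T B u).card) :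
    dj (fun F => n ≤ (cl F B u).card) (fun F => ∃ v ∈ B, n ≤ (cl F B v).card) T := by
  have hu : u ∈ B := by
    obtain ⟨y, hy⟩ := card_pos.1 (show 0 < (cl T B u).card by omega)
    exact (mem_cl.1 hy).left
  exact split_aux T B u hn T.card ∅ T u le_rfl (by simp) subset_rfl (by simp) (cn_refl hu) (by omega)
    (h.trans (card_le_card Finset.subset_union_right))
theorem cl_card_inc (B : Finset U) (u : U) (n : ℕ) : Inc (fun F => n ≤ (cl F B u).card) :=
  fun _ _ hT h => h.trans (card_le_card (cl_mono hT subset_rfl u))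
variable {r : Sym2 U → ℝ}
theorem split_prob (hr : ∀ e, 0 ≤ r e) (B : Finset U) (u : U) {n : ℕ} (hn : 1 ≤ n) :
    Pr r B.sym2 (fun T => 3 * n ≤ (cl T B u).card) ≤
      Pr r B.sym2 (fun T => n ≤ (cl T B u).card) * Pr r B.sym2 (fun T => ∃ v ∈ B, n ≤ (cl T B v).card) := by
  refine (Pr_mono hr fun T _ h => split_lemma hn h).trans (BK hr _ (cl_card_inc B u n) ?_)
  rintro T T' hT ⟨v, hv, h⟩
  exact ⟨v, hv, cl_card_inc B v n T T' hT h⟩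
theorem tight (hr : ∀ e, 0 ≤ r e) (B : Finset U) (u : U) {n : ℕ} (hn : 1 ≤ n)
    (hm : Pr r B.sym2 (fun T => ∃ v ∈ B, n ≤ (cl T B v).card) ≤ 1 / 12) :
    ∑ y ∈ B, tau r B u y ≤ 4 * Ex r B.sym2 (fun T => min ((cl T B u).card : ℝ) n) := by
  set p : ℕ → ℝ := fun k => Pr r B.sym2 (fun T => 3 ^ k * n ≤ (cl T B u).card) with hp
  set G : ℕ → ℝ := fun k => Ex r B.sym2 (fun T => min ((cl T B u).card : ℝ) (3 ^ k * n)) with hG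
  have hp1 : ∀ k, p (k + 1) ≤ p k * (1 / 12) := by
    intro k
    have h1 : 1 ≤ 3 ^ k * n := Nat.mul_pos (by positivity) hn
    have := split_prob hr B u h1
    have e : 3 ^ (k + 1) * n = 3 * (3 ^ k * n) := by ring
    simp only [hp, e]
    refine this.trans (mul_le_mul_of_nonneg_left (le_trans (Pr_mono hr ?_) hm) (Pr_nonneg hr _ _))
    rintro T _ ⟨v, hv, h⟩
    exact ⟨v, hv, le_trans (Nat.le_mul_of_pos_left n (by positivity)) h⟩
  have hp2 : ∀ k, p k ≤ (1 / 12) ^ k * p 0 := by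
    intro k
    induction k with
    | zero => simp
    | succ k ih => refine (hp1 k).trans ?_; rw [pow_succ]; linarith
  have hG0 : n * p 0 ≤ G 0 := by
    simp only [hp, hG, Pr]; rw [← Ex_mul]
    refine Ex_mono hr fun T _ => ?_
    by_cases h : 3 ^ 0 * n ≤ (cl T B u).card
    · rw [ind_true h, mul_one]; simp only [pow_zero, one_mul] at h ⊢
      exact le_min (by exact_mod_cast h) le_rfl
    · rw [ind_false h, mul_zero]; positivity
  have hG1 : ∀ k, G (k + 1) ≤ G k + 2 * 3 ^ k * n * p k := by
    intro k
    simp only [hp, hG, Pr]; rw [← Ex_mul, ← Ex_add]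
    refine Ex_mono hr fun T _ => ?_
    by_cases h : 3 ^ k * n ≤ (cl T B u).card
    · rw [ind_true h, mul_one]
      have h' : (3:ℝ) ^ k * n ≤ (cl T B u).card := by exact_mod_cast h
      rw [min_eq_right h']
      refine (min_le_right _ _).trans (le_of_eq ?_)
      ring
    · rw [ind_false h, mul_zero, add_zero]
      push Not at h
      have h' : ((cl T B u).card : ℝ) ≤ (3:ℝ) ^ k * n := by exact_mod_cast h.le
      rw [min_eq_left h']; exact min_le_left _ _
  have hG2 : ∀ k, G k ≤ (11 / 3 - 8 / 3 * (1 / 4) ^ k) * G 0 := by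
    intro k
    induction k with
    | zero => norm_num
    | succ k ih =>
      have h1 : 2 * 3 ^ k * n * p k ≤ 2 * (1 / 4) ^ k * G 0 := by
        calc 2 * 3 ^ k * n * p k ≤ 2 * 3 ^ k * n * ((1 / 12) ^ k * p 0) := by
              have := hp2 k; gcongr
          _ = 2 * (1 / 4) ^ k * (n * p 0) := by
              have : (1 / 4 : ℝ) ^ k = 3 ^ k * (1 / 12) ^ k := by rw [← mul_pow]; norm_num
              rw [this]; ring
          _ ≤ _ := by gcongr
      have := hG1 k
      rw [pow_succ]; nlinarith
  have hG0' : 0 ≤ G 0 := Ex_nonneg hr fun T _ => by positivity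
  have hfin := hG2 B.card
  have e1 : G B.card = ∑ y ∈ B, tau r B u y := by
    have := Ex_card_cl (r := r) (B := B) (x := u) subset_rfl (fun _ => 1)
    simp only [mul_one] at this
    rw [← this]
    refine Ex_congr fun T _ => ?_
    rw [min_eq_left]
    · simp
    have h1 : (cl T B u).card ≤ 3 ^ B.card * n :=
      (card_le_card (cl_sub _ _ _)).trans ((Nat.lt_pow_self (by norm_num)).le.trans (Nat.le_mul_of_pos_right _ hn))
    exact_mod_cast h1
  rw [e1] at hfin
  have e2 : G 0 = Ex r B.sym2 (fun T => min ((cl T B u).card : ℝ) n) := by simp only [hG, pow_zero, one_mul]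
  rw [← e2]
  have : (0:ℝ) ≤ (1 / 4) ^ B.card := by positivity
  nlinarith

theorem Pr_forall {ι : Type*} (s : Finset ι) (π : ι → E → Prop) (A : ι → Finset E → Prop)
    (hd : ∀ i ∈ s, Dep (π i) (A i)) (hdis : ∀ i ∈ s, ∀ j ∈ s, i ≠ j → ∀ e, π i e → ¬ π j e) (r : E → ℝ) (S : Finset E) :
    Pr r S (fun T => ∀ i ∈ s, A i T) = ∏ i ∈ s, Pr r S (A i) := by
  induction s using Finset.induction_on with
  | empty => simp only [Finset.prod_empty]; exact Pr_true fun T _ => by simp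
  | insert i s hi ih =>
    rw [Finset.prod_insert hi, ← ih (fun j hj => hd j (mem_insert_of_mem hj))
      (fun j hj k hk => hdis j (mem_insert_of_mem hj) k (mem_insert_of_mem hk)),
      ← Pr_indep (hd i (mem_insert_self _ _))]
    · exact Pr_congr fun T _ => by simp
    · intro T T' h
      refine propext (forall₂_congr fun j hj => iff_of_eq ?_)
      refine hd j (mem_insert_of_mem hj) T T' fun e he => h e ?_
      exact hdis j (mem_insert_of_mem hj) i (mem_insert_self _ _) (by rintro rfl; exact hi hj) e he
def big (B : Finset U) (n : ℕ) (T : Finset (Sym2 U)) : Prop := ∃ v ∈ B, n ≤ (cl T B v).card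
theorem big_dep (B : Finset U) (n : ℕ) : Dep (inner B) (big B n) := by
  intro T T' h
  have : ∀ x, cl T B x = cl T' B x := fun x => by
    ext y; rw [mem_cl, mem_cl]; exact iff_of_eq (cn_dep B x y T T' h)
  simp only [big, this]
theorem sum_rate_bipartite {ρ : ℝ} {K K' : Finset U} (hKK : Disjoint K K') (hρ : ∀ x ∈ K, ∀ y ∈ K', ρ ≤ r s(x, y)) :
    ρ * (K.card * K'.card) ≤ ∑ e ∈ (K ×ˢ K').image (fun p => s(p.1, p.2)), r e := by
  rw [Finset.sum_image]
  · rw [Finset.sum_product]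
    calc ρ * (K.card * K'.card) = ∑ x ∈ K, ∑ y ∈ K', ρ := by simp; ring
      _ ≤ _ := sum_le_sum fun x hx => sum_le_sum fun y hy => hρ x hx y hy
  · rintro ⟨a, b⟩ hab ⟨a', b'⟩ hab' h
    simp only [Finset.coe_product, Set.mem_prod, Finset.mem_coe] at hab hab'
    simp only [Sym2.eq_iff] at h
    rcases h with ⟨rfl, rfl⟩ | ⟨rfl, rfl⟩
    · rfl
    · exact absurd hab'.2 (disjoint_left.1 hKK hab.1)
theorem growth_abs (hr : ∀ e, 0 ≤ r e) {N₁ N₂ n : ℕ} (hN : 1 ≤ N₁) (Q : Fin N₁ × Fin N₂ → Finset U) (B : Finset U)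
    (hQB : ∀ p, Q p ⊆ B) (hQ : ∀ p q, p ≠ q → Disjoint (Q p) (Q q)) {ρ b : ℝ} (hρ0 : 0 ≤ ρ)
    (hρ : ∀ x ∈ B, ∀ y ∈ B, x ≠ y → ρ ≤ r s(x, y)) (hb : ∀ p, b ≤ Pr r (Q p).sym2 (big (Q p) n)) :
    1 - N₁ * (1 - b) ^ N₂ - N₁ ^ 2 * Real.exp (-(ρ * n ^ 2)) ≤ Pr r B.sym2 (big B (N₁ * n)) := by
  set S0 : Finset (Sym2 U) := Finset.univ.biUnion fun p => (Q p).sym2 with hS0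
  have hS0B : S0 ⊆ B.sym2 := Finset.biUnion_subset.2 fun p _ => sym2_mono (hQB p)
  have hQS : ∀ p, (Q p).sym2 ⊆ S0 := fun p => Finset.subset_biUnion_of_mem (fun p => (Q p).sym2) (mem_univ p)
  set G : Finset (Sym2 U) → Prop := fun T => ∀ i, ∃ j, big (Q (i, j)) n T with hG
  have hnG : Pr r S0 (fun T => ¬ G T) ≤ N₁ * (1 - b) ^ N₂ := by
    calc Pr r S0 (fun T => ¬ G T) ≤ ∑ i ∈ (Finset.univ : Finset (Fin N₁)), Pr r S0 (fun T => ∀ j ∈ (Finset.univ : Finset (Fin N₂)), ¬ big (Q (i, j)) n T) := by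
          refine Pr_exists_le hr _ _ _ _ fun T _ h => ?_
          simp only [hG] at h; push Not at h
          simpa using h
      _ ≤ ∑ i ∈ (Finset.univ : Finset (Fin N₁)), (1 - b) ^ N₂ := by
          refine sum_le_sum fun i _ => ?_
          rw [Pr_forall _ (fun j => inner (Q (i, j))) (fun j T => ¬ big (Q (i, j)) n T)]
          · calc _ ≤ ∏ j ∈ (Finset.univ : Finset (Fin N₂)), (1 - b) := by
                  refine Finset.prod_le_prod (fun j _ => Pr_nonneg hr _ _) fun j _ => ?_
                  rw [Pr_not, Pr_dep_congr (big_dep (Q (i, j)) n) (S' := (Q (i, j)).sym2) (r' := r)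
                    (fun e he => ⟨fun _ => he.1, fun h => hQS _ h⟩) fun _ _ _ => rfl]
                  linarith [hb (i, j)]
              _ = _ := by simp
          · exact fun j _ T T' h => by simp only [big_dep (Q (i, j)) n T T' h]
          · intro j _ k _ hjk e he he'
            induction e using Sym2.ind with
            | _ x y =>
              have h1 := (mk_mem_sym2_iff.1 he.1).1
              have h2 := (mk_mem_sym2_iff.1 he'.1).1
              exact disjoint_left.1 (hQ (i, j) (i, k) (by simpa using hjk)) h1 h2
      _ = _ := by simp
  have hmain : Pr r B.sym2 (fun T => ¬ big B (N₁ * n) T) ≤ N₁ * (1 - b) ^ N₂ + N₁ ^ 2 * Real.exp (-(ρ * n ^ 2)) := by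
    refine le_trans ?_ (add_le_add_left hnG _)
    unfold Pr
    rw [← Finset.union_sdiff_of_subset hS0B, Ex_union r Finset.disjoint_sdiff,
      ← Ex_const r S0 (N₁ ^ 2 * Real.exp (-(ρ * n ^ 2))), ← Ex_add]
    refine Ex_mono hr fun T hT => ?_
    by_cases hGT : G T
    swap
    · rw [ind_true hGT]
      have h1 := Pr_le_one hr (B.sym2 \ S0) (fun T' => ¬ big B (N₁ * n) (T ∪ T'))
      have h2 : 0 ≤ (N₁:ℝ) ^ 2 * Real.exp (-(ρ * n ^ 2)) := by positivity
      exact h1.trans (by linarith)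
    rw [ind_false (not_not.2 hGT), zero_add]
    choose j v hv hcard using hGT
    set K : Fin N₁ → Finset U := fun i => cl T (Q (i, j i)) (v i) with hK
    have hKQ : ∀ i, K i ⊆ Q (i, j i) := fun i => cl_sub _ _ _
    have hKd : ∀ i i', i ≠ i' → Disjoint (K i) (K i') := fun i i' h =>
      (hQ (i, j i) (i', j i') (fun h' => h (congrArg Prod.fst h'))).mono (hKQ i) (hKQ i')
    calc _ ≤ ∑ p ∈ (Finset.univ : Finset (Fin N₁ × Fin N₁)).filter (fun p => p.1 ≠ p.2), Pr r (B.sym2 \ S0)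
            (fun T' => ∀ e ∈ (K p.1 ×ˢ K p.2).image (fun p => s(p.1, p.2)), e ∉ T') := by
          refine Pr_exists_le hr _ _ _ _ fun T' _ h => ?_
          by_contra hcon
          push Not at hcon
          apply h
          have hcon' : ∀ i i', cn (T ∪ T') B (v i) (v i') := by
            intro i i'
            by_cases hii : i = i'
            · subst hii; exact cn_refl (hQB _ (hv i))
            obtain ⟨e, he, heT⟩ := hcon (i, i') (by simpa using hii)
            obtain ⟨⟨x, y⟩, hxy, rfl⟩ := mem_image.1 he
            rw [mem_product] at hxy
            have h1 : cn (T ∪ T') B (v i) x := (mem_cl.1 hxy.1).mono subset_union_left (hQB _)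
            have h2 : cn (T ∪ T') B (v i') y := (mem_cl.1 hxy.2).mono subset_union_left (hQB _)
            exact (h1.step h2.right (mem_union_right _ heT)).trans h2.symm
          refine ⟨v ⟨0, hN⟩, hQB _ (hv _), ?_⟩
          calc N₁ * n = ∑ i : Fin N₁, n := by simp
            _ ≤ ∑ i : Fin N₁, (K i).card := sum_le_sum fun i _ => hcard i
            _ = (Finset.univ.biUnion K).card := (Finset.card_biUnion fun i _ i' _ h => hKd i i' h).symm
            _ ≤ _ := by
              refine card_le_card fun y hy => ?_
              obtain ⟨i, -, hi⟩ := Finset.mem_biUnion.1 hy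
              exact mem_cl.2 ((hcon' _ i).trans ((mem_cl.1 hi).mono subset_union_left (hQB _)))
      _ ≤ ∑ p ∈ (Finset.univ : Finset (Fin N₁ × Fin N₁)).filter (fun p => p.1 ≠ p.2), Real.exp (-(ρ * n ^ 2)) := by
          refine sum_le_sum fun p hp => ?_
          have hp' : p.1 ≠ p.2 := (mem_filter.1 hp).2
          rw [Pr_none]
          · rw [Real.exp_le_exp, neg_le_neg_iff]
            refine le_trans ?_ (sum_rate_bipartite (ρ := ρ) (hKd _ _ hp') fun x hx y hy => hρ x (hQB _ (hKQ _ hx)) y (hQB _ (hKQ _ hy)) ?_)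
            · have h1 := hcard p.1
              have h2 := hcard p.2
              rw [sq]
              have h3 : (n:ℝ) ≤ (K p.1).card := by exact_mod_cast h1
              have h4 : (n:ℝ) ≤ (K p.2).card := by exact_mod_cast h2
              gcongr
            · rintro rfl; exact disjoint_left.1 (hKd _ _ hp') hx hy
          · intro e he
            obtain ⟨⟨x, y⟩, hxy, rfl⟩ := mem_image.1 he
            rw [mem_product] at hxy
            have hx := hKQ _ hxy.1
            have hy := hKQ _ hxy.2
            refine mem_sdiff.2 ⟨mk_mem_sym2_iff.2 ⟨hQB _ hx, hQB _ hy⟩, fun h => ?_⟩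
            obtain ⟨q, -, hq⟩ := Finset.mem_biUnion.1 h
            rw [mk_mem_sym2_iff] at hq
            have h1 : (p.1, j p.1) = q := by
              by_contra hne; exact disjoint_left.1 (hQ _ _ hne) hx hq.1
            have h2 : (p.2, j p.2) = q := by
              by_contra hne; exact disjoint_left.1 (hQ _ _ hne) hy hq.2
            exact hp' (congrArg Prod.fst (h1.trans h2.symm))
      _ ≤ ∑ p ∈ (Finset.univ : Finset (Fin N₁ × Fin N₁)), Real.exp (-(ρ * n ^ 2)) :=
          sum_le_sum_of_subset_of_nonneg (filter_subset _ _) fun _ _ _ => (Real.exp_pos _).le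
      _ = _ := by simp; ring
  rw [Pr_not] at hmain
  linarith
end split

section growth
open scoped Classical
variable {d : ℕ} {J : V d → V d → ℝ} {α c C : ℝ}

noncomputable def qb (a : V d) (l : ℕ) : Finset (V d) := Fintype.piFinset fun i => Finset.Ico (a i) (a i + l)
theorem mem_qb {a x : V d} {l : ℕ} : x ∈ qb a l ↔ ∀ i, a i ≤ x i ∧ x i < a i + l := by
  simp [qb, Fintype.mem_piFinset]
theorem card_qb (a : V d) (l : ℕ) : (qb a l).card = l ^ d := by simp [qb]
theorem qb_map (a z : V d) (l : ℕ) : (qb a l).map (sh z) = qb (a + z) l := by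
  ext x; simp only [mem_map, mem_qb, sh_apply]
  constructor
  · rintro ⟨y, hy, rfl⟩ i
    have := hy i; simp only [Pi.add_apply]; omega
  · intro h; refine ⟨x - z, fun i => ?_, by simp⟩
    have := h i; simp only [Pi.add_apply, Pi.sub_apply] at *; omega
theorem qb_dist {a x y : V d} {l : ℕ} (hx : x ∈ qb a l) (hy : y ∈ qb a l) : normInf (x - y) ≤ l := by
  rw [normInf, Finset.sup_le_iff]; intro i _
  have h1 := mem_qb.1 hx i; have h2 := mem_qb.1 hy i
  simp only [Pi.sub_apply]; omega
theorem normInf_pos {x : V d} (h : x ≠ 0) : 1 ≤ normInf x := by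
  obtain ⟨i, hi⟩ := Function.ne_iff.1 h
  have : (x i).natAbs ≤ normInf x := le_sup (f := fun i => (x i).natAbs) (mem_univ i)
  have h0 : x i ≠ 0 := hi
  omega
theorem J_lower (hJ : KernelHyp d J α c C) {x y : V d} {l : ℕ} (hxy : x ≠ y) (h : normInf (x - y) ≤ l) :
    c * (l : ℝ) ^ (-(d : ℝ) - α) ≤ J x y := by
  refine le_trans ?_ (hJ.lower x y hxy)
  have h1 := normInf_pos (sub_ne_zero.2 hxy)
  have := hJ.c_pos
  have h3 := hJ.alpha_pos
  refine mul_le_mul_of_nonneg_left ?_ this.le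
  exact Real.rpow_le_rpow_of_nonpos (by exact_mod_cast h1) (by exact_mod_cast h)
    (by have : (0:ℝ) ≤ d := by positivity
        linarith)
theorem big_map (t : V d ↪ V d) (B : Finset (V d)) (n : ℕ) (T : Finset (Sym2 (V d))) :
    big (B.map t) n (T.map t.sym2Map) ↔ big B n T := by
  have hc : ∀ v, cl (T.map t.sym2Map) (B.map t) (t v) = (cl T B v).map t := by
    intro v; ext y; rw [mem_cl, mem_map]; constructor
    · intro h
      obtain ⟨w, hw, rfl⟩ := mem_map.1 h.right
      exact ⟨w, mem_cl.2 (cn_map t |>.1 h), rfl⟩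
    · rintro ⟨w, hw, rfl⟩; exact (cn_map t).2 (mem_cl.1 hw)
  simp only [big, mem_map, exists_exists_and_eq_and, hc, Finset.card_map]
theorem Pr_big_sh (hJ : KernelHyp d J α c C) (β h : ℝ) (a z : V d) (l n : ℕ) :
    Pr (Rt J β h) (qb (a + z) l).sym2 (big (qb (a + z) l) n) = Pr (Rt J β h) (qb a l).sym2 (big (qb a l) n) := by
  rw [← qb_map, Pr_map (sh z) (Rt_sh hJ β h z)]
  exact Pr_congr fun T _ => big_map _ _ _ _
theorem qb_sub {l L : ℕ} {k : Fin d → Fin L} : qb (fun i => (l : ℤ) * (k i : ℕ)) l ⊆ qb 0 (L * l) := by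
  intro x hx; rw [mem_qb] at *; intro i
  have h := hx i
  have hk : ((k i : ℕ) : ℤ) + 1 ≤ L := by have := (k i).isLt; omega
  have h0 : (0:ℤ) ≤ (l:ℤ) * (k i : ℕ) := by positivity
  simp only [Pi.zero_apply]; push_cast
  constructor
  · linarith
  · nlinarith
theorem qb_disj {l L : ℕ} {k k' : Fin d → Fin L} (h : k ≠ k') :
    Disjoint (qb (fun i => (l : ℤ) * (k i : ℕ)) l) (qb (fun i => (l : ℤ) * (k' i : ℕ)) l) := by
  rw [disjoint_left]; intro x h1 h2
  rw [mem_qb] at h1 h2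
  obtain ⟨i, hi⟩ := Function.ne_iff.1 h
  have h1 := h1 i; have h2 := h2 i
  have : ((k i : ℕ) : ℤ) ≠ (k' i : ℕ) := by intro hh; exact hi (Fin.ext (by exact_mod_cast hh))
  rcases lt_or_gt_of_ne this with h3 | h3
  · have : ((k i : ℕ) : ℤ) + 1 ≤ (k' i : ℕ) := h3
    nlinarith
  · have : ((k' i : ℕ) : ℤ) + 1 ≤ (k i : ℕ) := h3
    nlinarith

theorem growth_step (hJ : KernelHyp d J α c C) {β b : ℝ} (hβ : 0 ≤ β) {L l N₁ N₂ n : ℕ} (hN : 1 ≤ N₁)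
    (hNN : N₁ * N₂ = L ^ d) (hb : b ≤ Pr (Rt J β 0) (qb (0 : V d) l).sym2 (big (qb 0 l) n)) :
    1 - N₁ * (1 - b) ^ N₂ - N₁ ^ 2 * Real.exp (-(β * (c * ((L * l : ℕ) : ℝ) ^ (-(d : ℝ) - α)) * n ^ 2)) ≤
      Pr (Rt J β 0) (qb (0 : V d) (L * l)).sym2 (big (qb 0 (L * l)) (N₁ * n)) := by
  have e : Fin N₁ × Fin N₂ ≃ (Fin d → Fin L) := Fintype.equivOfCardEq (by simp [hNN])
  refine growth_abs (Rt_nonneg hJ hβ le_rfl) hN (fun p => qb (fun i => (l : ℤ) * (e p i : ℕ)) l) _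
    (fun p => qb_sub) (fun p q hpq => qb_disj fun h => hpq (e.injective h)) ?_ ?_ ?_
  · have := hJ.c_pos; positivity
  · intro x hx y hy hxy
    rw [Rt_mk hJ _ _ hxy]
    exact mul_le_mul_of_nonneg_left (J_lower hJ hxy (qb_dist hx hy)) hβ
  · intro p
    have := Pr_big_sh hJ β 0 0 (fun i => (l : ℤ) * (e p i : ℕ)) l n
    rw [zero_add] at this
    rw [this]; exact hb

theorem big_chi (hJ : KernelHyp d J α c C) {β K : ℝ} (hβ : 0 ≤ β) (hK : Chi J β K) (B : Finset (V d)) (n : ℕ) :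
    Pr (Rt J β 0) B.sym2 (big B n) * (n:ℝ) ^ 2 ≤ B.card * K := by
  have h1 : Pr (Rt J β 0) B.sym2 (big B n) * (n:ℝ) ^ 2 ≤
      Ex (Rt J β 0) B.sym2 (fun T => ∑ v ∈ B, ∑ y ∈ cl T B v, (1:ℝ)) := by
    rw [mul_comm, Pr, ← Ex_mul]
    refine Ex_mono (Rt_nonneg hJ hβ le_rfl) fun T _ => ?_
    by_cases h : big B n T
    · rw [ind_true h, mul_one]
      obtain ⟨v, hv, hn⟩ := h
      have hcl : ∀ w ∈ cl T B v, cl T B w = cl T B v := by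
        intro w hw; ext y; rw [mem_cl, mem_cl]
        exact ⟨(mem_cl.1 hw).trans, (mem_cl.1 hw).symm.trans⟩
      calc (n:ℝ)^2 ≤ ∑ w ∈ cl T B v, ((cl T B v).card : ℝ) := by
            rw [sum_const, nsmul_eq_mul, sq]
            have : (n:ℝ) ≤ (cl T B v).card := by exact_mod_cast hn
            exact mul_self_le_mul_self (by positivity) this
        _ = ∑ w ∈ cl T B v, ∑ y ∈ cl T B w, (1:ℝ) :=
            sum_congr rfl fun w hw => by rw [hcl w hw]; simp
        _ ≤ _ := sum_le_sum_of_subset_of_nonneg (cl_sub _ _ _) fun w _ _ => by positivity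
    · rw [ind_false h, mul_zero]; positivity
  refine h1.trans ?_
  rw [Ex_sum]
  calc _ = ∑ v ∈ B, ∑ y ∈ B, tt J β B v y := sum_congr rfl fun v _ => by
        rw [Ex_card_cl subset_rfl]; simp [tt]
    _ ≤ ∑ v ∈ B, K := sum_le_sum fun v _ => hK B v
    _ = _ := by simp

theorem params (hJ : KernelHyp d J α c C) : ∃ L N₁ N₂ : ℕ, 2 ≤ L ∧ 1 ≤ N₁ ∧ N₁ * N₂ = L ^ d ∧
    (L : ℝ) ^ ((d:ℝ) + α) ≤ (N₁:ℝ) ^ 2 ∧ (N₁ : ℝ) * (11/12) ^ N₂ ≤ 1/4 := by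
  obtain ⟨k, hk⟩ := exists_nat_gt (2 / ((d:ℝ) - α))
  have hda : 0 < (d:ℝ) - α := by linarith [hJ.alpha_lt_d]
  have hd := hJ.d_pos
  rw [div_lt_iff₀ hda] at hk
  have hk1 : 1 ≤ k := by
    rcases Nat.eq_zero_or_pos k with h | h
    · subst h; norm_num at hk
    · exact h
  have ht := tendsto_pow_const_mul_const_pow_of_abs_lt_one (k * d) (r := (11/12:ℝ)) (by norm_num [abs_lt])
  have ht2 : Filter.Tendsto (fun q : ℕ => 2 ^ q) Filter.atTop Filter.atTop :=
    tendsto_pow_atTop_atTop_of_one_lt (by norm_num)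
  have h3 := (ht.comp ht2).eventually (eventually_le_nhds (show (0:ℝ) < 1/4 by norm_num))
  obtain ⟨q, hq, hq1⟩ := (h3.and (Filter.eventually_ge_atTop 1)).exists
  have hkd : 1 ≤ k * d := Nat.mul_pos hk1 hd
  have hle : q ≤ k * q * d := by nlinarith
  refine ⟨2 ^ (k * q), 2 ^ (k * q * d - q), 2 ^ q, ?_, Nat.one_le_two_pow, ?_, ?_, ?_⟩
  · calc 2 = 2 ^ 1 := by norm_num
      _ ≤ _ := Nat.pow_le_pow_right (by norm_num) (by nlinarith)
  · rw [← pow_add, Nat.sub_add_cancel hle, pow_mul]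
  · push_cast
    rw [← Real.rpow_natCast 2 (k*q), ← Real.rpow_mul (by norm_num), ← pow_mul, ← Real.rpow_natCast 2]
    refine Real.rpow_le_rpow_of_exponent_le (by norm_num) ?_
    push_cast [Nat.cast_sub hle]
    have : (1:ℝ) ≤ q := by exact_mod_cast hq1
    nlinarith
  · refine le_trans ?_ hq
    simp only [Function.comp]
    refine mul_le_mul_of_nonneg_right ?_ (by positivity)
    push_cast
    rw [← pow_mul]
    refine pow_le_pow_right₀ (by norm_num) ?_
    have : q * (k * d) = k * q * d := by ring
    omega

theorem growth (hJ : KernelHyp d J α c C) : ∃ Kst : ℝ, 0 < Kst ∧ ∀ (β : ℝ) (l n : ℕ), 0 < β → 1 ≤ l → 1 ≤ n →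
    Kst * (l:ℝ) ^ ((d:ℝ) + α) ≤ β * (n:ℝ) ^ 2 →
    1/12 ≤ Pr (Rt J β 0) (qb (0 : V d) l).sym2 (big (qb 0 l) n) → ¬ ∃ K, Chi J β K := by
  obtain ⟨L, N₁, N₂, hL, hN, hNN, hLN, hN2⟩ := params hJ
  have hc := hJ.c_pos
  have hα := hJ.alpha_pos
  have hLp : (0:ℝ) < L := by exact_mod_cast (by omega : 0 < L)
  obtain ⟨Kst, hK0, hK⟩ : ∃ Kst : ℝ, 0 < Kst ∧
      (N₁:ℝ) ^ 2 * Real.exp (-(c * (L:ℝ) ^ (-(d : ℝ) - α) * Kst)) ≤ 1/4 := by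
    have hg : 0 < c * (L:ℝ) ^ (-(d : ℝ) - α) := by positivity
    have h1 : Filter.Tendsto (fun K : ℝ => (N₁:ℝ) ^ 2 * Real.exp (-(c * (L:ℝ) ^ (-(d : ℝ) - α) * K))) Filter.atTop (nhds ((N₁:ℝ)^2 * 0)) := by
      refine Filter.Tendsto.const_mul _ ?_
      exact Real.tendsto_exp_neg_atTop_nhds_zero.comp (Filter.tendsto_id.const_mul_atTop hg)
    rw [mul_zero] at h1
    obtain ⟨K, h2, h3⟩ := ((h1.eventually (eventually_le_nhds (show (0:ℝ) < 1/4 by norm_num))).and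
      (Filter.eventually_gt_atTop 0)).exists
    exact ⟨K, h3, h2⟩
  refine ⟨Kst, hK0, ?_⟩
  rintro β l n hβ hl hn hcond hb ⟨K, hKc⟩
  have key : ∀ k : ℕ, Kst * ((L ^ k * l : ℕ):ℝ) ^ ((d:ℝ) + α) ≤ β * ((N₁ ^ k * n : ℕ):ℝ) ^ 2 ∧
      1/12 ≤ Pr (Rt J β 0) (qb (0 : V d) (L ^ k * l)).sym2 (big (qb 0 (L ^ k * l)) (N₁ ^ k * n)) := by
    intro k
    induction k with
    | zero => simpa using ⟨hcond, by simpa using hb⟩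
    | succ k ih =>
      obtain ⟨h1, h2⟩ := ih
      set l' := L ^ k * l with hl'
      set n' := N₁ ^ k * n with hn'
      have el : L ^ (k+1) * l = L * l' := by rw [hl']; ring
      have en : N₁ ^ (k+1) * n = N₁ * n' := by rw [hn']; ring
      rw [el, en]
      have hl'0 : (0:ℝ) < l' := by
        have : 0 < l' := Nat.mul_pos (by positivity) hl
        exact_mod_cast this
      constructor
      · push_cast
        rw [Real.mul_rpow hLp.le hl'0.le, mul_pow]
        calc _ = (L:ℝ) ^ ((d:ℝ)+α) * (Kst * (l':ℝ) ^ ((d:ℝ)+α)) := by ring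
          _ ≤ (N₁:ℝ)^2 * (β * (n':ℝ)^2) := mul_le_mul hLN h1 (by positivity) (by positivity)
          _ = _ := by ring
      · refine le_trans ?_ (growth_step hJ hβ.le hN hNN h2)
        have h3 : c * (L:ℝ) ^ (-(d : ℝ) - α) * Kst ≤ β * (c * ((L * l' : ℕ) : ℝ) ^ (-(d : ℝ) - α)) * (n':ℝ) ^ 2 := by
          push_cast
          rw [Real.mul_rpow hLp.le hl'0.le]
          have h4 : (l':ℝ) ^ ((d:ℝ)+α) * (l':ℝ) ^ (-(d:ℝ)-α) = 1 := by
            rw [← Real.rpow_add hl'0]; simp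
          calc c * (L:ℝ) ^ (-(d : ℝ) - α) * Kst
              = c * (L:ℝ) ^ (-(d : ℝ) - α) * (l':ℝ) ^ (-(d:ℝ)-α) * (Kst * (l':ℝ) ^ ((d:ℝ)+α)) := by
                linear_combination (-(c * (L:ℝ) ^ (-(d : ℝ) - α) * Kst)) * h4
            _ ≤ c * (L:ℝ) ^ (-(d : ℝ) - α) * (l':ℝ) ^ (-(d:ℝ)-α) * (β * (n':ℝ)^2) :=
                mul_le_mul_of_nonneg_left h1 (by positivity)
            _ = _ := by ring
        have h5 : (N₁:ℝ) ^ 2 * Real.exp (-(β * (c * ((L * l' : ℕ) : ℝ) ^ (-(d : ℝ) - α)) * (n':ℝ) ^ 2)) ≤ 1/4 := by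
          refine le_trans ?_ hK
          gcongr
        have h6 : (N₁ : ℝ) * (1 - 1/12) ^ N₂ ≤ 1/4 := by norm_num at hN2 ⊢; exact hN2
        linarith
  have hbd : ∀ k : ℕ, ((2:ℝ) ^ α) ^ k ≤ 12 * K * β / Kst := by
    intro k
    obtain ⟨h1, h2⟩ := key k
    have h3 := big_chi hJ hβ.le hKc (qb (0 : V d) (L ^ k * l)) (N₁ ^ k * n)
    rw [card_qb] at h3
    set l' := L ^ k * l
    set n' := N₁ ^ k * n
    have hl'k : (2:ℝ) ^ k ≤ l' := by
      have : 2 ^ k ≤ l' := (Nat.pow_le_pow_left hL k).trans (Nat.le_mul_of_pos_right _ hl)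
      exact_mod_cast this
    have hl'0 : (0:ℝ) < l' := lt_of_lt_of_le (by positivity) hl'k
    have h4 : (n':ℝ)^2 ≤ 12 * ((l':ℝ)^d * K) := by
      push_cast at h3
      nlinarith [mul_le_mul_of_nonneg_right h2 (sq_nonneg (n':ℝ))]
    have h5 : Kst * ((l':ℝ)^d * (l':ℝ)^α) ≤ β * (12 * ((l':ℝ)^d * K)) := by
      refine le_trans ?_ (mul_le_mul_of_nonneg_left h4 hβ.le)
      rw [← Real.rpow_natCast (l':ℝ) d, ← Real.rpow_add hl'0]; exact h1
    have h6 : Kst * (l':ℝ)^α ≤ β * 12 * K := by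
      have : (0:ℝ) < (l':ℝ)^d := by positivity
      nlinarith
    rw [le_div_iff₀ hK0]
    have h7 : ((2:ℝ) ^ α) ^ k ≤ (l':ℝ)^α := by
      rw [← Real.rpow_natCast, ← Real.rpow_mul (by norm_num), mul_comm, Real.rpow_mul (by norm_num), Real.rpow_natCast]
      exact Real.rpow_le_rpow (by positivity) hl'k hα.le
    nlinarith
  obtain ⟨k, hk⟩ := pow_unbounded_of_one_lt (12 * K * β / Kst) (Real.one_lt_rpow (by norm_num : (1:ℝ) < 2) hα)
  exact absurd (hbd k) (not_le.2 hk)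

theorem PS_nonempty (hJ : KernelHyp d J α c C) {P : ℝ → Measure (Config d)} (hP : IsLRP J P) : (PS P).Nonempty := by
  obtain ⟨Kst, hK0, hK⟩ := growth hJ
  refine ⟨Kst + 1, mem_PS hJ hP hK0 (by linarith) fun hs => ?_⟩
  obtain ⟨K, _, hc⟩ := hs.chi hJ hK0.le
  refine hK Kst 1 1 hK0 le_rfl le_rfl (by simp) ?_ ⟨K, hc⟩
  rw [Pr_true]; · norm_num
  intro T _
  have h0 : (0 : V d) ∈ qb (0 : V d) 1 := mem_qb.2 fun i => by simp
  exact ⟨0, h0, card_pos.2 ⟨0, mem_cl.2 (cn_refl h0)⟩⟩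
end growth

set_option linter.unusedTactic false
section twopt
open scoped Classical
variable {d : ℕ} {J : V d → V d → ℝ} {α c C : ℝ}

theorem sq_iter {s : ℕ → ℝ} {κ K : ℝ} (hκ : 0 < κ) (hs : ∀ k, κ * s k ^ 2 ≤ s (k + 1)) (hK : ∀ k, s k ≤ K) (k : ℕ) :
    s k ≤ 1 / κ := by
  by_contra h
  push Not at h
  rw [div_lt_iff₀ hκ] at h
  have hsk : 0 < s k := by nlinarith
  have : ∀ j, (s k * κ) ^ j * s k ≤ s (k + j) ∧ s k ≤ s (k + j) := by
    intro j
    induction j with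
    | zero => simp
    | succ j ih =>
      obtain ⟨h1, h2⟩ := ih
      have h3 : s k * κ * s (k + j) ≤ s (k + j + 1) := by
        refine le_trans ?_ (hs (k + j))
        have : 0 ≤ κ * s (k+j) := by nlinarith
        nlinarith
      refine ⟨?_, ?_⟩
      · calc _ = (s k * κ) * ((s k * κ) ^ j * s k) := by ring
          _ ≤ (s k * κ) * s (k + j) := mul_le_mul_of_nonneg_left h1 (by linarith)
          _ ≤ _ := h3
      · rw [← add_assoc]; nlinarith
  obtain ⟨j, hj⟩ := pow_unbounded_of_one_lt (K / s k) h
  rw [div_lt_iff₀ hsk] at hj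
  linarith [(this j).1, hK (k + j)]

theorem one_sub_exp_ge {t t₁ : ℝ} (h0 : 0 ≤ t) (h : t ≤ t₁) : t / (1 + t₁) ≤ 1 - Real.exp (-t) := by
  have h1 : t / (1 + t₁) ≤ t / (1 + t) := div_le_div_of_nonneg_left h0 (by linarith) (by linarith)
  have h2 : Real.exp (-t) ≤ 1 / (1 + t) := by
    rw [Real.exp_neg, ← one_div]
    exact one_div_le_one_div_of_le (by linarith) (by linarith [Real.add_one_le_exp t])
  have h3 : t / (1 + t) = 1 - 1 / (1 + t) := by field_simp; ring
  linarith

theorem two_cubes (hJ : KernelHyp d J α c C) {β ρ t₁ : ℝ} (hβ : 0 ≤ β) {Q Q' B : Finset (V d)} (hQ : Q ⊆ B) (hQ' : Q' ⊆ B)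
    (hd : Disjoint Q Q') (hρ0 : 0 ≤ ρ) (hρ : ∀ x ∈ Q, ∀ y ∈ Q', ρ ≤ β * J x y) {n : ℕ} (ht : ρ * (n:ℝ) ^ 2 ≤ t₁) (u v : V d) (hu : u ∈ Q) (hv : v ∈ Q') :
    ρ / (1 + t₁) * (Ex (Rt J β 0) Q.sym2 (fun T => min ((cl T Q u).card : ℝ) n) *
      Ex (Rt J β 0) Q'.sym2 (fun T => min ((cl T Q' v).card : ℝ) n)) ≤ tt J β B u v := by
  have hr := Rt_nonneg hJ hβ (le_refl 0)
  set bip : Finset (V d) × Finset (V d) → Finset (Sym2 (V d)) := fun D => (D.1 ×ˢ D.2).image (fun p => s(p.1, p.2)) with hbip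
  have hcd : ∀ (Q : Finset (V d)) u, Dep (inner Q) (fun T => cl T Q u) := by
    intro Q x T T' h
    beta_reduce
    ext y; rw [mem_cl, mem_cl]; exact iff_of_eq (cn_dep Q x y T T' h)
  have hdis : ∀ e, inner Q e → ¬ inner Q' e := by
    intro e; induction e using Sym2.ind with
    | _ x y =>
      rintro ⟨h1, _⟩ ⟨h2, _⟩
      rw [mk_mem_sym2_iff] at h1 h2
      exact disjoint_left.1 hd h1.1 h2.1
  have e1 : Ex (Rt J β 0) B.sym2 (fun T => min ((cl T Q u).card : ℝ) n * min ((cl T Q' v).card : ℝ) n) =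
     Ex (Rt J β 0) Q.sym2 (fun T => min ((cl T Q u).card : ℝ) n) *
      Ex (Rt J β 0) Q'.sym2 (fun T => min ((cl T Q' v).card : ℝ) n) := by
    have d1 : Dep (inner Q) (fun T => min ((cl T Q u).card : ℝ) n) := fun T T' h => by
      have := hcd Q u T T' h; beta_reduce at this ⊢; rw [this]
    have d2 : Dep (inner Q') (fun T => min ((cl T Q' v).card : ℝ) n) := fun T T' h => by
      have := hcd Q' v T T' h; beta_reduce at this ⊢; rw [this]
    rw [Ex_indep d1 (d2.mono fun e he h => hdis e h he)]
    congr 1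
    · exact Ex_dep_congr d1 (fun e he => ⟨fun _ => he.1, fun h => sym2_mono hQ h⟩) fun _ _ _ => rfl
    · exact Ex_dep_congr d2 (fun e he => ⟨fun _ => he.1, fun h => sym2_mono hQ' h⟩) fun _ _ _ => rfl
  rw [← e1, ← Ex_mul]
  have e2 : Ex (Rt J β 0) B.sym2 (fun T => ind (∃ e ∈ bip (cl T Q u, cl T Q' v), e ∈ T)) ≤ tt J β B u v := by
    refine Ex_mono hr fun T _ => ind_mono ?_
    rintro ⟨e, he, heT⟩
    obtain ⟨⟨x, y⟩, hxy, rfl⟩ := mem_image.1 he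
    obtain ⟨hx, hy⟩ := mem_product.1 hxy
    have hx := mem_cl.1 hx; have hy := mem_cl.1 hy
    exact ((hx.mono subset_rfl hQ).step (hQ' hy.right) heT).trans (hy.symm.mono subset_rfl hQ')
  refine le_trans ?_ e2
  rw [Ex_cond (Q.powerset ×ˢ Q'.powerset) (fun T => (cl T Q u, cl T Q' v)) (F := fun D T => ind (∃ e ∈ bip D, e ∈ T))]
  · refine Ex_mono hr fun T _ => ?_
    set K := cl T Q u with hK
    set K' := cl T Q' v with hK'
    have hKQ : K ⊆ Q := cl_sub _ _ _
    have hKQ' : K' ⊆ Q' := cl_sub _ _ _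
    have hKK : Disjoint K K' := Finset.disjoint_of_subset_left hKQ (Finset.disjoint_of_subset_right hKQ' hd)
    have hsub : bip (K, K') ⊆ B.sym2 := by
      intro e he
      obtain ⟨⟨x, y⟩, hxy, rfl⟩ := mem_image.1 he
      obtain ⟨hx, hy⟩ := mem_product.1 hxy
      exact mk_mem_sym2_iff.2 ⟨hQ (hKQ hx), hQ' (hKQ' hy)⟩
    have h1 : Ex (Rt J β 0) B.sym2 (fun T => ind (∃ e ∈ bip (K, K'), e ∈ T)) =
        1 - Real.exp (-∑ e ∈ bip (K, K'), Rt J β 0 e) := by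
      rw [← Pr_none hsub, ← Pr_not]
      exact Ex_congr fun T _ => ind_congr (by push Not; rfl)
    rw [h1]
    have h2 : ρ * (K.card * K'.card) ≤ ∑ e ∈ bip (K, K'), Rt J β 0 e := by
      refine sum_rate_bipartite hKK fun x hx y hy => ?_
      rw [Rt_mk hJ]
      · exact hρ x (hKQ hx) y (hKQ' hy)
      · rintro rfl; exact disjoint_left.1 hKK hx hy
    set p := min (K.card : ℝ) n
    set q := min (K'.card : ℝ) n
    have hp0 : 0 ≤ p := le_min (by positivity) (by positivity)
    have hq0 : 0 ≤ q := le_min (by positivity) (by positivity)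
    have hpq : ρ * (p * q) ≤ ρ * (K.card * K'.card) :=
      mul_le_mul_of_nonneg_left (mul_le_mul (min_le_left _ _) (min_le_left _ _) hq0 (by positivity)) hρ0
    have hpn : ρ * (p * q) ≤ t₁ := le_trans (mul_le_mul_of_nonneg_left
      (by rw [sq]; exact mul_le_mul (min_le_right _ _) (min_le_right _ _) hq0 (by positivity)) hρ0) ht
    have h3 := one_sub_exp_ge (by positivity) hpn
    have h4 : Real.exp (-∑ e ∈ bip (K, K'), Rt J β 0 e) ≤ Real.exp (-(ρ * (p * q))) := by
      apply Real.exp_le_exp.2; linarith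
    calc _ = ρ * (p * q) / (1 + t₁) := by ring
      _ ≤ _ := by linarith
  · intro T _
    exact mem_product.2 ⟨mem_powerset.2 (cl_sub _ _ _), mem_powerset.2 (cl_sub _ _ _)⟩
  · intro D hD
    obtain ⟨h1, h2⟩ := mem_product.1 hD
    rw [mem_powerset] at h1 h2
    refine ⟨fun e => inner Q e ∨ inner Q' e, fun T T' h => ?_, fun T T' h => ?_⟩
    · have a1 := hcd Q u T T' fun e he => h e (Or.inl he)
      have a2 := hcd Q' v T T' fun e he => h e (Or.inr he)
      beta_reduce at a1 a2 ⊢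
      rw [a1, a2]
    · refine ind_congr (exists_congr fun e => and_congr_right fun he => h e ?_)
      obtain ⟨⟨x, y⟩, hxy, rfl⟩ := mem_image.1 he
      obtain ⟨hx, hy⟩ := mem_product.1 hxy
      rintro (⟨h, _⟩ | ⟨h, _⟩) <;> rw [mk_mem_sym2_iff] at h
      · exact disjoint_left.1 hd h.2 (h2 hy)
      · exact disjoint_left.1 hd (h1 hx) h.1

noncomputable def SS (J : V d → V d → ℝ) (β : ℝ) (B : Finset (V d)) : ℝ := ∑ x ∈ B, ∑ y ∈ B, tt J β B x y
theorem SS_sh (hJ : KernelHyp d J α c C) (β : ℝ) (B : Finset (V d)) (z : V d) : SS J β (B.map (sh z)) = SS J β B := by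
  unfold SS; rw [sum_map]; refine sum_congr rfl fun x _ => ?_
  rw [sum_map]; refine sum_congr rfl fun y _ => tt_sh hJ β B x y z

theorem SS_step (hJ : KernelHyp d J α c C) {β ρ t₁ : ℝ} (hβ : 0 ≤ β) {Q Q' B : Finset (V d)} (hQ : Q ⊆ B) (hQ' : Q' ⊆ B)
    (hd : Disjoint Q Q') (hρ0 : 0 ≤ ρ) (hρ : ∀ x ∈ Q, ∀ y ∈ Q', ρ ≤ β * J x y) {n : ℕ} (hn : 1 ≤ n) (ht : ρ * (n:ℝ) ^ 2 ≤ t₁)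
    (h1 : Pr (Rt J β 0) Q.sym2 (big Q n) ≤ 1/12) (h2 : Pr (Rt J β 0) Q'.sym2 (big Q' n) ≤ 1/12) :
    ρ / (1 + t₁) / 16 * (SS J β Q * SS J β Q') ≤ SS J β B := by
  have hr := Rt_nonneg hJ hβ (le_refl 0)
  have ht1 : 0 ≤ t₁ := le_trans (by positivity) ht
  have hS : ∀ Q : Finset (V d), Pr (Rt J β 0) Q.sym2 (big Q n) ≤ 1/12 →
      SS J β Q ≤ 4 * ∑ u ∈ Q, Ex (Rt J β 0) Q.sym2 (fun T => min ((cl T Q u).card : ℝ) n) := by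
    intro Q hQ; rw [mul_sum]; exact sum_le_sum fun u _ => tight hr Q u hn hQ
  have hS0 : ∀ Q : Finset (V d), 0 ≤ SS J β Q := fun Q =>
    sum_nonneg fun x _ => sum_nonneg fun y _ => tt_nonneg hJ hβ
  calc ρ / (1 + t₁) / 16 * (SS J β Q * SS J β Q')
      ≤ ρ / (1 + t₁) / 16 * ((4 * ∑ u ∈ Q, Ex (Rt J β 0) Q.sym2 (fun T => min ((cl T Q u).card : ℝ) n)) *
        (4 * ∑ u ∈ Q', Ex (Rt J β 0) Q'.sym2 (fun T => min ((cl T Q' u).card : ℝ) n))) :=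
        mul_le_mul_of_nonneg_left (mul_le_mul (hS Q h1) (hS Q' h2) (hS0 _) ((hS0 _).trans (hS Q h1))) (by positivity)
    _ = ∑ u ∈ Q, ∑ v ∈ Q', ρ / (1 + t₁) * (Ex (Rt J β 0) Q.sym2 (fun T => min ((cl T Q u).card : ℝ) n) *
      Ex (Rt J β 0) Q'.sym2 (fun T => min ((cl T Q' v).card : ℝ) n)) := by
        simp_rw [← mul_sum, ← sum_mul]; ring
    _ ≤ ∑ u ∈ Q, ∑ v ∈ Q', tt J β B u v := sum_le_sum fun u hu => sum_le_sum fun v hv =>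
        two_cubes hJ hβ hQ hQ' hd hρ0 hρ ht u v hu hv
    _ ≤ ∑ u ∈ Q, ∑ v ∈ B, tt J β B u v := sum_le_sum fun u hu =>
        sum_le_sum_of_subset_of_nonneg hQ' fun _ _ _ => tt_nonneg hJ hβ
    _ ≤ _ := sum_le_sum_of_subset_of_nonneg hQ fun _ _ _ => sum_nonneg fun _ _ => tt_nonneg hJ hβ

theorem A3 (hJ : KernelHyp d J α c C) {β₀ : ℝ} (hβ₀ : 0 < β₀) : ∃ CA : ℝ, 0 < CA ∧ ∀ β, β₀ ≤ β → (∃ K, Chi J β K) →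
    ∀ k : ℕ, SS J β (qb 0 (2 ^ k)) ≤ CA * ((2:ℝ) ^ k) ^ ((d:ℝ) + α) := by
  obtain ⟨Kst, hK0, hK⟩ := growth hJ
  have hc := hJ.c_pos
  have hα := hJ.alpha_pos
  set C₁ : ℝ := 2 + 2 * (Kst / β₀) with hC₁
  have hC10 : 0 < C₁ := by positivity
  set t₁ : ℝ := β₀ * c * C₁ with ht₁
  set κ : ℝ := β₀ * c * ((2:ℝ) ^ (-(d:ℝ) - α)) / (1 + t₁) / 16 * (2:ℝ) ^ (-(d:ℝ) - α) with hκ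
  have ht10 : 0 < t₁ := by positivity
  have hκ0 : 0 < κ := by positivity
  refine ⟨1 / κ, by positivity, ?_⟩
  rintro β hβ ⟨K, hKc⟩ k
  have hβ0 : 0 < β := hβ₀.trans_le hβ
  have hpos : ∀ k : ℕ, (0:ℝ) < ((2:ℝ) ^ k) ^ ((d:ℝ) + α) := fun k => by positivity
  rw [← div_le_iff₀ (hpos k)]
  refine sq_iter (s := fun k => SS J β (qb 0 (2 ^ k)) / ((2:ℝ) ^ k) ^ ((d:ℝ) + α)) (K := K) hκ0 ?_ ?_ k
  · intro k
    set l : ℕ := 2 ^ k with hl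
    have hl0 : (0:ℝ) < (l:ℝ) := by rw [hl]; positivity
    have hl1 : (1:ℝ) ≤ l := by rw [hl]; push_cast; exact one_le_pow₀ (by norm_num)
    have hlc : ((2:ℝ) ^ k) = (l:ℝ) := by rw [hl]; push_cast; rfl
    have hlc' : ((2:ℝ) ^ (k+1)) = 2 * (l:ℝ) := by rw [pow_succ, hlc]; ring
    set X : ℝ := (l:ℝ) ^ ((d:ℝ) + α) with hX
    have hX1 : 1 ≤ X := Real.one_le_rpow hl1 (by positivity)
    have hXi : (l:ℝ) ^ (-(d:ℝ) - α) = X⁻¹ := by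
      rw [hX, ← Real.rpow_neg hl0.le]; congr 1; ring
    set n : ℕ := ⌈Real.sqrt (Kst / β₀ * X)⌉₊ with hn
    have hY : 0 < Kst / β₀ * X := by positivity
    have hn1 : 1 ≤ n := Nat.one_le_iff_ne_zero.2 (Nat.ceil_pos.2 (Real.sqrt_pos.2 hY)).ne'
    have hnl : Real.sqrt (Kst / β₀ * X) ≤ n := Nat.le_ceil _
    have hnu : (n:ℝ) < Real.sqrt (Kst / β₀ * X) + 1 := Nat.ceil_lt_add_one (Real.sqrt_nonneg _)
    have hsq := Real.sq_sqrt hY.le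
    have hn2 : (n:ℝ)^2 ≤ C₁ * X := by
      have : (n:ℝ)^2 ≤ (Real.sqrt (Kst / β₀ * X) + 1)^2 := by gcongr
      rw [hC₁]
      nlinarith [sq_nonneg (Real.sqrt (Kst / β₀ * X) - 1)]
    have hn3 : Kst * X ≤ β * (n:ℝ)^2 := by
      have h1 : Kst / β₀ * X ≤ (n:ℝ)^2 := by
        rw [← hsq]; exact pow_le_pow_left₀ (Real.sqrt_nonneg _) hnl 2
      calc Kst * X = β₀ * (Kst / β₀ * X) := by field_simp
        _ ≤ β * (n:ℝ)^2 := mul_le_mul hβ h1 hY.le hβ0.le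
    have hbig : Pr (Rt J β 0) (qb (0 : V d) l).sym2 (big (qb 0 l) n) ≤ 1/12 := by
      by_contra h
      push Not at h
      exact hK β l n hβ0 (by exact_mod_cast hl1) hn1 hn3 h.le ⟨K, hKc⟩
    set ρ : ℝ := β₀ * (c * ((2 * l : ℕ):ℝ) ^ (-(d:ℝ) - α)) with hρ
    have hρe : ρ = β₀ * c * (2:ℝ) ^ (-(d:ℝ) - α) * X⁻¹ := by
      rw [hρ, ← hXi]; push_cast; rw [Real.mul_rpow (by norm_num) hl0.le]; ring
    have hρ0 : 0 ≤ ρ := by rw [hρe]; positivity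
    have h2le : (2:ℝ) ^ (-(d:ℝ) - α) ≤ 1 := Real.rpow_le_one_of_one_le_of_nonpos (by norm_num)
      (by have : (0:ℝ) ≤ d := by positivity
          linarith)
    have hst := SS_step hJ (β := β) (ρ := ρ) (t₁ := t₁) hβ0.le (Q := qb 0 l) (Q' := qb (0 + fun _ => (l:ℤ)) l)
      (B := qb 0 (2 * l)) (n := n)
      (by intro x hx; rw [mem_qb] at *; intro i; have := hx i; simp only [Pi.zero_apply] at *; push_cast; omega)
      (by intro x hx; rw [mem_qb] at *; intro i; have := hx i; simp only [Pi.zero_apply, Pi.add_apply] at *; push_cast; omega)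
      (by
        rw [disjoint_left]; intro x h1 h2
        rw [mem_qb] at h1 h2
        have i : Fin d := ⟨0, hJ.d_pos⟩
        have h1 := h1 i; have h2 := h2 i; simp only [Pi.zero_apply, Pi.add_apply] at *; omega) hρ0
      (by
        intro x hx y hy
        have hxy : x ≠ y := by
          rintro rfl
          rw [mem_qb] at hx hy
          have i : Fin d := ⟨0, hJ.d_pos⟩
          have h1 := hx i; have h2 := hy i; simp only [Pi.zero_apply, Pi.add_apply] at *; omega
        refine mul_le_mul hβ (J_lower hJ hxy ?_) (by positivity) hβ0.le
        refine qb_dist (a := 0) ?_ ?_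
        · rw [mem_qb] at *; intro i; have := hx i; simp only [Pi.zero_apply] at *; push_cast; omega
        · rw [mem_qb] at *; intro i; have := hy i; simp only [Pi.zero_apply, Pi.add_apply] at *; push_cast; omega)
      hn1
      (by
        rw [hρe, ht₁]
        calc _ ≤ β₀ * c * 1 * X⁻¹ * (C₁ * X) := by gcongr
          _ = _ := by field_simp)
      hbig (by rw [Pr_big_sh hJ]; exact hbig)
    rw [← qb_map, SS_sh hJ] at hst
    have e2 : (2:ℕ) ^ (k+1) = 2 * l := by rw [hl]; ring
    beta_reduce
    rw [e2, hlc, hlc', Real.mul_rpow (by norm_num) hl0.le]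
    have h2i : (2:ℝ) ^ ((d:ℝ) + α) = ((2:ℝ) ^ (-(d:ℝ) - α))⁻¹ := by
      rw [← Real.rpow_neg (by norm_num)]; congr 1; ring
    rw [h2i, ← hX, le_div_iff₀ (by positivity)]
    refine le_trans (le_of_eq ?_) hst
    rw [hκ, hρe]
    have : (2:ℝ) ^ (-(d:ℝ) - α) ≠ 0 := by positivity
    field_simp
  · intro k
    beta_reduce
    rw [div_le_iff₀ (hpos k)]
    have hKp : 0 ≤ K := le_trans (by simp) (hKc ∅ 0)
    calc SS J β (qb 0 (2^k)) ≤ ∑ x ∈ qb (0 : V d) (2^k), K := sum_le_sum fun x _ => hKc _ x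
      _ = K * ((2:ℝ)^k)^(d:ℝ) := by rw [sum_const, card_qb, nsmul_eq_mul, Real.rpow_natCast]; push_cast; ring
      _ ≤ _ := mul_le_mul_of_nonneg_left (Real.rpow_le_rpow_of_exponent_le (one_le_pow₀ (by norm_num)) (by linarith)) hKp

theorem A4 (hJ : KernelHyp d J α c C) {β₀ : ℝ} (hβ₀ : 0 < β₀) : ∃ CA : ℝ, 0 < CA ∧ ∀ β, β₀ ≤ β → (∃ K, Chi J β K) →
    ∀ R : ℕ, 1 ≤ R → ∑ a ∈ bx d R, tt J β (bx d R) 0 a ≤ CA * (R:ℝ) ^ α := by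
  obtain ⟨CA, hCA, h⟩ := A3 hJ hβ₀
  have hα := hJ.alpha_pos
  refine ⟨2 ^ d * CA * 8 ^ α, by positivity, fun β hβ hK R hR => ?_⟩
  have hβ0 : 0 < β := hβ₀.trans_le hβ
  set k := Nat.log 2 (4 * R) + 1 with hk
  have h1 : 4 * R < 2 ^ k := Nat.lt_pow_succ_log_self (by norm_num) _
  have h2 : 2 ^ k ≤ 8 * R := by
    have := Nat.pow_log_le_self 2 (x := 4 * R) (by omega)
    rw [hk, pow_succ]; omega
  have h3 := h β hβ hK k
  set l := 2 ^ k with hl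
  have hlc : ((2:ℝ) ^ k) = (l:ℝ) := by rw [hl]; push_cast; rfl
  have hl0 : (0:ℝ) < (l:ℝ) := by rw [← hlc]; positivity
  set X := ∑ a ∈ bx d R, tt J β (bx d R) 0 a with hX
  have hsub : ∀ z ∈ qb (fun _ => (R:ℤ)) (l - 2 * R), (bx d R).map (sh z) ⊆ qb (0 : V d) l := by
    intro z hz x hx
    obtain ⟨y, hy, rfl⟩ := mem_map.1 hx
    rw [sh_apply, mem_qb]; rw [mem_qb] at hz
    simp only [bx, Finset.mem_Icc, Pi.le_def] at hy
    intro i; have := hz i; have a := hy.1 i; have b := hy.2 i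
    simp only [Pi.zero_apply, Pi.add_apply] at *
    omega
  have h4 : ((l - 2 * R : ℕ) : ℝ) ^ d * X ≤ SS J β (qb 0 l) := by
    calc _ = ∑ z ∈ qb (fun _ => (R:ℤ)) (l - 2 * R) , X := by
          rw [sum_const, card_qb, nsmul_eq_mul]; push_cast; rfl
      _ ≤ ∑ z ∈ qb (fun _ : Fin d => (R:ℤ)) (l - 2 * R), ∑ y ∈ qb 0 l, tt J β (qb 0 l) z y := by
          refine sum_le_sum fun z hz => ?_
          calc X = ∑ a ∈ (bx d R).map (sh z), tt J β ((bx d R).map (sh z)) z a := by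
                rw [sum_map]
                refine sum_congr rfl fun a _ => ?_
                have := tt_sh hJ β (bx d R) 0 a z
                rw [zero_add] at this
                rw [sh_apply, this]
            _ ≤ ∑ a ∈ (bx d R).map (sh z), tt J β (qb 0 l) z a := sum_le_sum fun a _ => tt_mono hJ hβ0.le (hsub z hz)
            _ ≤ _ := sum_le_sum_of_subset_of_nonneg (hsub z hz) fun _ _ _ => tt_nonneg hJ hβ0.le
      _ ≤ _ := by
          refine sum_le_sum_of_subset_of_nonneg ?_ fun _ _ _ => sum_nonneg fun _ _ => tt_nonneg hJ hβ0.le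
          intro z hz
          exact hsub z hz (mem_map.2 ⟨0, zero_mem_bx R, by simp [sh_apply]⟩)
  have hX0 : 0 ≤ X := sum_nonneg fun _ _ => tt_nonneg hJ hβ0.le
  have h5 : ((l:ℝ) / 2) ^ d * X ≤ CA * ((l:ℝ) ^ d * (l:ℝ) ^ α) := by
    rw [hlc, Real.rpow_add hl0, Real.rpow_natCast] at h3
    refine le_trans (mul_le_mul_of_nonneg_right ?_ hX0) (h4.trans h3)
    refine pow_le_pow_left₀ (by positivity) ?_ d
    rw [Nat.cast_sub (by omega)]
    have : (4:ℝ) * R ≤ l := by exact_mod_cast h1.le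
    push_cast; linarith
  have h6 : X ≤ 2 ^ d * CA * (l:ℝ) ^ α := by
    rw [div_pow] at h5
    have : (0:ℝ) < (l:ℝ)^d := by positivity
    have h2d : (0:ℝ) < 2 ^ d := by positivity
    have h7 : (l:ℝ)^d * X ≤ (l:ℝ)^d * (2 ^ d * CA * (l:ℝ) ^ α) := by
      calc _ = 2 ^ d * ((l:ℝ)^d / 2^d * X) := by field_simp
        _ ≤ 2 ^ d * (CA * ((l:ℝ) ^ d * (l:ℝ) ^ α)) := mul_le_mul_of_nonneg_left h5 h2d.le
        _ = _ := by ring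
    exact le_of_mul_le_mul_left h7 this
  refine h6.trans ?_
  rw [mul_assoc _ ((8:ℝ)^α), ← Real.mul_rpow (by norm_num) (by positivity)]
  gcongr
  exact_mod_cast h2
end twopt

section sums
open scoped Classical
variable {d : ℕ}

theorem normInf_add (x y : V d) : normInf (x + y) ≤ normInf x + normInf y := by
  rw [normInf, Finset.sup_le_iff]; intro i _
  have h1 : (x i).natAbs ≤ normInf x := le_sup (f := fun i => (x i).natAbs) (mem_univ i)
  have h2 : (y i).natAbs ≤ normInf y := le_sup (f := fun i => (y i).natAbs) (mem_univ i)
  have := Int.natAbs_add_le (x i) (y i)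
  simp only [Pi.add_apply]; omega
theorem nt (x y z : V d) : normInf (x - z) ≤ normInf (x - y) + normInf (y - z) := by
  have := normInf_add (x - y) (y - z); simpa using this
theorem ns (x y : V d) : normInf (x - y) = normInf (y - x) := by
  simp only [normInf, Pi.sub_apply]; refine Finset.sup_congr rfl fun i _ => by omega
theorem card_bx (m : ℕ) : (bx d m).card = (2 * m + 1) ^ d := by
  rw [bx, Pi.card_Icc]; simp only [Int.card_Icc, Finset.prod_const, Finset.card_univ, Fintype.card_fin]
  congr 1; omega
noncomputable def nn (z : V d) : ℝ := max 1 (normInf z : ℝ)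
theorem nn_one (z : V d) : 1 ≤ nn z := le_max_left _ _
theorem nn_pos (z : V d) : 0 < nn z := lt_of_lt_of_le one_pos (nn_one z)
theorem nn_ge (z : V d) : (normInf z : ℝ) ≤ nn z := le_max_right _ _
theorem nn_symm (x y : V d) : nn (x - y) = nn (y - x) := by rw [nn, ns, nn]
theorem nn_eq {z : V d} (h : 1 ≤ normInf z) : nn z = normInf z := max_eq_right (by exact_mod_cast h)
theorem nn_half {u v w : V d} (h : normInf (w - u) ≤ normInf (w - v)) : nn (u - v) / 2 ≤ nn (w - v) := by
  have h1 := nt u w v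
  rw [ns u w] at h1
  have h2 : (normInf (u - v) : ℝ) ≤ 2 * normInf (w - v) := by exact_mod_cast (by omega : normInf (u - v) ≤ 2 * normInf (w - v))
  have := nn_one (w - v); have h4 := nn_ge (w - v)
  rw [div_le_iff₀ (by norm_num)]
  exact max_le (by linarith) (by linarith)

theorem S1 {s : ℝ} (hs : 0 < s) (hsd : s ≤ d) : ∃ K : ℝ, 0 < K ∧ ∀ R : ℕ, 1 ≤ R →
    ∑ z ∈ bx d R, nn z ^ (-(d:ℝ) + s) ≤ K * (R:ℝ) ^ s := by
  have h2s : (2:ℝ) ^ (-s) < 1 := Real.rpow_lt_one_of_one_lt_of_neg (by norm_num) (by linarith)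
  set K : ℝ := 7 ^ d / (1 - 2 ^ (-s)) with hK
  have hK0 : 7 ^ d ≤ K := by
    rw [hK, le_div_iff₀ (by linarith)]
    have : (0:ℝ) < 2 ^ (-s) := by positivity
    nlinarith [show (0:ℝ) < 7 ^ d by positivity]
  have hKe : K * (1 - 2 ^ (-s)) = 7 ^ d := by rw [hK]; field_simp [(by linarith : (1:ℝ) - 2 ^ (-s) ≠ 0)]
  have hKp : 0 < K := lt_of_lt_of_le (by positivity) hK0
  refine ⟨K, hKp, fun R => ?_⟩
  induction R using Nat.strong_induction_on with
  | _ R ih =>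
    intro hR
    rcases Nat.lt_or_ge R 2 with h | h
    · have : R = 1 := by omega
      subst this
      calc _ ≤ ∑ z ∈ bx d 1, (1:ℝ) := sum_le_sum fun z _ => Real.rpow_le_one_of_one_le_of_nonpos (nn_one z) (by linarith)
        _ = 3 ^ d := by rw [sum_const, card_bx]; simp
        _ ≤ 7 ^ d := by gcongr; norm_num
        _ ≤ _ := by simpa using hK0
    · set R' := R / 2 with hR'
      have h1 := ih R' (by omega) (by omega)
      have hR'0 : (0:ℝ) < R' := by exact_mod_cast (by omega : 0 < R')
      have hR0 : (0:ℝ) < R := by exact_mod_cast (by omega : 0 < R)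
      have hRR : (R':ℝ) ≤ R / 2 := Nat.cast_div_le
      rw [← Finset.sum_sdiff (bx_mono (show R' ≤ R by omega))]
      have h2 : ∑ z ∈ bx d R \ bx d R', nn z ^ (-(d:ℝ) + s) ≤ 7 ^ d * (R:ℝ) ^ s := by
        calc _ ≤ ∑ z ∈ bx d R \ bx d R', (R':ℝ) ^ (-(d:ℝ) + s) := by
              refine sum_le_sum fun z hz => Real.rpow_le_rpow_of_nonpos hR'0 ?_ (by linarith)
              rw [mem_sdiff, mem_bx, mem_bx] at hz
              exact le_trans (by exact_mod_cast (by omega : R' ≤ normInf z)) (nn_ge z)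
          _ ≤ ∑ z ∈ bx d R, (R':ℝ) ^ (-(d:ℝ) + s) := sum_le_sum_of_subset_of_nonneg sdiff_subset fun _ _ _ => by positivity
          _ = (2 * (R:ℝ) + 1) ^ d * ((R':ℝ) ^ (-(d:ℝ)) * (R':ℝ) ^ s) := by
              rw [sum_const, card_bx, nsmul_eq_mul, Real.rpow_add hR'0]; push_cast; rfl
          _ ≤ (7 * (R':ℝ)) ^ d * ((R':ℝ) ^ (-(d:ℝ)) * (R':ℝ) ^ s) := by
              have : 2 * (R:ℝ) + 1 ≤ 7 * R' := by exact_mod_cast (by omega : 2 * R + 1 ≤ 7 * R')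
              gcongr
          _ = 7 ^ d * (R':ℝ) ^ s := by
              rw [mul_pow, Real.rpow_neg hR'0.le, Real.rpow_natCast]
              field_simp
          _ ≤ 7 ^ d * (R:ℝ) ^ s := by gcongr; omega
      have h3 : K * (R':ℝ) ^ s ≤ K * 2 ^ (-s) * (R:ℝ) ^ s := by
        calc K * (R':ℝ) ^ s ≤ K * ((R:ℝ) / 2) ^ s := by gcongr
          _ = _ := by rw [Real.div_rpow hR0.le (by norm_num), Real.rpow_neg (by norm_num)]; field_simp
      calc _ ≤ 7 ^ d * (R:ℝ) ^ s + K * 2 ^ (-s) * (R:ℝ) ^ s := add_le_add h2 (h1.trans h3)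
        _ = K * (R:ℝ) ^ s := by rw [← hKe]; ring

theorem S2 {s : ℝ} (hs : 0 < s) : ∃ K : ℝ, 0 < K ∧ ∀ R : ℕ, 1 ≤ R → ∀ F : Finset (V d), (∀ z ∈ F, R < normInf z) →
    ∑ z ∈ F, nn z ^ (-(d:ℝ) - s) ≤ K * (R:ℝ) ^ (-s) := by
  have h2s : (2:ℝ) ^ (-s) < 1 := Real.rpow_lt_one_of_one_lt_of_neg (by norm_num) (by linarith)
  set K : ℝ := 5 ^ d / (1 - 2 ^ (-s)) with hK
  have hKe : K * (1 - 2 ^ (-s)) = 5 ^ d := by rw [hK]; field_simp [(by linarith : (1:ℝ) - 2 ^ (-s) ≠ 0)]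
  have hKp : 0 < K := div_pos (by positivity) (by linarith)
  have key : ∀ j : ℕ, ∀ R : ℕ, 1 ≤ R → ∀ F : Finset (V d), (∀ z ∈ F, R < normInf z ∧ normInf z ≤ 2 ^ j * R) →
    ∑ z ∈ F, nn z ^ (-(d:ℝ) - s) ≤ K * (R:ℝ) ^ (-s) := by
    intro j
    induction j with
    | zero =>
      intro R hR F hF
      have : F = ∅ := Finset.eq_empty_of_forall_notMem fun z hz => by have := hF z hz; simp at this; omega
      rw [this, Finset.sum_empty]; positivity
    | succ j ih =>
      intro R hR F hF
      have hR0 : (0:ℝ) < R := by exact_mod_cast (by omega : 0 < R)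
      rw [← sum_filter_add_sum_filter_not F (fun z => normInf z ≤ 2 * R)]
      have h1 : ∑ z ∈ F with normInf z ≤ 2 * R, nn z ^ (-(d:ℝ) - s) ≤ 5 ^ d * (R:ℝ) ^ (-s) := by
        calc _ ≤ ∑ z ∈ F with normInf z ≤ 2 * R, (R:ℝ) ^ (-(d:ℝ) - s) := by
              refine sum_le_sum fun z hz => Real.rpow_le_rpow_of_nonpos hR0 ?_ (by have : (0:ℝ) ≤ d := (by positivity); linarith)
              exact le_trans (by exact_mod_cast (hF z (mem_filter.1 hz).1).1.le) (nn_ge z)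
          _ ≤ ∑ z ∈ bx d (2 * R), (R:ℝ) ^ (-(d:ℝ) - s) := sum_le_sum_of_subset_of_nonneg
              (fun z hz => mem_bx.2 (mem_filter.1 hz).2) fun _ _ _ => by positivity
          _ = (2 * (2 * (R:ℝ)) + 1) ^ d * ((R:ℝ) ^ (-(d:ℝ)) * (R:ℝ) ^ (-s)) := by
              rw [sum_const, card_bx, nsmul_eq_mul, sub_eq_add_neg, Real.rpow_add hR0]; push_cast; rfl
          _ ≤ (5 * (R:ℝ)) ^ d * ((R:ℝ) ^ (-(d:ℝ)) * (R:ℝ) ^ (-s)) := by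
              have : 2 * (2 * (R:ℝ)) + 1 ≤ 5 * R := by exact_mod_cast (by omega : 2 * (2 * R) + 1 ≤ 5 * R)
              gcongr
          _ = 5 ^ d * (R:ℝ) ^ (-s) := by
              rw [mul_pow, Real.rpow_neg hR0.le (d:ℝ), Real.rpow_natCast]
              field_simp
      have h2 := ih (2 * R) (by omega) (F.filter fun z => ¬ normInf z ≤ 2 * R) (by
        intro z hz
        rw [mem_filter] at hz
        have := hF z hz.1
        refine ⟨by omega, this.2.trans (le_of_eq (by ring))⟩)
      have h3 : K * ((2 * R : ℕ):ℝ) ^ (-s) = K * 2 ^ (-s) * (R:ℝ) ^ (-s) := by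
        push_cast; rw [Real.mul_rpow (by norm_num) hR0.le]; ring
      calc _ ≤ 5 ^ d * (R:ℝ) ^ (-s) + K * 2 ^ (-s) * (R:ℝ) ^ (-s) := add_le_add h1 (h2.trans h3.le)
        _ = _ := by rw [← hKe]; ring
  refine ⟨K, hKp, fun R hR F hF => ?_⟩
  obtain ⟨m, hm⟩ := sub_bx F
  refine key m R hR F fun z hz => ⟨hF z hz, (mem_bx.1 (hm hz)).trans ?_⟩
  have : m < 2 ^ m := Nat.lt_two_pow_self
  nlinarith

/-- shifting a sum -/
theorem sum_shift (F : Finset (V d)) (p : V d) (f : V d → ℝ) : ∑ b ∈ F, f (b - p) = ∑ z ∈ F.map (sh (-p)), f z := by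
  rw [sum_map]; exact sum_congr rfl fun b _ => by rw [sh_apply, sub_eq_add_neg]
theorem S1' {s : ℝ} (hs : 0 < s) (hsd : s ≤ d) : ∃ K : ℝ, 0 < K ∧ ∀ R : ℕ, 1 ≤ R → ∀ (F : Finset (V d)) (p : V d),
    (∀ b ∈ F, normInf (b - p) ≤ R) → ∑ b ∈ F, nn (b - p) ^ (-(d:ℝ) + s) ≤ K * (R:ℝ) ^ s := by
  obtain ⟨K, hK, h⟩ := S1 (d := d) hs hsd
  refine ⟨K, hK, fun R hR F p hF => ?_⟩
  rw [sum_shift F p fun z => nn z ^ (-(d:ℝ) + s)]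
  refine le_trans (sum_le_sum_of_subset_of_nonneg ?_ fun z _ _ => by have := nn_pos z; positivity) (h R hR)
  intro z hz
  obtain ⟨b, hb, rfl⟩ := mem_map.1 hz
  rw [mem_bx, sh_apply, ← sub_eq_add_neg]; exact hF b hb
theorem S2' {s : ℝ} (hs : 0 < s) : ∃ K : ℝ, 0 < K ∧ ∀ R : ℕ, 1 ≤ R → ∀ (F : Finset (V d)) (p : V d),
    (∀ b ∈ F, R < normInf (b - p)) → ∑ b ∈ F, nn (b - p) ^ (-(d:ℝ) - s) ≤ K * (R:ℝ) ^ (-s) := by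
  obtain ⟨K, hK, h⟩ := S2 (d := d) hs
  refine ⟨K, hK, fun R hR F p hF => ?_⟩
  rw [sum_shift F p fun z => nn z ^ (-(d:ℝ) - s)]
  refine h R hR _ fun z hz => ?_
  obtain ⟨b, hb, rfl⟩ := mem_map.1 hz
  rw [sh_apply, ← sub_eq_add_neg]; exact hF b hb

theorem conv_half {s t : ℝ} (hs : 0 < s) (ht : 0 < t) (hst : s + t < d) : ∃ K : ℝ, 0 < K ∧
    ∀ (F : Finset (V d)) (u v : V d), (∀ w ∈ F, normInf (w - u) ≤ normInf (w - v)) →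
    ∑ w ∈ F, nn (w - u) ^ (-(d:ℝ) + s) * nn (w - v) ^ (-(d:ℝ) + t) ≤ K * nn (u - v) ^ (-(d:ℝ) + s + t) := by
  obtain ⟨K1, hK1, h1⟩ := S1' (d := d) hs (by linarith)
  obtain ⟨K2, hK2, h2⟩ := S2' (d := d) (s := d - s - t) (by linarith)
  refine ⟨K1 * 2 ^ ((d:ℝ) - t) + K2, by positivity, fun F u v hF => ?_⟩
  set R := max 1 (normInf (u - v)) with hR
  have hRn : (R:ℝ) = nn (u - v) := by rw [hR, nn]; push_cast; rfl
  have hn0 := nn_pos (u - v)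
  rw [← sum_filter_add_sum_filter_not F (fun w => normInf (w - u) ≤ R), add_mul]
  refine add_le_add ?_ ?_
  · calc _ ≤ ∑ w ∈ F with normInf (w - u) ≤ R, nn (w - u) ^ (-(d:ℝ) + s) * (nn (u - v) / 2) ^ (-(d:ℝ) + t) := by
          refine sum_le_sum fun w hw => ?_
          have := nn_pos (w - u)
          refine mul_le_mul_of_nonneg_left (Real.rpow_le_rpow_of_nonpos (by positivity) (nn_half (hF w (mem_filter.1 hw).1)) (by linarith)) (by positivity)
      _ ≤ (K1 * (R:ℝ) ^ s) * (nn (u - v) / 2) ^ (-(d:ℝ) + t) := by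
          rw [← sum_mul]
          exact mul_le_mul_of_nonneg_right (h1 R (le_max_left _ _) _ u fun b hb => (mem_filter.1 hb).2) (by positivity)
      _ = _ := by
          rw [hRn, Real.div_rpow hn0.le (by norm_num), Real.rpow_add hn0 (-(d:ℝ)+s), Real.rpow_add hn0, Real.rpow_add hn0,
            show (d:ℝ) - t = -(-(d:ℝ)+t) by ring, Real.rpow_neg (by norm_num) (-(d:ℝ)+t)]
          field_simp
  · calc _ ≤ ∑ w ∈ F with ¬ normInf (w - u) ≤ R, nn (w - u) ^ (-(d:ℝ) - (d - s - t)) := by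
          refine sum_le_sum fun w hw => ?_
          have h0 := nn_pos (w - u)
          have e : nn (w - u) ^ (-(d:ℝ) - (d - s - t)) = nn (w - u) ^ (-(d:ℝ) + s) * nn (w - u) ^ (-(d:ℝ) + t) := by
            rw [← Real.rpow_add h0]; congr 1; ring
          rw [e]
          refine mul_le_mul_of_nonneg_left (Real.rpow_le_rpow_of_nonpos h0 ?_ (show -(d:ℝ) + t ≤ 0 by linarith)) (by positivity)
          have := hF w (mem_filter.1 hw).1
          exact max_le_max le_rfl (by exact_mod_cast this)
      _ ≤ K2 * (R:ℝ) ^ (-((d:ℝ) - s - t)) := h2 R (le_max_left _ _) _ u fun b hb => not_le.1 (mem_filter.1 hb).2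
      _ = _ := by rw [hRn]; congr 2; ring

theorem conv {s t : ℝ} (hs : 0 < s) (ht : 0 < t) (hst : s + t < d) : ∃ K : ℝ, 0 < K ∧
    ∀ (F : Finset (V d)) (u v : V d),
    ∑ w ∈ F, nn (u - w) ^ (-(d:ℝ) + s) * nn (w - v) ^ (-(d:ℝ) + t) ≤ K * nn (u - v) ^ (-(d:ℝ) + s + t) := by
  obtain ⟨K1, hK1, h1⟩ := conv_half (d := d) hs ht hst
  obtain ⟨K2, hK2, h2⟩ := conv_half (d := d) ht hs (by linarith)
  refine ⟨K1 + K2, by positivity, fun F u v => ?_⟩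
  rw [← sum_filter_add_sum_filter_not F (fun w => normInf (w - u) ≤ normInf (w - v)), add_mul]
  refine add_le_add ?_ ?_
  · simp_rw [nn_symm u]
    rw [nn_symm v u]
    exact h1 _ u v fun w hw => (mem_filter.1 hw).2
  · have := h2 (F.filter fun w => ¬ normInf (w - u) ≤ normInf (w - v)) v u fun w hw => (not_le.1 (mem_filter.1 hw).2).le
    rw [nn_symm u v, show -(d:ℝ) + s + t = -(d:ℝ) + t + s by ring]
    refine le_trans (le_of_eq (sum_congr rfl fun w _ => ?_)) this
    rw [nn_symm u w, mul_comm]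
end sums

section pointwise
open scoped Classical
variable {d : ℕ} {J : V d → V d → ℝ} {α c C : ℝ}

noncomputable def ww (α : ℝ) (r : ℕ) (z : V d) : ℝ := nn z ^ (-(d:ℝ) - α) * (min r (normInf z) : ℕ)
theorem ww_nonneg (r : ℕ) (z : V d) : 0 ≤ ww α r z := by have := nn_pos z; unfold ww; positivity
theorem J_ww (hJ : KernelHyp d J α c C) (r : ℕ) (a b : V d) : J a b * (min r (normInf (b - a)) : ℕ) ≤ C * ww α r (b - a) := by
  by_cases h : a = b
  · subst h; simp [ww, normInf_zero]
  · have h1 : 1 ≤ normInf (a - b) := normInf_pos (sub_ne_zero.2 h)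
    have := hJ.upper a b h
    rw [← nn_eq h1, nn_symm] at this
    rw [ww, ← mul_assoc]
    exact mul_le_mul_of_nonneg_right this (by positivity)

theorem D_sum (hJ : KernelHyp d J α c C) {β CA : ℝ} (hβ : 0 ≤ β)
    (hA : ∀ R : ℕ, 1 ≤ R → ∑ a ∈ bx d R, tt J β (bx d R) 0 a ≤ CA * (R:ℝ) ^ α) (Λ : Finset (V d)) (x : V d) {R : ℕ} (hR : 1 ≤ R)
    {F : Finset (V d)} (hF : F ⊆ Λ.filter fun b => normInf (b - x) ≤ R) :
    ∑ a ∈ F, tt J β (Λ.filter fun b => normInf (b - x) ≤ R) x a ≤ CA * (R:ℝ) ^ α := by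
  have hsub : (Λ.filter fun b => normInf (b - x) ≤ R) ⊆ (bx d R).map (sh x) := by
    intro b hb
    exact mem_map.2 ⟨b - x, mem_bx.2 (mem_filter.1 hb).2, by simp [sh_apply]⟩
  calc _ ≤ ∑ a ∈ F, tt J β ((bx d R).map (sh x)) x a := sum_le_sum fun a _ => tt_mono hJ hβ hsub
    _ ≤ ∑ a ∈ (bx d R).map (sh x), tt J β ((bx d R).map (sh x)) x a :=
        sum_le_sum_of_subset_of_nonneg (hF.trans hsub) fun _ _ _ => tt_nonneg hJ hβ
    _ = ∑ a ∈ bx d R, tt J β (bx d R) 0 a := by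
        rw [sum_map]
        refine sum_congr rfl fun a _ => ?_
        rw [← tt_sh hJ β (bx d R) 0 a x, sh_apply, zero_add]
    _ ≤ _ := hA R hR

theorem avg (hJ : KernelHyp d J α c C) {β β₁ CA : ℝ} (hβ : 0 ≤ β) (hβ1 : β ≤ β₁)
    (hA : ∀ R : ℕ, 1 ≤ R → ∑ a ∈ bx d R, tt J β (bx d R) 0 a ≤ CA * (R:ℝ) ^ α) {Λ : Finset (V d)} {x y : V d} (hx : x ∈ Λ)
    {r0 : ℕ} (hr : 1 ≤ r0) {X : ℝ} (hX0 : 0 ≤ X)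
    (hX : ∀ p, normInf (p - x) ≤ 2 * r0 → ∑ b ∈ Λ.filter (fun b => r0 < normInf (b - x)), ww α r0 (b - p) * tt J β Λ b y ≤ X) :
    tt J β Λ x y ≤ tt J β (Λ.filter fun b => normInf (b - x) ≤ 2 * r0) x y + β₁ * C * (CA * 2 ^ α) * ((r0:ℝ) ^ (α - 1) * X) := by
  set D := Λ.filter fun b => normInf (b - x) ≤ 2 * r0 with hD
  set E := Λ.filter fun b => r0 < normInf (b - x) with hE
  have hR0 : (0:ℝ) < r0 := by exact_mod_cast hr
  have hC0 : 0 ≤ C := hJ.c_pos.le.trans hJ.c_le_C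
  have hn := fun e => Rt_nonneg hJ hβ (le_refl 0) e
  have one : ∀ r ∈ Finset.Ico r0 (2 * r0), tt J β Λ x y ≤ tt J β D x y + ∑ a ∈ D, ∑ b ∈ E,
      tt J β D x a * (β * (J a b * ind (normInf (a - x) ≤ r ∧ r < normInf (b - x)))) * tt J β Λ b y := by
    intro r hrr
    rw [Finset.mem_Ico] at hrr
    set Cr := Λ.filter fun b => normInf (b - x) ≤ r with hCr
    have hCD : Cr ⊆ D := fun b hb => by
      rw [hCr, mem_filter] at hb; rw [hD, mem_filter]; exact ⟨hb.1, by omega⟩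
    have hxC : x ∈ Cr := by rw [hCr, mem_filter]; exact ⟨hx, by simp [normInf_zero]⟩
    have hCL : Cr ⊆ Λ := filter_subset _ _
    have h1 : tt J β Λ x y ≤ tt J β Cr x y + Pr (Rt J β 0) Λ.sym2 (fun T => cn T Λ x y ∧ ¬ cn T Cr x y) := by
      rw [← Pr_tt (h := 0) (subset_refl Λ.sym2), ← Pr_tt (h := 0) (sym2_mono hCL)]
      refine le_trans (Pr_mono hn fun T _ h => ?_) (Pr_or_le hn _ _ _)
      by_cases hc : cn T Cr x y
      exacts [Or.inl hc, Or.inr ⟨h, hc⟩]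
    have h2 := exit_gen (y := y) hn hCL hxC
    refine h1.trans (add_le_add (tt_mono hJ hβ hCD) (h2.trans ?_))
    have hnn : ∀ a b, 0 ≤ tt J β D x a * (β * (J a b * ind (normInf (a - x) ≤ r ∧ r < normInf (b - x)))) * tt J β Λ b y := fun a b => by
      have := tt_nonneg hJ hβ (B := D) (x := x) (y := a)
      have := tt_nonneg hJ hβ (B := Λ) (x := b) (y := y)
      have := hJ.nonneg a b
      have := ind_nonneg (normInf (a - x) ≤ r ∧ r < normInf (b - x))
      positivity
    refine le_trans (sum_le_sum fun a ha => ?_) (sum_le_sum_of_subset_of_nonneg hCD fun a _ _ => sum_nonneg fun b _ => hnn a b)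
    have hsub : Λ \ Cr ⊆ E := fun b hb => by
      simp only [hCr, hE, mem_sdiff, mem_filter] at hb ⊢
      exact ⟨hb.1, by have := hb.2; simp only [hb.1, true_and] at this; omega⟩
    refine le_trans (sum_le_sum fun b hb => ?_) (sum_le_sum_of_subset_of_nonneg hsub fun b _ _ => hnn a b)
    have hb' := hb
    simp only [hCr, mem_sdiff, mem_filter] at hb' ha
    have hab : a ≠ b := by rintro rfl; exact hb'.2 ha
    rw [Rt_mk hJ β 0 hab, ind_true ⟨ha.2, by have := hb'.2; simp only [hb'.1, true_and] at this; omega⟩, mul_one]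
    have := hJ.nonneg a b
    exact mul_le_mul_of_nonneg_right (mul_le_mul_of_nonneg_right (tt_mono hJ hβ hCD) (by positivity)) (tt_nonneg hJ hβ)
  have hcount : ∀ a b : V d, ∑ r ∈ Finset.Ico r0 (2 * r0), ind (normInf (a - x) ≤ r ∧ r < normInf (b - x)) ≤ (min r0 (normInf (b - a)) : ℕ) := by
    intro a b
    have : ∑ r ∈ Finset.Ico r0 (2 * r0), ind (normInf (a - x) ≤ r ∧ r < normInf (b - x))
        = ((Finset.Ico r0 (2 * r0)).filter fun r => normInf (a - x) ≤ r ∧ r < normInf (b - x)).card := by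
      rw [Finset.card_filter]; push_cast; exact sum_congr rfl fun r _ => by unfold ind; congr
    rw [this]
    have h1 : ((Finset.Ico r0 (2 * r0)).filter fun r => normInf (a - x) ≤ r ∧ r < normInf (b - x)).card ≤ r0 :=
      (Finset.card_filter_le _ _).trans (by rw [Nat.card_Ico]; omega)
    have h2 : ((Finset.Ico r0 (2 * r0)).filter fun r => normInf (a - x) ≤ r ∧ r < normInf (b - x)).card ≤ normInf (b - a) := by
      refine (card_le_card (t := Finset.Ico (normInf (a - x)) (normInf (b - x))) fun r h => ?_).trans ?_
      · rw [mem_filter] at h; exact Finset.mem_Ico.2 h.2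
      · rw [Nat.card_Ico]; have := nt b a x; omega
    exact_mod_cast le_min h1 h2
  have hs := sum_le_sum one
  rw [sum_const, Nat.card_Ico, show 2 * r0 - r0 = r0 by omega, sum_add_distrib, sum_const, Nat.card_Ico,
    show 2 * r0 - r0 = r0 by omega, nsmul_eq_mul, nsmul_eq_mul] at hs
  have hM : ∑ r ∈ Finset.Ico r0 (2 * r0), ∑ a ∈ D, ∑ b ∈ E,
      tt J β D x a * (β * (J a b * ind (normInf (a - x) ≤ r ∧ r < normInf (b - x)))) * tt J β Λ b y
      ≤ β₁ * C * X * (CA * (2 * r0:ℝ) ^ α) := by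
    calc _ = ∑ a ∈ D, ∑ b ∈ E, tt J β D x a * (β * (J a b * ∑ r ∈ Finset.Ico r0 (2 * r0), ind (normInf (a - x) ≤ r ∧ r < normInf (b - x)))) * tt J β Λ b y := by
          rw [sum_comm]; refine sum_congr rfl fun a _ => ?_
          rw [sum_comm]; refine sum_congr rfl fun b _ => ?_
          simp only [mul_sum, sum_mul]
      _ ≤ ∑ a ∈ D, tt J β D x a * (β * C * X) := by
          refine sum_le_sum fun a ha => ?_
          have h1 := hX a (mem_filter.1 ha).2
          calc _ ≤ ∑ b ∈ E, tt J β D x a * (β * C) * (ww α r0 (b - a) * tt J β Λ b y) := by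
                refine sum_le_sum fun b _ => ?_
                have e1 := mul_le_mul_of_nonneg_left (hcount a b) (hJ.nonneg a b)
                have e2 := e1.trans (J_ww hJ r0 a b)
                have t1 := tt_nonneg hJ hβ (B := D) (x := x) (y := a)
                have t2 := tt_nonneg hJ hβ (B := Λ) (x := b) (y := y)
                calc _ ≤ tt J β D x a * (β * (C * ww α r0 (b - a))) * tt J β Λ b y := by gcongr
                  _ = _ := by ring
            _ = tt J β D x a * (β * C) * ∑ b ∈ E, (ww α r0 (b - a) * tt J β Λ b y) := by rw [mul_sum]
            _ ≤ tt J β D x a * (β * C) * X := mul_le_mul_of_nonneg_left h1 (mul_nonneg (tt_nonneg hJ hβ) (by positivity))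
            _ = _ := by ring
      _ = (β * C * X) * ∑ a ∈ D, tt J β D x a := by rw [← sum_mul]; ring
      _ ≤ (β₁ * C * X) * (CA * (2 * r0:ℝ) ^ α) := by
          have := D_sum hJ hβ hA Λ x (R := 2 * r0) (by omega) subset_rfl
          push_cast at this
          exact mul_le_mul (by gcongr) this (sum_nonneg fun _ _ => tt_nonneg hJ hβ) (by have := hβ.trans hβ1; positivity)
  have e3 : β₁ * C * (CA * 2 ^ α) * ((r0:ℝ) ^ (α - 1) * X) = (β₁ * C * X * (CA * (2 * r0:ℝ) ^ α)) / r0 := by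
    rw [Real.mul_rpow (by norm_num) hR0.le, Real.rpow_sub hR0, Real.rpow_one]; ring
  rw [e3]
  have e4 := hs.trans (add_le_add_right hM _)
  have : tt J β Λ x y ≤ (r0 * tt J β D x y + β₁ * C * X * (CA * (2 * r0:ℝ) ^ α)) / r0 := by
    rw [le_div_iff₀ hR0]; linarith
  refine this.trans (le_of_eq ?_)
  field_simp

theorem ww_near {r0 R : ℕ} {z : V d} (h : normInf z ≤ R) : ww α r0 z ≤ nn z ^ (-(d:ℝ) + (1 - α)) := by
  rw [ww, show -(d:ℝ) + (1 - α) = (-(d:ℝ) - α) + 1 by ring, Real.rpow_add (nn_pos z), Real.rpow_one]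
  have := nn_pos z
  refine mul_le_mul_of_nonneg_left (le_trans ?_ (nn_ge z)) (by positivity)
  exact_mod_cast min_le_right _ _
theorem ww_far (r0 : ℕ) (z : V d) : ww α r0 z ≤ r0 * nn z ^ (-(d:ℝ) - α) := by
  have := nn_pos z
  rw [ww, mul_comm]
  exact mul_le_mul_of_nonneg_right (by exact_mod_cast min_le_left _ _) (by positivity)
theorem ww_sum (hα0 : 0 < α) (hα : α < 1) (hd : 1 ≤ d) : ∃ Cw : ℝ, 0 < Cw ∧
    (∀ (r0 : ℕ), 1 ≤ r0 → ∀ (F : Finset (V d)) p, ∑ b ∈ F, ww α r0 (b - p) ≤ Cw * (r0:ℝ) ^ (1 - α)) ∧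
    (∀ (r0 R : ℕ), 1 ≤ R → ∀ (F : Finset (V d)) p, (∀ b ∈ F, normInf (b - p) ≤ R) → ∑ b ∈ F, ww α r0 (b - p) ≤ Cw * (R:ℝ) ^ (1 - α)) := by
  have hd' : (1:ℝ) ≤ d := by exact_mod_cast hd
  obtain ⟨K1, hK1, h1⟩ := S1' (d := d) (s := 1 - α) (by linarith) (by linarith)
  obtain ⟨K2, hK2, h2⟩ := S2' (d := d) hα0
  have near : ∀ (r0 R : ℕ), 1 ≤ R → ∀ (F : Finset (V d)) p, (∀ b ∈ F, normInf (b - p) ≤ R) → ∑ b ∈ F, ww α r0 (b - p) ≤ K1 * (R:ℝ) ^ (1 - α) :=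
    fun r0 R hR F p hF => (sum_le_sum fun b hb => ww_near (hF b hb)).trans (h1 R hR F p hF)
  refine ⟨K1 + K2, by positivity, fun r0 hr F p => ?_, fun r0 R hR F p hF => (near r0 R hR F p hF).trans (by gcongr; linarith)⟩
  have hr0 : (0:ℝ) < r0 := by exact_mod_cast hr
  rw [← sum_filter_add_sum_filter_not F (fun b => normInf (b - p) ≤ r0), add_mul]
  refine add_le_add (near _ _ hr _ _ fun b hb => (mem_filter.1 hb).2) ?_
  calc _ ≤ ∑ b ∈ F with ¬ normInf (b - p) ≤ r0, r0 * nn (b - p) ^ (-(d:ℝ) - α) := sum_le_sum fun b _ => ww_far _ _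
    _ ≤ r0 * (K2 * (r0:ℝ) ^ (-α)) := by
        rw [← mul_sum]
        exact mul_le_mul_of_nonneg_left (h2 r0 hr _ p fun b hb => not_le.1 (mem_filter.1 hb).2) hr0.le
    _ = _ := by rw [Real.rpow_sub hr0, Real.rpow_neg hr0.le, Real.rpow_one]; ring

theorem tau_far {A : ℝ} (hA : 0 ≤ A) (hαd : α < d) {τ : ℝ} {R : ℝ} (hR : 0 < R) {z : V d} (hz : R ≤ nn z) (h : τ ≤ A * nn z ^ (-(d:ℝ) + α)) :
    τ ≤ A * R ^ (-(d:ℝ) + α) :=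
  h.trans (mul_le_mul_of_nonneg_left (Real.rpow_le_rpow_of_nonpos hR hz (by linarith)) hA)

/-- sum over a ball -/
theorem Gbound (hJ : KernelHyp d J α c C) {β β₁ CA Cw A : ℝ} (hβ : 0 ≤ β) (hβ1 : β ≤ β₁) (hCA : 0 < CA) (hCw : 0 < Cw)
    (hA : ∀ R : ℕ, 1 ≤ R → ∑ a ∈ bx d R, tt J β (bx d R) 0 a ≤ CA * (R:ℝ) ^ α)
    (hw : ∀ (r0 : ℕ), 1 ≤ r0 → ∀ (F : Finset (V d)) p, ∑ b ∈ F, ww α r0 (b - p) ≤ Cw * (r0:ℝ) ^ (1 - α)) (hA0 : 0 ≤ A) {Λ : Finset (V d)}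
    (hτ : ∀ x y, tt J β Λ x y ≤ A * nn (x - y) ^ (-(d:ℝ) + α)) {y : V d} (hy : y ∈ Λ) {R L : ℕ} (hR : 1 ≤ R) (hL : 1 ≤ L)
    {F : Finset (V d)} (hF : ∀ b ∈ F, b ∈ Λ ∧ normInf (b - y) ≤ R) :
    ∑ b ∈ F, tt J β Λ b y ≤ (CA * (4 * L) ^ α + β₁ * C * (CA * 2 ^ α) * Cw * 3 ^ d * (L:ℝ) ^ (-(d:ℝ) + α) * A) * (R:ℝ) ^ α := by
  have hR0 : (0:ℝ) < R := by exact_mod_cast hR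
  have hL0 : (0:ℝ) < L := by exact_mod_cast hL
  have hC0 : 0 ≤ C := hJ.c_pos.le.trans hJ.c_le_C
  have hβ10 := hβ.trans hβ1
  have hdR : (1:ℕ) ≤ 2 * (2 * L * R) := by have := Nat.mul_pos hL hR; nlinarith
  have hLR : R ≤ L * R := by nlinarith
  have pt : ∀ b ∈ F, tt J β Λ b y ≤ tt J β (Λ.filter fun z => normInf (z - y) ≤ 2 * (2 * L * R)) y b
      + β₁ * C * (CA * 2 ^ α) * Cw * A * (L * R:ℝ) ^ (-(d:ℝ) + α) := by
    intro b hb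
    have hLR0 : (0:ℝ) < (2 * L * R : ℕ) := by push_cast; positivity
    have := avg hJ hβ hβ1 hA (y := b) hy (r0 := 2 * L * R) (by nlinarith)
      (X := A * (L * R:ℝ) ^ (-(d:ℝ) + α) * (Cw * ((2 * L * R : ℕ):ℝ) ^ (1 - α))) (by positivity) (fun p _ => ?_)
    · rw [tt_comm]
      refine this.trans (le_of_eq ?_)
      have e : ((2 * L * R : ℕ):ℝ) ^ (α - 1) * ((2 * L * R : ℕ):ℝ) ^ (1 - α) = 1 := by
        rw [← Real.rpow_add hLR0]; norm_num
      linear_combination (β₁ * C * (CA * 2 ^ α)) * (A * (L * R:ℝ) ^ (-(d:ℝ) + α)) * Cw * e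
    · refine le_trans (sum_le_sum (g := fun z => ww α (2 * L * R) (z - p) * (A * (L * R:ℝ) ^ (-(d:ℝ) + α))) fun z hz => ?_) ?_
      · refine mul_le_mul_of_nonneg_left (tau_far hA0 hJ.alpha_lt_d (by positivity) ?_ (hτ z b)) (ww_nonneg _ _)
        refine le_trans ?_ (nn_ge _)
        have h1 := (mem_filter.1 hz).2
        have h2 := (hF b hb).2
        have h3 := nt z b y
        have : L * R ≤ normInf (z - b) := by nlinarith
        exact_mod_cast this
      · rw [← sum_mul, mul_comm]
        exact mul_le_mul_of_nonneg_left (hw _ (by nlinarith) _ p) (by positivity)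
  refine (sum_le_sum pt).trans ?_
  rw [sum_add_distrib, add_mul]
  refine add_le_add ?_ ?_
  · refine (D_sum hJ hβ hA Λ y hdR fun b hb => mem_filter.2 ⟨(hF b hb).1, (hF b hb).2.trans (by nlinarith)⟩).trans (le_of_eq ?_)
    push_cast
    rw [show (2:ℝ) * (2 * L * R) = (4 * L) * R by ring, Real.mul_rpow (by positivity) hR0.le]; ring
  · rw [sum_const, nsmul_eq_mul]
    have hc : (F.card : ℝ) ≤ 3 ^ d * (R:ℝ) ^ (d:ℝ) := by
      have h1 : F.card ≤ (bx d R).card := by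
        rw [← Finset.card_map (sh (-y))]
        refine card_le_card fun z hz => ?_
        obtain ⟨b, hb, rfl⟩ := mem_map.1 hz
        rw [mem_bx, sh_apply, ← sub_eq_add_neg]; exact (hF b hb).2
      rw [card_bx] at h1
      have h2 : (2 * R + 1) ^ d ≤ (3 * R) ^ d := Nat.pow_le_pow_left (by omega) d
      rw [Real.rpow_natCast, ← mul_pow]
      exact_mod_cast h1.trans h2
    calc _ ≤ (3 ^ d * (R:ℝ) ^ (d:ℝ)) * (β₁ * C * (CA * 2 ^ α) * Cw * A * (L * R:ℝ) ^ (-(d:ℝ) + α)) := by gcongr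
      _ = _ := by
        rw [Real.mul_rpow hL0.le hR0.le, Real.rpow_add hR0, Real.rpow_neg hR0.le]
        field_simp

theorem improve (hJ : KernelHyp d J α c C) (hα : α < 1) {β₁ CA : ℝ} (hβ₁ : 0 < β₁) (hCA : 0 < CA) : ∃ A₀ : ℝ, 0 < A₀ ∧
    ∀ β, 0 ≤ β → β ≤ β₁ → (∀ R : ℕ, 1 ≤ R → ∑ a ∈ bx d R, tt J β (bx d R) 0 a ≤ CA * (R:ℝ) ^ α) →
    ∀ (A : ℝ), 0 ≤ A → ∀ (Λ : Finset (V d)), (∀ x y, tt J β Λ x y ≤ A * nn (x - y) ^ (-(d:ℝ) + α)) →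
    ∀ x y, tt J β Λ x y ≤ (A / 2 + A₀) * nn (x - y) ^ (-(d:ℝ) + α) := by
  obtain ⟨Cw, hCw, hw1, hw2⟩ := ww_sum (d := d) hJ.alpha_pos hα hJ.d_pos
  have hC0 : 0 < C := hJ.c_pos.trans_le hJ.c_le_C
  have hαd := hJ.alpha_lt_d
  set c0 := β₁ * C * (CA * 2 ^ α) with hc0
  have hc0p : 0 < c0 := by positivity
  have choosek : ∀ (M e : ℝ), 0 < M → e < 0 → ∃ k : ℕ, 1 ≤ k ∧ M * (k:ℝ) ^ e ≤ 1 / 6 := by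
    intro M e hM he
    have h1 := ((tendsto_rpow_neg_atTop (neg_pos.2 he)).comp tendsto_natCast_atTop_atTop).const_mul M
    simp only [neg_neg, mul_zero, Function.comp_def] at h1
    obtain ⟨k, hk, hk1⟩ := ((h1.eventually_le_const (show (0:ℝ) < 1 / 6 by norm_num)).and (Filter.eventually_ge_atTop 1)).exists
    exact ⟨k, hk1, hk⟩
  obtain ⟨j, hj1, hj⟩ := choosek (8 ^ d * c0 * Cw) (α - 1) (by positivity) (by linarith)
  obtain ⟨k, hk1, hk⟩ := choosek (8 ^ d * c0 * Cw) (-(d:ℝ) + α) (by positivity) (by linarith)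
  have hj0 : (0:ℝ) < j := by exact_mod_cast hj1
  have hk0 : (0:ℝ) < k := by exact_mod_cast hk1
  obtain ⟨L, hL1, hL⟩ := choosek (8 ^ d * c0 * (j:ℝ) ^ ((d:ℝ) + α) * (k:ℝ) ^ α * (c0 * Cw * 3 ^ d)) (-(d:ℝ) + α) (by positivity) (by linarith)
  have hL0 : (0:ℝ) < L := by exact_mod_cast hL1
  refine ⟨8 ^ d * c0 * (j:ℝ) ^ ((d:ℝ) + α) * (k:ℝ) ^ α * (CA * (4 * L) ^ α) + (4 * j) ^ ((d:ℝ) - α), by positivity, fun β hβ hβ1 hA A hA0 Λ hτ x y => ?_⟩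
  have hn0 := nn_pos (x - y)
  by_cases hxy : ¬ (x ∈ Λ ∧ y ∈ Λ)
  · have : tt J β Λ x y = 0 := by
      rw [not_and_or] at hxy
      exact hxy.elim (fun h => tau_zero_left h) fun h => tau_zero_right h
    rw [this]; positivity
  push Not at hxy
  obtain ⟨hx, hy⟩ := hxy
  by_cases hn : normInf (x - y) < 4 * j
  · have h1 : nn (x - y) ≤ 4 * j := max_le (by have : (1:ℝ) ≤ j := by exact_mod_cast hj1
                                               linarith) (by exact_mod_cast hn.le)
    have h2 : 1 ≤ (4 * j:ℝ) ^ ((d:ℝ) - α) * nn (x - y) ^ (-(d:ℝ) + α) := by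
      rw [show -(d:ℝ) + α = -((d:ℝ) - α) by ring, Real.rpow_neg hn0.le, ← div_eq_mul_inv, one_le_div (by positivity)]
      exact Real.rpow_le_rpow hn0.le h1 (by linarith)
    refine (tt_le_one hJ hβ).trans (h2.trans (mul_le_mul_of_nonneg_right ?_ (by positivity)))
    have : 0 ≤ 8 ^ d * c0 * (j:ℝ) ^ ((d:ℝ) + α) * (k:ℝ) ^ α * (CA * (4 * L) ^ α) := by positivity
    linarith
  push Not at hn
  set ρ := normInf (x - y) / (4 * j) with hρ
  have hρ1 : 1 ≤ ρ := (Nat.one_le_div_iff (by omega)).2 hn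
  have hdm := Nat.div_add_mod (normInf (x - y)) (4 * j)
  have hml := Nat.mod_lt (normInf (x - y)) (show 0 < 4 * j by omega)
  rw [← hρ] at hdm
  set r0 := j * ρ with hr0
  have hjρ : 4 * j * ρ = 4 * r0 := by rw [hr0]; ring
  have hρr : ρ ≤ r0 := by rw [hr0]; nlinarith
  have hjr : j ≤ r0 := by rw [hr0]; nlinarith
  have hlo : 4 * r0 ≤ normInf (x - y) := by omega
  have hhi : normInf (x - y) ≤ 8 * r0 := by omega
  have hr1 : 1 ≤ r0 := hρ1.trans hρr
  have hρ0 : (0:ℝ) < ρ := by exact_mod_cast hρ1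
  have hr00 : (0:ℝ) < r0 := by exact_mod_cast hr1
  set G := (CA * (4 * L) ^ α + c0 * Cw * 3 ^ d * (L:ℝ) ^ (-(d:ℝ) + α) * A) with hG
  have hG0 : 0 ≤ G := by positivity
  set X := A * (r0:ℝ) ^ (-(d:ℝ) + α) * (Cw * (ρ:ℝ) ^ (1 - α)) + (r0 * (ρ:ℝ) ^ (-(d:ℝ) - α)) * (G * ((k * r0 : ℕ):ℝ) ^ α)
    + A * ((k:ℝ) * r0) ^ (-(d:ℝ) + α) * (Cw * (r0:ℝ) ^ (1 - α)) with hXd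
  have main := avg hJ hβ hβ1 hA (y := y) hx hr1 (X := X) (by positivity) (fun p hp => ?_)
  · have hz : tt J β (Λ.filter fun b => normInf (b - x) ≤ 2 * r0) x y = 0 :=
      tau_zero_right fun h => by have := (mem_filter.1 h).2; rw [ns] at this; omega
    rw [hz, zero_add, ← hc0] at main
    have hnr : nn (x - y) ≤ 8 * r0 := by rw [nn_eq (by omega)]; exact_mod_cast hhi
    have e1 : 1 ≤ 8 ^ d * (r0:ℝ) ^ ((d:ℝ) - α) * nn (x - y) ^ (-(d:ℝ) + α) := by
      rw [show -(d:ℝ) + α = -((d:ℝ) - α) by ring, Real.rpow_neg hn0.le, ← div_eq_mul_inv, one_le_div (by positivity)]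
      refine (Real.rpow_le_rpow hn0.le hnr (by linarith)).trans ?_
      rw [Real.mul_rpow (by norm_num) hr00.le, ← Real.rpow_natCast 8 d]
      gcongr
      · norm_num
      · linarith [hJ.alpha_pos]
    have hρj : (ρ:ℝ) = r0 / j := by rw [hr0]; push_cast; field_simp
    have e2 : (r0:ℝ) ^ ((d:ℝ) - α) * ((r0:ℝ) ^ (α - 1) * X) = A * Cw * (j:ℝ) ^ (α - 1) + (j:ℝ) ^ ((d:ℝ) + α) * (k:ℝ) ^ α * G
        + A * Cw * (k:ℝ) ^ (-(d:ℝ) + α) := by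
      rw [hXd, hρj]
      push_cast
      rw [Real.div_rpow hr00.le hj0.le, Real.div_rpow hr00.le hj0.le, Real.mul_rpow hk0.le hr00.le, Real.mul_rpow hk0.le hr00.le]
      simp only [Real.rpow_add hr00, Real.rpow_sub hr00, Real.rpow_neg hr00.le, Real.rpow_one, Real.rpow_add hj0, Real.rpow_sub hj0, Real.rpow_neg hj0.le]
      have q1 : (r0:ℝ) ^ α ≠ 0 := by positivity
      have q2 : (r0:ℝ) ^ (d:ℝ) ≠ 0 := by positivity
      have q3 : (j:ℝ) ^ α ≠ 0 := by positivity
      have q4 : (j:ℝ) ^ (d:ℝ) ≠ 0 := by positivity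
      generalize (r0:ℝ) ^ α = u1 at *
      generalize (r0:ℝ) ^ (d:ℝ) = u2 at *
      generalize (j:ℝ) ^ α = u3 at *
      generalize (j:ℝ) ^ (d:ℝ) = u4 at *
      field_simp
    have e3 : 8 ^ d * (c0 * ((r0:ℝ) ^ ((d:ℝ) - α) * ((r0:ℝ) ^ (α - 1) * X))) ≤ A / 2 + 8 ^ d * c0 * (j:ℝ) ^ ((d:ℝ) + α) * (k:ℝ) ^ α * (CA * (4 * L) ^ α) := by
      rw [e2, hG]
      have a1 := mul_le_mul_of_nonneg_left hj hA0
      have a2 := mul_le_mul_of_nonneg_left hk hA0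
      have a3 := mul_le_mul_of_nonneg_left hL hA0
      linarith
    calc tt J β Λ x y ≤ c0 * ((r0:ℝ) ^ (α - 1) * X) * 1 := by rw [mul_one]; exact main
      _ ≤ c0 * ((r0:ℝ) ^ (α - 1) * X) * (8 ^ d * (r0:ℝ) ^ ((d:ℝ) - α) * nn (x - y) ^ (-(d:ℝ) + α)) := mul_le_mul_of_nonneg_left e1 (by positivity)
      _ = 8 ^ d * (c0 * ((r0:ℝ) ^ ((d:ℝ) - α) * ((r0:ℝ) ^ (α - 1) * X))) * nn (x - y) ^ (-(d:ℝ) + α) := by ring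
      _ ≤ _ := by
        refine mul_le_mul_of_nonneg_right (e3.trans ?_) (by positivity)
        have : 0 ≤ (4 * j:ℝ) ^ ((d:ℝ) - α) := by positivity
        linarith
  · set E := Λ.filter (fun b => r0 < normInf (b - x)) with hE
    rw [← sum_filter_add_sum_filter_not E (fun b => normInf (b - p) ≤ ρ),
      ← sum_filter_add_sum_filter_not (E.filter fun b => ¬ normInf (b - p) ≤ ρ) (fun b => normInf (b - y) ≤ k * r0), ← add_assoc]
    refine add_le_add (add_le_add ?_ ?_) ?_
    · refine le_trans (sum_le_sum (g := fun z => ww α r0 (z - p) * (A * (r0:ℝ) ^ (-(d:ℝ) + α))) fun z hz => ?_) ?_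
      · refine mul_le_mul_of_nonneg_left (tau_far hA0 hαd hr00 (le_trans ?_ (nn_ge _)) (hτ z y)) (ww_nonneg _ _)
        have h1 := (mem_filter.1 hz).2
        have h2 := nt x p y
        have h3 := nt p z y
        rw [ns p z] at h3; rw [ns x p] at h2
        have : r0 ≤ normInf (z - y) := by omega
        exact_mod_cast this
      · rw [← sum_mul, mul_comm]
        exact mul_le_mul_of_nonneg_left (hw2 _ _ hρ1 _ p fun b hb => (mem_filter.1 hb).2) (by positivity)
    · refine le_trans (sum_le_sum (g := fun z => (r0 * (ρ:ℝ) ^ (-(d:ℝ) - α)) * tt J β Λ z y) fun z hz => ?_) ?_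
      · refine mul_le_mul_of_nonneg_right ((ww_far _ _).trans (mul_le_mul_of_nonneg_left ?_ hr00.le)) (tt_nonneg hJ hβ)
        refine Real.rpow_le_rpow_of_nonpos hρ0 (le_trans ?_ (nn_ge _)) (by linarith [hJ.alpha_pos])
        have h1 := (mem_filter.1 (mem_filter.1 hz).1).2
        exact_mod_cast (not_le.1 h1).le
      · rw [← mul_sum]
        refine mul_le_mul_of_nonneg_left ?_ (by positivity)
        refine Gbound hJ hβ hβ1 hCA hCw hA hw1 hA0 hτ hy (by nlinarith) hL1 fun b hb => ?_
        simp only [hE, mem_filter] at hb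
        exact ⟨hb.1.1.1, hb.2⟩
    · refine le_trans (sum_le_sum (g := fun z => ww α r0 (z - p) * (A * ((k:ℝ) * r0) ^ (-(d:ℝ) + α))) fun z hz => ?_) ?_
      · refine mul_le_mul_of_nonneg_left (tau_far hA0 hαd (by positivity) (le_trans ?_ (nn_ge _)) (hτ z y)) (ww_nonneg _ _)
        have h1 := (mem_filter.1 hz).2
        exact_mod_cast (not_le.1 h1).le
      · rw [← sum_mul, mul_comm]
        exact mul_le_mul_of_nonneg_left (hw1 _ hr1 _ p) (by positivity)

/-- pointwise two-point bound -/
theorem two_point (hJ : KernelHyp d J α c C) (hα : α < 1) {β₀ β₁ : ℝ} (hβ₀ : 0 < β₀) (h01 : β₀ ≤ β₁) : ∃ A : ℝ, 0 < A ∧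
    ∀ β, β₀ ≤ β → β ≤ β₁ → (∃ K, Chi J β K) → ∀ Λ x y, tt J β Λ x y ≤ A * nn (x - y) ^ (-(d:ℝ) + α) := by
  obtain ⟨CA, hCA, hA⟩ := A4 hJ hβ₀
  obtain ⟨A₀, hA₀, h⟩ := improve hJ hα (hβ₀.trans_le h01) hCA
  have hαd := hJ.alpha_lt_d
  refine ⟨2 * A₀, by positivity, fun β h0 h1 hK Λ => ?_⟩
  have hβ : 0 ≤ β := hβ₀.le.trans h0
  obtain ⟨m, hm⟩ := sub_bx Λ
  set A1 := (2 * m + 1 : ℝ) ^ ((d:ℝ) - α) with hA1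
  have hit : ∀ i : ℕ, ∀ x y, tt J β Λ x y ≤ (A1 / 2 ^ i + 2 * A₀) * nn (x - y) ^ (-(d:ℝ) + α) := by
    intro i
    induction i with
    | zero =>
      intro x y
      have hn0 := nn_pos (x - y)
      by_cases hxy : x ∈ Λ ∧ y ∈ Λ
      · have hxm := mem_bx.1 (hm hxy.1)
        have hym := mem_bx.1 (hm hxy.2)
        have h2 := nt x 0 y
        rw [sub_zero, ns 0 y, sub_zero] at h2
        have hle : nn (x - y) ≤ 2 * m + 1 := max_le (by linarith [Nat.cast_nonneg (α := ℝ) m]) (by exact_mod_cast (by omega : normInf (x - y) ≤ 2 * m + 1) |>.trans le_rfl)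
        have h3 : 1 ≤ A1 * nn (x - y) ^ (-(d:ℝ) + α) := by
          rw [show -(d:ℝ) + α = -((d:ℝ) - α) by ring, Real.rpow_neg hn0.le, ← div_eq_mul_inv, one_le_div (by positivity)]
          exact Real.rpow_le_rpow hn0.le hle (by linarith)
        refine (tt_le_one hJ hβ).trans (h3.trans (mul_le_mul_of_nonneg_right ?_ (by positivity)))
        rw [pow_zero, div_one]; linarith
      · have : tt J β Λ x y = 0 := by
          rw [not_and_or] at hxy
          exact hxy.elim (fun h => tau_zero_left h) fun h => tau_zero_right h
        rw [this]; positivity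
    | succ i ih =>
      intro x y
      refine (h β hβ h1 (hA β h0 hK) _ (by positivity) Λ ih x y).trans (le_of_eq ?_)
      rw [pow_succ]; ring
  intro x y
  have lim : Filter.Tendsto (fun i : ℕ => (A1 / 2 ^ i + 2 * A₀) * nn (x - y) ^ (-(d:ℝ) + α)) Filter.atTop
      (nhds ((0 + 2 * A₀) * nn (x - y) ^ (-(d:ℝ) + α))) := by
    refine Filter.Tendsto.mul_const _ (Filter.Tendsto.add_const _ ?_)
    exact tendsto_const_nhds.div_atTop (tendsto_pow_atTop_atTop_of_one_lt (by norm_num))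
  rw [zero_add] at lim
  exact ge_of_tendsto' lim fun i => hit i x y
end pointwise

section treegraph
open scoped Classical
variable {U : Type*} [DecidableEq U] {T T' : Finset (Sym2 U)} {B : Finset U} {r : Sym2 U → ℝ}

inductive Pth (T : Finset (Sym2 U)) (B : Finset U) (u : U) : Finset (Sym2 U) → Finset U → U → Prop
  | nil : Pth T B u ∅ {u} u
  | cons {T0 : Finset (Sym2 U)} {W : Finset U} {z z' : U} : Pth T B u T0 W z → z' ∉ W → z' ∈ B → s(z, z') ∈ T →
      Pth T B u (insert s(z, z') T0) (insert z' W) z'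

theorem Pth.inv {u z : U} {T0 : Finset (Sym2 U)} {W : Finset U} (hu : u ∈ B) (h : Pth T B u T0 W z) :
    T0 ⊆ T ∧ (∀ a b, s(a, b) ∈ T0 → a ∈ W) ∧ z ∈ W ∧ cn T0 B u z ∧ (∀ e ∈ T0, ¬ e.IsDiag) ∧ u ∈ W := by
  induction h with
  | nil => simp [cn_refl hu]
  | @cons T0 W z z' h1 h2 h3 h4 ih =>
    obtain ⟨i1, i2, i3, i4, i5, i6⟩ := ih
    refine ⟨Finset.insert_subset h4 i1, fun a b hab => ?_, mem_insert_self _ _,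
      (i4.mono (subset_insert _ _) subset_rfl).step h3 (mem_insert_self _ _), fun e he => ?_, mem_insert_of_mem i6⟩
    · rw [mem_insert, Sym2.eq_iff] at hab
      rcases hab with (⟨rfl, rfl⟩ | ⟨rfl, rfl⟩) | hab
      exacts [mem_insert_of_mem i3, mem_insert_self _ _, mem_insert_of_mem (i2 a b hab)]
    · rcases mem_insert.1 he with rfl | he
      · rw [Sym2.mk_isDiag_iff]; rintro rfl; exact h2 i3
      · exact i5 e he
theorem Pth.split {u z : U} {T0 : Finset (Sym2 U)} {W : Finset U} (hu : u ∈ B) (h : Pth T B u T0 W z) {p : U} (hp : p ∈ W) :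
    ∃ Ta Tb W', Pth T B u Ta W' p ∧ Ta ⊆ T0 ∧ Tb ⊆ T0 ∧ Disjoint Ta Tb ∧ cn Tb B p z := by
  induction h with
  | nil => rw [Finset.mem_singleton] at hp; subst hp; exact ⟨∅, ∅, {p}, .nil, by simp, by simp, by simp, cn_refl hu⟩
  | @cons T0 W z z' h1 h2 h3 h4 ih =>
    rcases mem_insert.1 hp with rfl | hp
    · exact ⟨_, ∅, _, .cons h1 h2 h3 h4, subset_rfl, by simp, by simp, cn_refl h3⟩
    · obtain ⟨Ta, Tb, W', i1, i2, i3, i4, i5⟩ := ih hp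
      refine ⟨Ta, insert s(z, z') Tb, W', i1, i2.trans (subset_insert _ _), Finset.insert_subset_insert _ i3, ?_,
        (i5.mono (subset_insert _ _) subset_rfl).step h3 (mem_insert_self _ _)⟩
      rw [Finset.disjoint_insert_right]
      refine ⟨fun h => h2 ((h1.inv hu).2.1 z' z ?_), i4⟩
      rw [Sym2.eq_swap]; exact i2 h
theorem Pth.ex {u z : U} (h : cn T B u z) : ∃ T0 W, Pth T B u T0 W z := by
  refine h.ind_on (p := fun z => ∃ T0 W, Pth T B u T0 W z) ⟨_, _, .nil⟩ fun a b h1 h2 h3 h4 => ?_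
  obtain ⟨T0, W, h2⟩ := h2
  by_cases hb : b ∈ W
  · obtain ⟨Ta, _, W', i, _⟩ := h2.split h.1 hb; exact ⟨_, _, i⟩
  · exact ⟨_, _, .cons h2 hb h3 h4⟩

def QR (R : Finset (Sym2 U) → U → Prop) (B : Finset U) (w : U) (T : Finset (Sym2 U)) : Prop := ∃ g, cn T B w g ∧ R T g
/-- admissible marking -/
def Mk (R : Finset (Sym2 U) → U → Prop) : Prop :=
  (∀ T T' g, T ⊆ T' → R T g → R T' g) ∧ ∀ T g, R T g → R (T.filter fun e => e.IsDiag) g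
theorem QR_inc {R : Finset (Sym2 U) → U → Prop} (hR : Mk R) (B : Finset U) (w : U) : Inc (QR R B w) := by
  rintro T T' h ⟨g, h1, h2⟩; exact ⟨g, h1.mono h subset_rfl, hR.1 _ _ _ h h2⟩
theorem tree_det {R : Finset (Sym2 U) → U → Prop} (hR : Mk R) {u z : U} (h : cn T B u z) (hQ : QR R B u T) :
    ∃ w ∈ B, dj (dj (fun T => cn T B u w) (fun T => cn T B w z)) (QR R B w) T := by
  obtain ⟨T0, W, hp⟩ := Pth.ex h
  obtain ⟨i1, i2, i3, i4, i5, i6⟩ := hp.inv h.1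
  obtain ⟨g, hg, hRg⟩ := hQ
  have key : ∃ p ∈ W, ∃ T3, T3 ⊆ T ∧ Disjoint T0 T3 ∧ cn T3 B p g := by
    refine hg.ind_on (p := fun g => ∃ p ∈ W, ∃ T3, T3 ⊆ T ∧ Disjoint T0 T3 ∧ cn T3 B p g) ⟨u, i6, ∅, by simp, by simp, cn_refl h.1⟩ fun a b h1 h2 h3 h4 => ?_
    obtain ⟨p, hpW, T3, j1, j2, j3⟩ := h2
    by_cases hab : s(a, b) ∈ T0
    · exact ⟨b, i2 b a (by rw [Sym2.eq_swap]; exact hab), ∅, by simp, by simp, cn_refl h3⟩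
    · exact ⟨p, hpW, insert s(a, b) T3, Finset.insert_subset h4 j1, by rw [Finset.disjoint_insert_right]; exact ⟨hab, j2⟩,
        (j3.mono (subset_insert _ _) subset_rfl).step h3 (mem_insert_self _ _)⟩
  obtain ⟨p, hpW, T3, j1, j2, j3⟩ := key
  obtain ⟨Ta, Tb, W', k1, k2, k3, k4, k5⟩ := hp.split h.1 hpW
  refine ⟨p, j3.left, T0, T3 ∪ T.filter (fun e => e.IsDiag), i1, union_subset j1 (filter_subset _ _), ?_,
    ⟨Ta, Tb, k2, k3, k4, (k1.inv h.1).2.2.2.1, k5⟩, ⟨g, j3.mono subset_union_left subset_rfl, hR.1 _ _ _ Finset.subset_union_right (hR.2 _ _ hRg)⟩⟩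
  rw [Finset.disjoint_union_right]
  exact ⟨j2, disjoint_left.2 fun e he he' => i5 e he (mem_filter.1 he').2⟩
theorem tree {R : Finset (Sym2 U) → U → Prop} (hR : Mk R) (hr : ∀ e, 0 ≤ r e) {S : Finset (Sym2 U)} (hS : B.sym2 ⊆ S) (u z : U) :
    Pr r S (fun T => cn T B u z ∧ QR R B u T) ≤ ∑ w ∈ B, tau r B u w * tau r B w z * Pr r S (QR R B w) := by
  refine (Pr_exists_le hr S B (fun w => dj (dj (fun T => cn T B u w) (fun T => cn T B w z)) (QR R B w)) _
    fun T _ h => tree_det hR h.1 h.2).trans (sum_le_sum fun w _ => ?_)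
  refine (BK hr S (dj_inc _ _) (QR_inc hR B w)).trans (mul_le_mul_of_nonneg_right ?_ (Pr_nonneg hr _ _))
  refine (BK hr S (cn_inc _ _ _) (cn_inc _ _ _)).trans (le_of_eq ?_)
  rw [Pr_cn hS, Pr_cn hS]

/-- connected to a marked (green) vertex -/
def hit (T : Finset (Sym2 U)) (B : Finset U) (x : U) : Prop := ∃ g, cn T B x g ∧ s(g, g) ∈ T
theorem hit_mk : Mk (fun (T : Finset (Sym2 U)) g => s(g, g) ∈ T) :=
  ⟨fun _ _ _ h h' => h h', fun T g h => mem_filter.2 ⟨h, by simp⟩⟩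
theorem hit_inc (B : Finset U) (x : U) : Inc (fun T => hit T B x) := QR_inc hit_mk B x
theorem hit_dep (B : Finset U) (x : U) : Dep (fun e => e ∈ B.sym2) (fun T => hit T B x) := by
  intro T T' h
  have h1 : ∀ g, cn T B x g = cn T' B x g := fun g => cn_dep B x g T T' fun e he => h e he.1
  refine propext ⟨?_, ?_⟩
  · rintro ⟨g, h2, h3⟩; exact ⟨g, h1 g ▸ h2, (h _ (mk_mem_sym2_iff.2 ⟨h2.right, h2.right⟩)).1 h3⟩
  · rintro ⟨g, h2, h3⟩; exact ⟨g, (h1 g).symm ▸ h2, (h _ (mk_mem_sym2_iff.2 ⟨h2.right, h2.right⟩)).2 h3⟩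
theorem hit_cn {x y : U} (h : cn T B x y) : hit T B x ↔ hit T B y :=
  ⟨fun ⟨g, h1, h2⟩ => ⟨g, h.symm.trans h1, h2⟩, fun ⟨g, h1, h2⟩ => ⟨g, h.trans h1, h2⟩⟩
noncomputable def ph (r : Sym2 U → ℝ) (B : Finset U) (x : U) : ℝ := Pr r B.sym2 (fun T => hit T B x)
theorem Pr_hit {S : Finset (Sym2 U)} (hS : B.sym2 ⊆ S) (x : U) : Pr r S (fun T => hit T B x) = ph r B x :=
  Pr_dep_congr (hit_dep B x) (fun _ he => ⟨fun _ => he, fun h => hS h⟩) fun _ _ _ => rfl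
theorem ph_nonneg (hr : ∀ e, 0 ≤ r e) (x : U) : 0 ≤ ph r B x := Pr_nonneg hr _ _
theorem ph_mono (hr : ∀ e, 0 ≤ r e) {B' : Finset U} (h : B ⊆ B') (x : U) : ph r B x ≤ ph r B' x := by
  rw [← Pr_hit (sym2_mono h)]
  exact Pr_mono hr fun T _ ⟨g, h1, h2⟩ => ⟨g, h1.mono subset_rfl h, h2⟩

theorem c2_det {v : U} {W : Finset U} (h : hit T B v) :
    hit T (B \ W) v ∨ ∃ z ∈ W, dj (fun T => cn T B v z) (fun T => hit T B z) T := by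
  obtain ⟨y, h1, h2⟩ := h
  by_cases hv : v ∈ W
  · exact Or.inr ⟨v, hv, ∅, T, by simp, subset_rfl, by simp, cn_refl h1.1, y, h1, h2⟩
  set D := cl T (B \ W) v with hD
  by_cases hy : y ∈ D
  · exact Or.inl ⟨y, mem_cl.1 hy, h2⟩
  have hvD : v ∈ D := mem_cl.2 (cn_refl (mem_sdiff.2 ⟨h1.1, hv⟩))
  obtain ⟨a, ha, b, hb, hab, _, hby⟩ := h1.last_exit hvD hy
  rw [mem_sdiff] at hb
  have hbW : b ∈ W := by
    by_contra hbW
    exact hb.2 (mem_cl.2 ((mem_cl.1 ha).step (mem_sdiff.2 ⟨hb.1, hbW⟩) hab))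
  refine Or.inr ⟨b, hbW, T.filter (touch D), T.filter (fun e => ¬ touch D e), filter_subset _ _, filter_subset _ _,
    Finset.disjoint_filter_filter_not _ _ _, ?_, y, ?_, mem_filter.2 ⟨h2, ?_⟩⟩
  · have : cn (T.filter (touch D)) (B \ W) v a :=
      (mem_cl.1 ha).agree fun p q hp _ _ hpq => mem_filter.2 ⟨hpq, touch_left (mem_cl.2 hp)⟩
    exact (this.mono subset_rfl sdiff_subset).step hb.1 (mem_filter.2 ⟨hab, touch_left ha⟩)
  · have : cn (T.filter (fun e => ¬ touch D e)) (B \ D) b y := hby.agree fun p q hp hq _ hpq => mem_filter.2 ⟨hpq, by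
      rintro ⟨w, hw, hwe⟩
      rcases Sym2.mem_iff.1 hwe with rfl | rfl
      exacts [(mem_sdiff.1 hp.right).2 hw, (mem_sdiff.1 hq).2 hw]⟩
    exact this.mono subset_rfl sdiff_subset
  · rintro ⟨w, hw, hwe⟩
    rcases Sym2.mem_iff.1 hwe with rfl | rfl <;> exact hy hw
theorem c2 (hr : ∀ e, 0 ≤ r e) {M : ℝ} (hM : ∀ B x, ph r B x ≤ M) (v : U) (W : Finset U) :
    ph r B v ≤ ph r (B \ W) v + M * ∑ z ∈ W, tau r B v z := by
  rw [← Pr_hit (sym2_mono (sdiff_subset (s := B) (t := W)))]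
  refine (Pr_mono hr fun T _ h => c2_det h).trans ((Pr_or_le hr _ _ _).trans (add_le_add le_rfl ?_))
  refine (Pr_exists_le hr _ W (fun z => dj (fun T => cn T B v z) (fun T => hit T B z)) _ fun T _ h => h).trans ?_
  rw [mul_sum]
  refine sum_le_sum fun z _ => (BK hr _ (cn_inc _ _ _) (hit_inc B z)).trans ?_
  rw [mul_comm]
  exact mul_le_mul_of_nonneg_right (hM B z) (Pr_nonneg hr _ _)
end treegraph

section condition
open scoped Classical
variable {U : Type*} [DecidableEq U] {T T' : Finset (Sym2 U)} {B : Finset U} {r : Sym2 U → ℝ}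

theorem cond_mono {E X : Type*} [DecidableEq E] {r : E → ℝ} (hr : ∀ e, 0 ≤ r e) {S : Finset E} (s : Finset X) (D : Finset E → X)
    (hD : ∀ T ⊆ S, D T ∈ s) (F G : X → Finset E → ℝ)
    (h : ∀ x ∈ s, ∃ π : E → Prop, Dep π (fun T => D T = x) ∧ Dep (fun e => ¬ π e) (F x) ∧ Dep (fun e => ¬ π e) (G x))
    (hle : ∀ x ∈ s, Ex r S (F x) ≤ Ex r S (G x)) : Ex r S (fun T => F (D T) T) ≤ Ex r S (fun T => G (D T) T) := by
  rw [Ex_cond s D hD F fun x hx => (h x hx).imp fun π h => ⟨h.1, h.2.1⟩, Ex_cond s D hD G fun x hx => (h x hx).imp fun π h => ⟨h.1, h.2.2⟩]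
  exact Ex_mono hr fun T hT => hle _ (hD T hT)
theorem cn_off {D : Finset U} {x y : U} (hcl : ∀ a b, a ∉ D → b ∈ B → s(a, b) ∈ T → b ∉ D) (h : cn T B x y) (hx : x ∉ D) : cn T (B \ D) x y :=
  h.ind_on (p := fun y => cn T (B \ D) x y) (cn_refl (mem_sdiff.2 ⟨h.1, hx⟩)) fun a b h1 h2 h3 h4 =>
    h2.step (mem_sdiff.2 ⟨h3, hcl a b (mem_sdiff.1 h2.right).2 h3 h4⟩) h4
theorem cl_closed (o a b : U) (ha : a ∈ B) (h : a ∉ cl T B o) (hab : s(a, b) ∈ T) : b ∉ cl T B o := fun hb =>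
  h (mem_cl.2 ((mem_cl.1 hb).step ha (by rw [Sym2.eq_swap]; exact hab)))
theorem cn_off_cl {o x y : U} (h : cn T B x y) (hx : x ∉ cl T B o) : cn T (B \ cl T B o) x y := by
  refine h.ind_on (p := fun y => cn T (B \ cl T B o) x y) (cn_refl (mem_sdiff.2 ⟨h.1, hx⟩)) fun a b h1 h2 h3 h4 => ?_
  exact h2.step (mem_sdiff.2 ⟨h3, cl_closed o a b h1.right (mem_sdiff.1 h2.right).2 h4⟩) h4
theorem sdiff_not_touch {D : Finset U} {e : Sym2 U} (h : e ∈ (B \ D).sym2) : ¬ touch D e := by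
  rintro ⟨y, hy, hye⟩
  exact (mem_sdiff.1 (Finset.mem_sym2_iff.1 h y hye)).2 hy
theorem loops_dep (D : Finset U) (f : (U → Prop) → Prop) (hf : ∀ σ σ' : U → Prop, (∀ y ∈ D, σ y ↔ σ' y) → f σ = f σ') :
    Dep (fun e : Sym2 U => touch D e ∧ e.IsDiag) (fun T : Finset (Sym2 U) => f fun y => s(y, y) ∈ T) := fun T T' h =>
  hf _ _ fun y hy => h _ ⟨touch_left hy, by simp⟩

/-- exploring the cluster of `o`: lower bound -/
theorem explore_ge (hr : ∀ e, 0 ≤ r e) {S : Finset (Sym2 U)} (o : U) (f : Finset U → (U → Prop) → Prop)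
    (hf : ∀ D, ∀ σ σ' : U → Prop, (∀ y ∈ D, σ y ↔ σ' y) → f D σ = f D σ') (A : Finset U → Finset (Sym2 U) → Prop)
    (hA : ∀ D, Dep (fun e => e ∈ (B \ D).sym2) (A D)) (φ : Finset U → ℝ) (hφ : ∀ D ⊆ B, φ D ≤ Pr r S (A D)) :
    Ex r S (fun T => ind (f (cl T B o) fun y => s(y, y) ∈ T) * φ (cl T B o)) ≤
      Pr r S (fun T => (f (cl T B o) fun y => s(y, y) ∈ T) ∧ A (cl T B o) T) := by
  unfold Pr; simp_rw [ind_and]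
  refine cond_mono hr B.powerset (fun T => cl T B o) (fun T _ => mem_powerset.2 (cl_sub _ _ _))
    (fun D T => ind (f D fun y => s(y, y) ∈ T) * φ D) (fun D T => ind (f D fun y => s(y, y) ∈ T) * ind (A D T)) (fun D _ => ?_) fun D hD => ?_
  · refine ⟨_, cl_dep B o, ?_, ?_⟩
    · exact ((loops_dep D (f D) (hf D)).mono fun e he h => h.1.2 he.2).ind.mul fun _ _ _ => rfl
    · exact ((loops_dep D (f D) (hf D)).mono fun e he h => h.1.2 he.2).ind.mul ((hA D).mono (π' := fun e => ¬ (inner B e ∧ touch D e)) fun e he h => sdiff_not_touch he h.2).ind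
  · rw [Ex_indep (π := touch D) ((loops_dep D (f D) (hf D)).mono fun e he => he.1).ind ((hA D).mono fun e he => sdiff_not_touch he).ind]
    rw [show (fun T => ind (f D fun y => s(y, y) ∈ T) * φ D) = fun T => φ D * ind (f D fun y => s(y, y) ∈ T) from funext fun T => mul_comm _ _, Ex_mul, mul_comm]
    exact mul_le_mul_of_nonneg_left (hφ D (mem_powerset.1 hD)) (Pr_nonneg hr _ _)
theorem hit_cl {o : U} : hit T B o ↔ ∃ y ∈ cl T B o, s(y, y) ∈ T := by
  simp only [hit, mem_cl]
theorem sum_cl {x : U} (f : U → ℝ) : ∑ y ∈ cl T B x, f y = ∑ y ∈ B, ind (cn T B x y) * f y := by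
  rw [cl, Finset.sum_filter]; exact sum_congr rfl fun y _ => by unfold ind; split_ifs <;> simp

theorem two_hit (hr : ∀ e, 0 ≤ r e) {M t : ℝ} (hM0 : 0 ≤ M) (hM : ∀ B x, ph r B x ≤ M) {u v : U}
    (ht : ∑ z ∈ B, ∑ w ∈ B, tau r B u w * tau r B w z * tau r B v z ≤ t) {S : Finset (Sym2 U)} (hS : B.sym2 ⊆ S) :
    ph r B u * ph r B v - M ^ 2 * t ≤ Pr r S (fun T => hit T B u ∧ hit T B v ∧ ¬ cn T B u v) := by
  have h1 := explore_ge (B := B) (S := S) hr u (fun D σ => ∃ y ∈ D, σ y) (fun D σ σ' h => by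
      refine propext (exists_congr fun y => and_congr_right fun hy => h y hy))
    (fun D T => hit T (B \ D) v) (fun D => hit_dep (B \ D) v) (fun D => ph r B v - M * ∑ z ∈ D, tau r B v z) (fun D hD => by
      beta_reduce
      rw [Pr_hit ((sym2_mono sdiff_subset).trans hS)]
      have := c2 hr hM (B := B) v D; linarith)
  refine le_trans (le_trans ?_ h1) (Pr_mono hr fun T _ h => ?_)
  · have e : ∀ T, ind (∃ y ∈ cl T B u, s(y, y) ∈ T) * (ph r B v - M * ∑ z ∈ cl T B u, tau r B v z)
        = ph r B v * ind (hit T B u) - M * ∑ z ∈ B, tau r B v z * ind (cn T B u z ∧ hit T B u) := by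
      intro T
      rw [ind_congr hit_cl.symm, sum_cl, mul_sub, mul_sum, mul_sum, mul_sum]
      congr 1
      · ring
      · exact sum_congr rfl fun z _ => by rw [ind_and]; ring
    simp_rw [e]
    rw [Ex_sub, Ex_mul, Ex_mul, Ex_sum]
    simp_rw [Ex_mul]
    have e2 : ∀ z ∈ B, tau r B v z * Ex r S (fun T => ind (cn T B u z ∧ hit T B u)) ≤ M * ∑ w ∈ B, tau r B u w * tau r B w z * tau r B v z := by
      intro z _
      have := tree hit_mk hr hS u z
      calc _ ≤ tau r B v z * ∑ w ∈ B, tau r B u w * tau r B w z * M := by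
            refine mul_le_mul_of_nonneg_left (this.trans (sum_le_sum fun w _ => ?_)) (tau_nonneg hr)
            refine mul_le_mul_of_nonneg_left (le_trans (le_of_eq (Pr_hit hS w)) (hM B w)) (mul_nonneg (tau_nonneg hr) (tau_nonneg hr))
        _ = _ := by rw [mul_sum, mul_sum]; exact sum_congr rfl fun w _ => by ring
    have e3 := sum_le_sum e2
    rw [← mul_sum] at e3
    have e4 : Ex r S (fun T => ind (hit T B u)) = ph r B u := Pr_hit hS u
    rw [e4]
    have e5 := mul_le_mul_of_nonneg_left (e3.trans (mul_le_mul_of_nonneg_left ht hM0)) hM0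
    linarith
  · obtain ⟨h1, g, h2, h3⟩ := h
    refine ⟨hit_cl.2 h1, ⟨g, h2.mono subset_rfl sdiff_subset, h3⟩, fun hc => ?_⟩
    exact (mem_sdiff.1 h2.left).2 (mem_cl.2 hc)

theorem c3 (hr : ∀ e, 0 ≤ r e) {M t : ℝ} (hM0 : 0 ≤ M) (hM : ∀ B x, ph r B x ≤ M) {o x u v : U}
    (ht : ∀ B' : Finset U, ∑ z ∈ B', ∑ w ∈ B', tau r B' u w * tau r B' w z * tau r B' v z ≤ t) :
    (ph r B u * ph r B v - M ^ 2 * t) * Pr r B.sym2 (fun T => cn T B o x ∧ ¬ hit T B o)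
      - M ^ 2 * ∑ z ∈ B, (tau r B u z + tau r B v z) * Pr r B.sym2 (fun T => cn T B o x ∧ cn T B o z ∧ ¬ hit T B o)
      ≤ Pr r B.sym2 (fun T => cn T B o x ∧ ¬ hit T B o ∧ hit T B u ∧ hit T B v ∧ ¬ cn T B u v) := by
  have h1 := explore_ge (B := B) (S := B.sym2) hr o (fun D σ => x ∈ D ∧ ∀ y ∈ D, ¬ σ y) (fun D σ σ' h => by
      refine propext (and_congr_right fun _ => forall_congr' fun y => ⟨fun i hy => ?_, fun i hy => ?_⟩)
      · rw [← h y hy]; exact i hy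
      · rw [h y hy]; exact i hy)
    (fun D T => hit T (B \ D) u ∧ hit T (B \ D) v ∧ ¬ cn T (B \ D) u v) (fun D T T' h => by
      have h1 : hit T (B \ D) u = hit T' (B \ D) u := hit_dep (B \ D) u T T' h
      have h2 : hit T (B \ D) v = hit T' (B \ D) v := hit_dep (B \ D) v T T' h
      have h3 : cn T (B \ D) u v = cn T' (B \ D) u v := cn_dep (B \ D) u v T T' fun e he => h e he.1
      beta_reduce
      rw [h1, h2, h3])
    (fun D => ph r B u * ph r B v - M ^ 2 * t - M ^ 2 * ∑ z ∈ D, (tau r B u z + tau r B v z)) (fun D hD => by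
      refine le_trans ?_ (two_hit hr hM0 hM (ht _) (sym2_mono sdiff_subset))
      have a1 := c2 hr hM (B := B) u D
      have a2 := c2 hr hM (B := B) v D
      have b1 := ph_mono hr (sdiff_subset (s := B) (t := D)) u
      have b2 := ph_mono hr (sdiff_subset (s := B) (t := D)) v
      have b3 := ph_nonneg hr (B := B \ D) v
      have b4 := ph_nonneg hr (B := B) u
      have c1 : (ph r B u - ph r (B \ D) u) * ph r (B \ D) v ≤ (M * ∑ z ∈ D, tau r B u z) * M :=
        mul_le_mul (by linarith) (hM _ _) b3 (mul_nonneg hM0 (sum_nonneg fun _ _ => tau_nonneg hr))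
      have c2' : ph r B u * (ph r B v - ph r (B \ D) v) ≤ M * (M * ∑ z ∈ D, tau r B v z) :=
        mul_le_mul (hM _ _) (by linarith) (by linarith) hM0
      rw [sum_add_distrib]
      nlinarith)
  refine le_trans (le_trans (le_of_eq ?_) h1) (Pr_mono hr fun T _ h => ?_)
  · have e : ∀ T, ind (x ∈ cl T B o ∧ ∀ y ∈ cl T B o, ¬ s(y, y) ∈ T) * (ph r B u * ph r B v - M ^ 2 * t - M ^ 2 * ∑ z ∈ cl T B o, (tau r B u z + tau r B v z))
        = (ph r B u * ph r B v - M ^ 2 * t) * ind (cn T B o x ∧ ¬ hit T B o)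
          - M ^ 2 * ∑ z ∈ B, (tau r B u z + tau r B v z) * ind (cn T B o x ∧ cn T B o z ∧ ¬ hit T B o) := by
      intro T
      have e0 : (x ∈ cl T B o ∧ ∀ y ∈ cl T B o, ¬ s(y, y) ∈ T) ↔ cn T B o x ∧ ¬ hit T B o := by
        rw [hit_cl, mem_cl]; push Not; rfl
      rw [ind_congr e0, sum_cl, mul_sub, mul_sum, mul_sum, mul_sum]
      congr 1
      · ring
      · exact sum_congr rfl fun z _ => by rw [ind_and, ind_and, ind_and]; ring
    simp_rw [e]
    rw [Ex_sub, Ex_mul, Ex_mul, Ex_sum]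
    simp_rw [Ex_mul]
    rfl
  · obtain ⟨⟨h1, h2⟩, ⟨g, h3, h4⟩, ⟨g', h5, h6⟩, h7⟩ := h
    refine ⟨mem_cl.1 h1, fun hh => ?_, ⟨g, h3.mono subset_rfl sdiff_subset, h4⟩, ⟨g', h5.mono subset_rfl sdiff_subset, h6⟩, fun hc => ?_⟩
    · obtain ⟨y, hy, hy'⟩ := hit_cl.1 hh; exact h2 y hy hy'
    · exact h7 (cn_off_cl hc (mem_sdiff.1 h3.left).2)

theorem c4 (hr : ∀ e, 0 ≤ r e) (o x z : U) :
    Pr r B.sym2 (fun T => cn T B o x ∧ cn T B o z ∧ ¬ hit T B o) ≤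
      ∑ w ∈ B, tau r B x w * tau r B w z * Pr r B.sym2 (fun T => cn T B w o ∧ ¬ hit T B w) := by
  set D : Finset (Sym2 U) → Finset U := fun T => clS (fun a => s(a, a) ∈ T) T B with hD
  have hmem : ∀ T y, y ∈ D T ↔ hit T B y := fun T y => by
    rw [hD, mem_clS]; exact ⟨fun ⟨a, h1, h2⟩ => ⟨a, h2.symm, h1⟩, fun ⟨a, h1, h2⟩ => ⟨a, h2, h1.symm⟩⟩
  have hoff : ∀ T p q, cn T B p q → ¬ hit T B p → cn T (B \ D T) p q := fun T p q h hp => by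
    refine h.ind_on (p := fun y => cn T (B \ D T) p y) (cn_refl (mem_sdiff.2 ⟨h.1, by rwa [hmem]⟩)) fun a b h1 h2 h3 h4 => ?_
    refine h2.step (mem_sdiff.2 ⟨h3, ?_⟩) h4
    rw [hmem, ← hit_cn (h1.step h3 h4)]; exact hp
  have h1 := cond_mono hr (S := B.sym2) B.powerset D (fun T _ => mem_powerset.2 (clS_sub _ _ _))
    (fun D T => ind (cn T (B \ D) x z ∧ QR (fun _ g => g = o) (B \ D) x T))
    (fun D T => ∑ w ∈ B, (tau r B x w * tau r B w z) * ind (cn T (B \ D) w o)) (fun K _ => ?_) (fun K _ => ?_)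
  · refine le_trans (Ex_mono hr fun T _ => ind_mono fun h => ?_) (h1.trans ?_)
    · have hx := hoff T o x h.1 h.2.2
      exact ⟨hx.symm.trans (hoff T o z h.2.1 h.2.2), o, hx.symm, rfl⟩
    · rw [Ex_sum]
      refine sum_le_sum fun w _ => ?_
      rw [Ex_mul]
      refine mul_le_mul_of_nonneg_left (Ex_mono hr fun T _ => ind_mono fun h => ?_) (mul_nonneg (tau_nonneg hr) (tau_nonneg hr))
      exact ⟨h.mono subset_rfl sdiff_subset, by rw [← hmem]; exact (mem_sdiff.1 h.left).2⟩
  · have hin : ∀ e, inner (B \ K) e → ¬ (e.IsDiag ∨ touch K e) := fun e he h => h.elim he.2 (sdiff_not_touch he.1)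
    refine ⟨fun e => e.IsDiag ∨ touch K e, clS_dep (σ := fun T a => s(a, a) ∈ T) B (fun T T' h => funext fun a => propext (h _ (Or.inl (by simp)))) (fun e _ h => Or.inr h), ?_, ?_⟩
    · intro T T' h
      have : ∀ p q, cn T (B \ K) p q = cn T' (B \ K) p q := fun p q => cn_dep (B \ K) p q T T' fun e he => h e (hin e he)
      simp only [QR, this]
    · intro T T' h
      have : ∀ p q, cn T (B \ K) p q = cn T' (B \ K) p q := fun p q => cn_dep (B \ K) p q T T' fun e he => h e (hin e he)
      simp only [this]
  · have hsub : (B \ K).sym2 ⊆ B.sym2 := sym2_mono sdiff_subset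
    refine (tree (R := fun _ g => g = o) ⟨fun _ _ _ _ h => h, fun _ _ h => h⟩ hr hsub x z).trans ?_
    rw [Ex_sum]
    refine (sum_le_sum fun w _ => ?_).trans (sum_le_sum_of_subset_of_nonneg (sdiff_subset (s := B) (t := K)) fun w _ _ => ?_)
    · rw [Ex_mul]
      refine mul_le_mul (mul_le_mul (tau_mono hr sdiff_subset) (tau_mono hr sdiff_subset) (tau_nonneg hr) (tau_nonneg hr))
        (Pr_mono hr fun T _ => ?_) (Pr_nonneg hr _ _) (mul_nonneg (tau_nonneg hr) (tau_nonneg hr))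
      rintro ⟨g, hg, rfl⟩; exact hg
    · rw [Ex_mul]; exact mul_nonneg (mul_nonneg (tau_nonneg hr) (tau_nonneg hr)) (Pr_nonneg hr _ _)
end condition

section insertion
open scoped Classical
variable {U : Type*} [DecidableEq U] {T T' : Finset (Sym2 U)} {B : Finset U} {r : Sym2 U → ℝ}

theorem ind_disj {ι : Type*} (s : Finset ι) (A : ι → Prop) (P : Prop) (h1 : ∀ i j, A i → A j → i = j) (h2 : ∀ i, A i → P) :
    ∑ i ∈ s, ind (A i) ≤ ind P := by
  by_cases h : ∃ i, A i
  · obtain ⟨i, hi⟩ := h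
    rw [ind_true (h2 i hi)]
    calc _ ≤ ∑ j ∈ s, (if j = i then (1:ℝ) else 0) := sum_le_sum fun j _ => by
          split_ifs with hj
          · exact ind_le_one _
          · exact le_of_eq (ind_false fun hA => hj (h1 j i hA hi))
      _ ≤ 1 := by rw [Finset.sum_ite_eq']; split_ifs <;> norm_num
  · rw [Finset.sum_eq_zero fun i _ => ind_false fun hA => h ⟨i, hA⟩]; exact ind_nonneg _
def Zv (T : Finset (Sym2 U)) (B : Finset U) (o x u v : U) : Prop :=
  cn T B o x ∧ ¬ hit T B o ∧ hit T B u ∧ hit T B v ∧ ¬ cn T B u v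
theorem Zv.swap {o x u v : U} (h : Zv T B o x u v) : Zv T B o x v u :=
  ⟨h.1, h.2.1, h.2.2.2.1, h.2.2.1, fun h' => h.2.2.2.2 h'.symm⟩
theorem Zv.ou {o x u v : U} (h : Zv T B o x u v) : ¬ cn T B o u := fun h' => h.2.1 ((hit_cn h').2 h.2.2.1)
theorem Zv.ux {o x u v : U} (h : Zv T B o x u v) : x ≠ u := by rintro rfl; exact h.ou h.1
theorem hit.mem {x : U} (h : hit T B x) : x ∈ B := by obtain ⟨g, h, _⟩ := h; exact h.left
theorem Zv.not_mem {o x u v : U} (h : Zv T B o x u v) : s(x, u) ∉ T := fun h' => h.ou (h.1.step h.2.2.1.mem h')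
def F2 (x u v : U) : Finset (Sym2 U) := {s(x, u), s(x, v)}
theorem mem_F2 {x u v : U} {e} : e ∈ F2 x u v ↔ e = s(x, u) ∨ e = s(x, v) := by simp [F2]
theorem F2_swap (x u v : U) : F2 x u v = F2 x v u := Finset.pair_comm _ _

theorem ins_a {o x u v x' u' v' : U} (hF : F2 x u v ⊆ T) (hd : Disjoint (F2 x u v) (F2 x' u' v'))
    (h1 : Zv (T \ F2 x u v) B o x u v) (h2 : Zv (T \ F2 x' u' v') B o x' u' v') : ¬ cn (T \ F2 x u v) B u x' := by
  intro hc
  have key : ∀ p q, ¬ cn (T \ F2 x u v) B p x' → cn (T \ F2 x u v) B p q → cn (T \ F2 x' u' v') B p q := fun p q hp hq =>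
    hq.agree fun a b ha hb hab hm => by
      refine mem_sdiff.2 ⟨(mem_sdiff.1 hm).1, fun hm' => hp ?_⟩
      have : x' ∈ s(a, b) := by rcases mem_F2.1 hm' with h | h <;> rw [h] <;> simp
      rcases Sym2.mem_iff.1 this with rfl | rfl
      exacts [ha, ha.step hb hm]
  have e1 : s(x, v) ∈ F2 x u v := mem_F2.2 (Or.inr rfl)
  have e2 : s(x, v) ∈ T \ F2 x' u' v' := mem_sdiff.2 ⟨hF e1, disjoint_left.1 hd e1⟩
  obtain ⟨g, hg, hgl⟩ := h1.2.2.2.1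
  have a1 := (key o x (fun h => h1.ou (h.trans hc.symm)) h1.1).step hg.left e2
  have a2 := a1.trans (key v g (fun h => h1.2.2.2.2 (hc.trans h.symm)) hg)
  refine h2.2.1 ⟨g, a2, mem_sdiff.2 ⟨(mem_sdiff.1 hgl).1, fun hm => ?_⟩⟩
  rcases mem_F2.1 hm with h | h
  · have := h2.ux; rw [Sym2.eq_iff] at h; rcases h with ⟨rfl, rfl⟩ | ⟨rfl, rfl⟩ <;> exact this rfl
  · have := h2.swap.ux; rw [Sym2.eq_iff] at h; rcases h with ⟨rfl, rfl⟩ | ⟨rfl, rfl⟩ <;> exact this rfl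
theorem ins_b {o x u v x' u' v' : U} (hF' : F2 x' u' v' ⊆ T) (hd : Disjoint (F2 x u v) (F2 x' u' v'))
    (h1 : Zv (T \ F2 x u v) B o x u v) (h2 : Zv (T \ F2 x' u' v') B o x' u' v') (hc : cn (T \ F2 x u v) B o x') :
    cn (T \ F2 x' u' v') B u' x := by
  have e1 : s(x', u') ∈ F2 x' u' v' := mem_F2.2 (Or.inl rfl)
  have hu : cn (T \ F2 x u v) B o u' := hc.step h2.2.2.1.mem (mem_sdiff.2 ⟨hF' e1, Finset.disjoint_right.1 hd e1⟩)
  obtain ⟨g, hg, hgl⟩ := h2.2.2.1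
  have hgK : g ∉ cl (T \ F2 x u v) B o := fun hm => by
    refine h1.2.1 ⟨g, mem_cl.1 hm, mem_sdiff.2 ⟨(mem_sdiff.1 hgl).1, fun hm => ?_⟩⟩
    rcases mem_F2.1 hm with h | h
    · have := h1.ux; rw [Sym2.eq_iff] at h; rcases h with ⟨rfl, rfl⟩ | ⟨rfl, rfl⟩ <;> exact this rfl
    · have := h1.swap.ux; rw [Sym2.eq_iff] at h; rcases h with ⟨rfl, rfl⟩ | ⟨rfl, rfl⟩ <;> exact this rfl
  obtain ⟨a, ha, b, hb, hab, h3, _⟩ := hg.last_exit (mem_cl.2 hu) hgK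
  rw [mem_sdiff] at hb hab
  have hm : s(a, b) ∈ F2 x u v := by
    by_contra hm
    exact hb.2 (mem_cl.2 ((mem_cl.1 ha).step hb.1 (mem_sdiff.2 ⟨hab.1, hm⟩)))
  have hbx : b ≠ x := by rintro rfl; exact hb.2 (mem_cl.2 h1.1)
  have : a = x := by
    rcases mem_F2.1 hm with h | h <;> rw [Sym2.eq_iff] at h <;> rcases h with ⟨h, _⟩ | ⟨_, h⟩
    exacts [h, absurd h hbx, h, absurd h hbx]
  exact this ▸ h3
theorem ins_unique {o x u v x' u' v' : U} (hF : F2 x u v ⊆ T) (hF' : F2 x' u' v' ⊆ T) (hd : Disjoint (F2 x u v) (F2 x' u' v'))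
    (h1 : Zv (T \ F2 x u v) B o x u v) (h2 : Zv (T \ F2 x' u' v') B o x' u' v') : False := by
  have h3 : cn T B o x' := h2.1.mono sdiff_subset subset_rfl
  have h4 : cn (T \ F2 x u v) B o x' ∨ cn (T \ F2 x u v) B u x' ∨ cn (T \ F2 x u v) B v x' := by
    refine h3.ind_on (p := fun y => cn (T \ F2 x u v) B o y ∨ cn (T \ F2 x u v) B u y ∨ cn (T \ F2 x u v) B v y)
      (Or.inl (cn_refl h3.left)) fun a b _ ih hb hab => ?_
    by_cases hm : s(a, b) ∈ F2 x u v
    · rcases mem_F2.1 hm with h | h <;> rw [Sym2.eq_iff] at h <;> rcases h with ⟨_, rfl⟩ | ⟨_, rfl⟩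
      exacts [Or.inr (Or.inl (cn_refl hb)), Or.inl h1.1, Or.inr (Or.inr (cn_refl hb)), Or.inl h1.1]
    · have := mem_sdiff.2 ⟨hab, hm⟩
      exact ih.imp (fun h => h.step hb this) (Or.imp (fun h => h.step hb this) fun h => h.step hb this)
  rcases h4 with h | h | h
  · have a1 := ins_b hF' hd h1 h2 h
    have a2 := ins_b (u' := v') (v' := u') (by rwa [F2_swap]) (by rwa [F2_swap x' v']) h1 (by rw [F2_swap]; exact h2.swap) h
    rw [F2_swap x' v'] at a2
    exact h2.2.2.2.2 (a1.trans a2.symm)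
  · exact ins_a hF hd h1 h2 h
  · refine ins_a (u := v) (v := u) (by rwa [F2_swap]) (by rwa [F2_swap x v]) (by rw [F2_swap]; exact h1.swap) h2 (by rwa [F2_swap x v])

theorem insertion (hr : ∀ e, 0 ≤ r e) (pu pv : U → U)
    (hd : ∀ x x', x ≠ x' → Disjoint (F2 x (pu x) (pv x)) (F2 x' (pu x') (pv x'))) (hne : ∀ x, pu x ≠ pv x) {q : ℝ}
    (hq : ∀ x, q ≤ (1 - Real.exp (-r s(x, pu x))) * (1 - Real.exp (-r s(x, pv x)))) (o : U) (X : Finset U) :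
    q * ∑ x ∈ X, Pr r B.sym2 (fun T => Zv T B o x (pu x) (pv x)) ≤ ph r B o := by
  have h1 : ∀ x ∈ X, q * Pr r B.sym2 (fun T => Zv T B o x (pu x) (pv x)) ≤
      Pr r B.sym2 (fun T => F2 x (pu x) (pv x) ⊆ T ∧ Zv (T \ F2 x (pu x) (pv x)) B o x (pu x) (pv x)) := by
    intro x _
    by_cases hB : x ∈ B ∧ pu x ∈ B ∧ pv x ∈ B
    · rw [Pr_indep (π := fun e => e ∈ F2 x (pu x) (pv x)) (A := fun T => F2 x (pu x) (pv x) ⊆ T)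
        (B := fun T => Zv (T \ F2 x (pu x) (pv x)) B o x (pu x) (pv x))]
      · refine mul_le_mul ?_ (Pr_mono hr fun T _ h => ?_) (Pr_nonneg hr _ _) (Pr_nonneg hr _ _)
        · refine (hq x).trans (le_of_eq ?_)
          rw [← Pr_mem (S := B.sym2) (mk_mem_sym2_iff.2 ⟨hB.1, hB.2.1⟩), ← Pr_mem (S := B.sym2) (mk_mem_sym2_iff.2 ⟨hB.1, hB.2.2⟩),
            ← Pr_indep (π := fun e => e = s(x, pu x)) (fun T T' h => propext (h _ rfl)) (fun T T' h => propext (h _ fun he => ?_))]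
          · exact Pr_congr fun T _ => by simp [F2, Finset.insert_subset_iff]
          · exact hne x (Sym2.congr_right.1 he).symm
        · have : T \ F2 x (pu x) (pv x) = T := by
            rw [Finset.sdiff_eq_self_iff_disjoint, Finset.disjoint_right]
            intro e he
            rcases mem_F2.1 he with rfl | rfl
            exacts [h.not_mem, h.swap.not_mem]
          rw [this]; exact h
      · intro T T' h; exact propext ⟨fun i e he => (h e he).1 (i he), fun i e he => (h e he).2 (i he)⟩
      · intro T T' h
        have : T \ F2 x (pu x) (pv x) = T' \ F2 x (pu x) (pv x) := by
          ext e; simp only [mem_sdiff]; exact ⟨fun i => ⟨(h e i.2).1 i.1, i.2⟩, fun i => ⟨(h e i.2).2 i.1, i.2⟩⟩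
        simp only [this]
    · rw [Pr_false fun T _ h => hB ⟨h.1.right, h.2.2.1.mem, h.2.2.2.1.mem⟩, mul_zero]; exact Pr_nonneg hr _ _
  rw [mul_sum]
  refine (sum_le_sum h1).trans ?_
  unfold Pr ph; rw [← Ex_sum]
  refine Ex_mono hr fun T _ => ind_disj X _ _ (fun x x' h h' => ?_) fun x h => ?_
  · by_contra hxx; exact ins_unique h.1 h'.1 (hd x x' hxx) h.2 h'.2
  · obtain ⟨g, hg, hg'⟩ := h.2.2.2.1
    exact ⟨g, (h.2.1.mono sdiff_subset subset_rfl |>.step hg.left (h.1 (mem_F2.2 (Or.inl rfl)))).trans (hg.mono sdiff_subset subset_rfl),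
      (mem_sdiff.1 hg').1⟩

theorem nohit (φ : Finset U → ℝ) (x : U) : Ex r B.sym2 (fun T => φ (cl T B x) * ind (¬ hit T B x)) =
    Ex r B.sym2 (fun T => φ (cl T B x) * Real.exp (-∑ y ∈ cl T B x, r s(y, y))) := by
  have h := Ex_cond (r := r) (S := B.sym2) B.powerset (fun T => cl T B x) (fun T _ => mem_powerset.2 (cl_sub _ _ _))
    (fun D T => φ D * ind (∀ y ∈ D, s(y, y) ∉ T)) (fun D _ => ⟨_, cl_dep B x, by
      intro T T' h
      have : (∀ y ∈ D, s(y, y) ∉ T) ↔ (∀ y ∈ D, s(y, y) ∉ T') := forall₂_congr fun y hy => by rw [h _ fun hh => hh.1.2 (by simp)]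
      simp only [this]⟩)
  rw [Ex_congr (g := fun T => φ (cl T B x) * ind (∀ y ∈ cl T B x, s(y, y) ∉ T)), h]
  · refine Ex_congr fun T _ => ?_
    rw [Ex_mul]; congr 1
    have := Pr_none (r := r) (S := B.sym2) (F := (cl T B x).image fun y => s(y, y)) (by
      intro e he; obtain ⟨y, hy, rfl⟩ := mem_image.1 he
      exact mk_mem_sym2_iff.2 ⟨cl_sub _ _ _ hy, cl_sub _ _ _ hy⟩)
    rw [Finset.sum_image fun a _ b _ h => by simpa using h] at this
    rw [← this]; exact Ex_congr fun T' _ => ind_congr (by simp)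
  · intro T _
    congr 1; refine ind_congr ?_
    rw [hit_cl]; push Not; rfl
end insertion

section green
open scoped Classical
variable {d : ℕ} {J : V d → V d → ℝ} {α c C : ℝ} {β h : ℝ} {B : Finset (V d)} {x : V d}
theorem nh (φ : Finset (V d) → ℝ) : Ex (Rt J β h) B.sym2 (fun T => φ (cl T B x) * ind (¬ hit T B x)) =
    Ex (Rt J β 0) B.sym2 (fun T => φ (cl T B x) * Real.exp (-(h * (cl T B x).card))) := by
  rw [nohit]
  simp only [Rt_loop, sum_const, nsmul_eq_mul]
  rw [Ex_dep_congr (π := inner B) (S' := B.sym2) (r' := Rt J β 0) _ (fun _ _ => Iff.rfl) fun e _ he => by simp [Rt, he.2]]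
  · exact Ex_congr fun T _ => by rw [mul_comm h]
  · intro T T' hT
    have : cl T B x = cl T' B x := by
      ext y; rw [mem_cl, mem_cl]; exact (cn_dep B x y T T' hT).to_iff
    simp only [this]
theorem ph_eq : ph (Rt J β h) B x = Ex (Rt J β 0) B.sym2 (fun T => 1 - Real.exp (-(h * (cl T B x).card))) := by
  have := nh (J := J) (β := β) (h := h) (B := B) (x := x) (fun _ => 1)
  simp only [one_mul] at this
  rw [Ex_sub, ← this, Ex_const]
  have h2 := Pr_not (Rt J β h) B.sym2 (fun T => hit T B x)
  unfold Pr at h2; rw [h2]; unfold ph Pr; ring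
noncomputable def Mp (J : V d → V d → ℝ) (β h : ℝ) (B : Finset (V d)) (x : V d) : ℝ :=
  Ex (Rt J β 0) B.sym2 (fun T => (cl T B x).card * Real.exp (-(h * (cl T B x).card)))
theorem Mp_eq : ∑ o ∈ B, Pr (Rt J β h) B.sym2 (fun T => cn T B x o ∧ ¬ hit T B x) = Mp J β h B x := by
  rw [Mp, ← nh (fun D => (D.card : ℝ))]
  unfold Pr; rw [← Ex_sum]
  refine Ex_congr fun T _ => ?_
  have := sum_cl (T := T) (B := B) (x := x) (fun _ => 1)
  rw [sum_const, nsmul_eq_mul, mul_one] at this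
  rw [this, sum_mul]
  exact sum_congr rfl fun o _ => by rw [ind_and, mul_one]
theorem Ex_card_le (hJ : KernelHyp d J α c C) (hβ : 0 ≤ β) {K : ℝ} (hK : Chi J β K) : Ex (Rt J β 0) B.sym2 (fun T => ((cl T B x).card : ℝ)) ≤ K := by
  have := Ex_card_cl (r := Rt J β 0) (B := B) (x := x) subset_rfl (fun _ => 1)
  simp only [sum_const, nsmul_eq_mul, mul_one] at this
  rw [this]; exact hK B x
theorem Mp_le (hJ : KernelHyp d J α c C) (hβ : 0 ≤ β) (hh : 0 ≤ h) {K : ℝ} (hK : Chi J β K) : Mp J β h B x ≤ K := by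
  refine le_trans (Ex_mono (Rt_nonneg hJ hβ le_rfl) fun T _ => ?_) (Ex_card_le (B := B) (x := x) hJ hβ hK)
  have : Real.exp (-(h * (cl T B x).card)) ≤ 1 := Real.exp_le_one_iff.2 (neg_nonpos.2 (by positivity))
  exact mul_le_of_le_one_right (by positivity) this
theorem Mp_nonneg (hJ : KernelHyp d J α c C) (hβ : 0 ≤ β) : 0 ≤ Mp J β h B x :=
  Ex_nonneg (Rt_nonneg hJ hβ le_rfl) fun T _ => by positivity
theorem ph_le_chi (hJ : KernelHyp d J α c C) (hβ : 0 ≤ β) (hh : 0 ≤ h) {K : ℝ} (hK : Chi J β K) : ph (Rt J β h) B x ≤ h * K := by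
  rw [ph_eq]
  refine le_trans (Ex_mono (Rt_nonneg hJ hβ le_rfl) (g := fun T => h * ((cl T B x).card : ℝ)) fun T _ => ?_) (by
    rw [Ex_mul]; exact mul_le_mul_of_nonneg_left (Ex_card_le hJ hβ hK) hh)
  linarith [Real.add_one_le_exp (-(h * ((cl T B x).card : ℝ)))]
theorem ph_two (hJ : KernelHyp d J α c C) (hβ : 0 ≤ β) (hh : 0 ≤ h) : ph (Rt J β (2 * h)) B x ≤ ph (Rt J β h) B x + h * Mp J β h B x := by
  rw [ph_eq, ph_eq, Mp, ← Ex_mul, ← Ex_add]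
  refine Ex_mono (Rt_nonneg hJ hβ le_rfl) fun T _ => ?_
  set t := h * ((cl T B x).card : ℝ) with ht
  have e : Real.exp (-(2 * h * ((cl T B x).card : ℝ))) = Real.exp (-t) * Real.exp (-t) := by rw [← Real.exp_add, ht]; congr 1; ring
  rw [e]
  have a1 := Real.add_one_le_exp (-t)
  have a2 := Real.exp_pos (-t)
  have : h * (((cl T B x).card : ℝ) * Real.exp (-t)) = t * Real.exp (-t) := by rw [ht]; ring
  rw [this]; nlinarith
theorem ph_dbl (hJ : KernelHyp d J α c C) (hβ : 0 ≤ β) (hh : 0 ≤ h) : ph (Rt J β (2 * h)) B x ≤ 2 * ph (Rt J β h) B x := by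
  rw [ph_eq, ph_eq, ← Ex_mul]
  refine Ex_mono (Rt_nonneg hJ hβ le_rfl) fun T _ => ?_
  have e : Real.exp (-(2 * h * ((cl T B x).card : ℝ))) = Real.exp (-(h * ((cl T B x).card : ℝ))) * Real.exp (-(h * ((cl T B x).card : ℝ))) := by
    rw [← Real.exp_add]; congr 1; ring
  rw [e]; nlinarith [sq_nonneg (1 - Real.exp (-(h * ((cl T B x).card : ℝ))))]
theorem min_le_ph (hJ : KernelHyp d J α c C) (hβ : 0 ≤ β) (hh : 0 ≤ h) :
    Ex (Rt J β 0) B.sym2 (fun T => min 1 (h * (cl T B x).card)) ≤ 2 * ph (Rt J β h) B x := by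
  rw [ph_eq, ← Ex_mul]
  refine Ex_mono (Rt_nonneg hJ hβ le_rfl) fun T _ => ?_
  set t := h * ((cl T B x).card : ℝ) with ht
  have t0 : 0 ≤ t := by positivity
  have a2 := Real.exp_pos (-t)
  have a3 : Real.exp (-t) * (1 + t) ≤ 1 := by
    have := mul_le_mul_of_nonneg_left (Real.add_one_le_exp t) a2.le
    rw [← Real.exp_add, neg_add_cancel, Real.exp_zero] at this; linarith
  rcases le_total t 1 with h1 | h1
  · rw [min_eq_right h1]; nlinarith
  · rw [min_eq_left h1]; nlinarith
theorem ph_tail (hJ : KernelHyp d J α c C) (hβ : 0 ≤ β) (hh : 0 ≤ h) (n : ℕ) :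
    Pr (Rt J β 0) B.sym2 (fun T => n ≤ (cl T B x).card) * (1 - Real.exp (-(h * n))) ≤ ph (Rt J β h) B x := by
  rw [ph_eq, mul_comm, Pr, ← Ex_mul]
  refine Ex_mono (Rt_nonneg hJ hβ le_rfl) fun T _ => ?_
  have key : ∀ a : ℝ, 0 ≤ a → 0 ≤ 1 - Real.exp (-a) := fun a ha => by linarith [Real.exp_le_one_iff.2 (neg_nonpos.2 ha)]
  by_cases hn : n ≤ (cl T B x).card
  · rw [ind_true hn, mul_one]
    have : (n : ℝ) ≤ (cl T B x).card := by exact_mod_cast hn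
    have := Real.exp_le_exp.2 (neg_le_neg (mul_le_mul_of_nonneg_left this hh))
    linarith
  · rw [ind_false hn, mul_zero]; exact key _ (by positivity)
theorem ph_hmono (hJ : KernelHyp d J α c C) (hβ : 0 ≤ β) (hh : 0 ≤ h) {h' : ℝ} (hl : h ≤ h') : ph (Rt J β h) B x ≤ ph (Rt J β h') B x :=
  Pr_rate_mono (Rt_nonneg hJ hβ hh) (Rt_mono hJ le_rfl hl) (hit_inc B x)
theorem ph_sh (hJ : KernelHyp d J α c C) (z : V d) : ph (Rt J β h) (B.map (sh z)) (x + z) = ph (Rt J β h) B x := by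
  unfold ph
  rw [← sh_apply, Pr_map (sh z) (Rt_sh hJ β h z)]
  refine Pr_congr fun T _ => ?_
  constructor
  · rintro ⟨g, hg, hg'⟩
    obtain ⟨e, he, he'⟩ := mem_map.1 hg'
    obtain ⟨a, _, rfl⟩ := mem_map.1 hg.right
    refine ⟨a, cn_map (sh z) |>.1 hg, ?_⟩
    have : (sh z).sym2Map e = (sh z).sym2Map s(a, a) := by rw [he']; rfl
    rwa [(sh z).sym2Map.injective this] at he
  · rintro ⟨g, hg, hg'⟩
    exact ⟨sh z g, (cn_map (sh z)).2 hg, mem_map.2 ⟨_, hg', rfl⟩⟩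
end green

section boot
open scoped Classical
theorem boot {G : ℝ → ℝ} {K C' : ℝ} (hC : 0 < C') (h0 : ∀ h, 0 < h → 0 < G h) (hK : ∀ h, 0 < h → G h ≤ h * K)
    (h2 : ∀ h, 0 < h → G (2 * h) ≤ 2 * G h) (h3 : ∀ h, 0 < h → 0.9 * G (2 * h) ≤ G h + h * (C' / G h)) {h : ℝ} (hh : 0 < h) :
    G h ^ 2 ≤ 20 * C' * h := by
  have step : ∀ h, 0 < h → G h ^ 2 ≤ 20 * C' * h → G (2 * h) ^ 2 ≤ 20 * C' * (2 * h) := by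
    intro h hh ih
    have p1 := h0 h hh; have p2 := h0 (2 * h) (by linarith)
    have b2 := h2 h hh; have b3 := h3 h hh
    rcases le_total (10 * C' * h) (G h ^ 2) with hc | hc
    · have : h * (C' / G h) ≤ G h / 10 := by
        rw [mul_div_assoc', div_le_div_iff₀ p1 (by norm_num)]; nlinarith
      have : G (2 * h) ≤ 1.1 / 0.9 * G h := by norm_num at b3 ⊢; linarith
      have : G (2 * h) ^ 2 ≤ (1.1 / 0.9 * G h) ^ 2 := by gcongr
      nlinarith
    · have : G (2 * h) ^ 2 ≤ (2 * G h) ^ 2 := by gcongr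
      nlinarith
  have it : ∀ n : ℕ, ∀ h, 0 < h → G h ^ 2 ≤ 20 * C' * h → G (2 ^ n * h) ^ 2 ≤ 20 * C' * (2 ^ n * h) := by
    intro n
    induction n with
    | zero => intro h _ ih; simpa using ih
    | succ n ih =>
      intro h hh hb
      have := step (2 ^ n * h) (by positivity) (ih h hh hb)
      rw [show (2:ℝ) ^ (n + 1) * h = 2 * (2 ^ n * h) by ring]; exact this
  obtain ⟨n, hn⟩ := pow_unbounded_of_one_lt (h * K ^ 2 / (20 * C')) (by norm_num : (1:ℝ) < 2)
  have hp : (0:ℝ) < 2 ^ n := by positivity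
  have := it n (h / 2 ^ n) (by positivity) (by
    have a1 := hK (h / 2 ^ n) (by positivity)
    have a2 := h0 (h / 2 ^ n) (by positivity)
    have a3 : G (h / 2 ^ n) ^ 2 ≤ (h / 2 ^ n * K) ^ 2 := by gcongr
    refine a3.trans ?_
    rw [div_lt_iff₀ (by positivity)] at hn
    have : (h / 2 ^ n * K) ^ 2 = (h * K ^ 2 / 2 ^ n) * (h / 2 ^ n) := by ring
    rw [this]
    refine mul_le_mul_of_nonneg_right ?_ (by positivity)
    rw [div_le_iff₀ hp]; linarith)
  rwa [mul_div_cancel₀ _ hp.ne'] at this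

variable {d : ℕ} {J : V d → V d → ℝ} {α c C : ℝ} {β h : ℝ}
theorem tri (hJ : KernelHyp d J α c C) (h3 : 3 * α < d) {A : ℝ} (hA : 0 < A) : ∃ L : ℝ, 0 < L ∧ ∀ τ : V d → V d → ℝ,
    (∀ x y, 0 ≤ τ x y) → (∀ x y, τ x y ≤ A * nn (x - y) ^ (-(d:ℝ) + α)) → ∀ (B X : Finset (V d)),
    (∀ u v, ∑ z ∈ B, ∑ w ∈ B, τ u w * τ w z * τ v z ≤ L * nn (u - v) ^ (-(d:ℝ) + 3 * α)) ∧
    (∀ w e, ∑ x ∈ X, ∑ z ∈ B, τ x w * τ w z * τ (x + e) z ≤ L * nn e ^ (-(d:ℝ) + 3 * α)) := by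
  have hα := hJ.alpha_pos
  obtain ⟨K1, hK1, c1⟩ := conv (d := d) hα hα (by linarith)
  obtain ⟨K2, hK2, c2⟩ := conv (d := d) (s := 2 * α) (t := α) (by linarith) hα (by linarith)
  have hp : ∀ z : V d, ∀ s : ℝ, 0 ≤ nn z ^ s := fun z s => Real.rpow_nonneg (nn_pos z).le s
  have x1 : -(d:ℝ) + α + α = -(d:ℝ) + 2 * α := by ring
  have x2 : -(d:ℝ) + 2 * α + α = -(d:ℝ) + 3 * α := by ring
  refine ⟨A * A * A * K1 * K2, by positivity, fun τ t0 t1 B X => ⟨fun u v => ?_, fun w e => ?_⟩⟩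
  · calc _ ≤ ∑ z ∈ B, (A * A * K1 * nn (u - z) ^ (-(d:ℝ) + 2 * α)) * (A * nn (z - v) ^ (-(d:ℝ) + α)) := by
          refine sum_le_sum fun z _ => ?_
          rw [← sum_mul]
          refine mul_le_mul ?_ (by rw [← nn_symm]; exact t1 v z) (t0 _ _) (by have := hp (u - z) (-(d:ℝ) + 2 * α); positivity)
          calc _ ≤ ∑ w ∈ B, A * A * (nn (u - w) ^ (-(d:ℝ) + α) * nn (w - z) ^ (-(d:ℝ) + α)) := sum_le_sum fun w _ => by
                refine (mul_le_mul (t1 u w) (t1 w z) (t0 _ _) (mul_nonneg hA.le (hp _ _))).trans (le_of_eq (by ring))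
            _ ≤ _ := by
                rw [← mul_sum, mul_assoc (A * A)]; refine mul_le_mul_of_nonneg_left ?_ (by positivity)
                rw [← x1]; exact c1 B u z
      _ = A * A * A * K1 * ∑ z ∈ B, nn (u - z) ^ (-(d:ℝ) + 2 * α) * nn (z - v) ^ (-(d:ℝ) + α) := by
          rw [mul_sum]; exact sum_congr rfl fun _ _ => by ring
      _ ≤ _ := by
          rw [mul_assoc (A * A * A * K1)]; refine mul_le_mul_of_nonneg_left ?_ (by positivity)
          rw [← x2]; exact c2 B u v
  · calc _ ≤ ∑ x ∈ X, (A * nn (x - w) ^ (-(d:ℝ) + α)) * (A * A * K1 * nn (w - (x + e)) ^ (-(d:ℝ) + 2 * α)) := by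
          refine sum_le_sum fun x _ => ?_
          simp_rw [mul_assoc (τ x w)]
          rw [← mul_sum]
          refine mul_le_mul (t1 x w) ?_ (sum_nonneg fun _ _ => mul_nonneg (t0 _ _) (t0 _ _)) (mul_nonneg hA.le (hp _ _))
          calc _ ≤ ∑ z ∈ B, A * A * (nn (w - z) ^ (-(d:ℝ) + α) * nn (z - (x + e)) ^ (-(d:ℝ) + α)) := sum_le_sum fun z _ => by
                refine (mul_le_mul (t1 w z) (t1 (x + e) z) (t0 _ _) (mul_nonneg hA.le (hp _ _))).trans (le_of_eq ?_)
                rw [nn_symm (x + e) z]; ring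
            _ ≤ _ := by
                rw [← mul_sum, mul_assoc (A * A)]; refine mul_le_mul_of_nonneg_left ?_ (by positivity)
                rw [← x1]; exact c1 B w (x + e)
      _ = A * A * A * K1 * ∑ x ∈ X, nn ((w - e) - x) ^ (-(d:ℝ) + 2 * α) * nn (x - w) ^ (-(d:ℝ) + α) := by
          rw [mul_sum]; exact sum_congr rfl fun x _ => by
            rw [show w - (x + e) = (w - e) - x by abel]; ring
      _ ≤ _ := by
          rw [mul_assoc (A * A * A * K1)]; refine mul_le_mul_of_nonneg_left ?_ (by positivity)
          have := c2 X (w - e) w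
          rw [x2, nn_symm, show w - (w - e) = e by abel] at this; exact this

theorem avg_ins (hJ : KernelHyp d J α c C) (hβ : 0 ≤ β) (hh : 0 ≤ h) {M q : ℝ} (hM0 : 0 < M) (hM : ∀ B x, ph (Rt J β h) B x ≤ M) {B X : Finset (V d)} {e : V d}
    (ht1 : ∀ (B' : Finset (V d)) (x : V d), ∑ z ∈ B', ∑ w ∈ B', tt J β B' (x + e) w * tt J β B' w z * tt J β B' (x + (e + e)) z ≤ 1 / 16)
    (ht2 : ∀ w, ∑ x ∈ X, ∑ z ∈ B, tt J β B x w * tt J β B w z * tt J β B (x + e) z ≤ 1 / 16)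
    (ht3 : ∀ w, ∑ x ∈ X, ∑ z ∈ B, tt J β B x w * tt J β B w z * tt J β B (x + (e + e)) z ≤ 1 / 16) (he : e ≠ 0) (hq0 : 0 < q)
    (hq : ∀ x : V d, q ≤ (1 - Real.exp (-Rt J β h s(x, x + e))) * (1 - Real.exp (-Rt J β h s(x, x + (e + e)))))
    (hX : ∀ x ∈ X, 0.9 * M ≤ ph (Rt J β h) B (x + e) ∧ 0.9 * M ≤ ph (Rt J β h) B (x + (e + e))) :
    q * M * ((0.81 - 1 / 16) * ∑ x ∈ X, Mp J β h B x - 1 / 8 * ∑ w ∈ B, Mp J β h B w) ≤ B.card := by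
  have hr := Rt_nonneg hJ hβ hh
  obtain ⟨i, hi⟩ : ∃ i, e i ≠ 0 := by by_contra hc; push Not at hc; exact he (funext hc)
  have hins : ∀ o ∈ B, q * ∑ x ∈ X, Pr (Rt J β h) B.sym2 (fun T => Zv T B o x (x + e) (x + (e + e))) ≤ M := fun o _ =>
    (insertion hr (fun x => x + e) (fun x => x + (e + e)) (fun x x' hx => by
      rw [disjoint_left]; intro s hs hs'
      rw [mem_F2] at hs hs'
      rcases hs with rfl | rfl <;> rcases hs' with h' | h' <;> rw [Sym2.eq_iff] at h' <;> rcases h' with ⟨h1, h2⟩ | ⟨h1, h2⟩ <;>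
        first
        | exact hx h1
        | (have h1 := congrFun h1 i; have h2 := congrFun h2 i; simp only [Pi.add_apply] at h1 h2; omega))
      (fun x hx => by have := congrFun hx i; simp only [Pi.add_apply] at this; omega) hq o X).trans (hM B o)
  set p : V d → V d → ℝ := fun o x => Pr (Rt J β h) B.sym2 (fun T => cn T B o x ∧ ¬ hit T B o) with hp
  have hpc : ∀ o x, p o x = p x o := fun o x => Pr_congr fun T _ =>
    ⟨fun h => ⟨h.1.symm, by rw [← hit_cn h.1]; exact h.2⟩, fun h => ⟨h.1.symm, by rw [← hit_cn h.1]; exact h.2⟩⟩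
  have hmp : ∀ x, ∑ o ∈ B, p x o = Mp J β h B x := fun x => Mp_eq
  set w4 : V d → V d → ℝ := fun x z => tt J β B (x + e) z + tt J β B (x + (e + e)) z with hw4
  have n0 : ∀ x y, 0 ≤ tt J β B x y := fun x y => tt_nonneg hJ hβ
  have w40 : ∀ x z, 0 ≤ w4 x z := fun x z => add_nonneg (n0 _ _) (n0 _ _)
  have key : ∀ o, ∀ x ∈ X, M ^ 2 * ((0.81 - 1 / 16) * p o x - ∑ z ∈ B, w4 x z * ∑ w ∈ B, tt J β B x w * tt J β B w z * p w o) ≤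
      Pr (Rt J β h) B.sym2 (fun T => Zv T B o x (x + e) (x + (e + e))) := by
    intro o x hx
    have h1 := c3 (B := B) (o := o) (x := x) (u := x + e) (v := x + (e + e)) (t := 1 / 16) hr hM0.le hM (by simpa only [tt_eq] using fun B' => ht1 B' x)
    simp only [tt_eq] at h1
    refine le_trans ?_ h1
    obtain ⟨b1, b2⟩ := hX x hx
    have b3 : 0.9 * M * (0.9 * M) ≤ ph (Rt J β h) B (x + e) * ph (Rt J β h) B (x + (e + e)) := mul_le_mul b1 b2 (by positivity) (by linarith [mul_pos (by norm_num : (0:ℝ) < 0.9) hM0])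
    have b4 : ∑ z ∈ B, w4 x z * Pr (Rt J β h) B.sym2 (fun T => cn T B o x ∧ cn T B o z ∧ ¬ hit T B o) ≤
        ∑ z ∈ B, w4 x z * ∑ w ∈ B, tt J β B x w * tt J β B w z * p w o := sum_le_sum fun z _ => by
      refine mul_le_mul_of_nonneg_left ?_ (w40 x z)
      have := c4 (B := B) hr o x z
      simpa only [tt_eq] using this
    have b5 : 0 ≤ p o x := Pr_nonneg hr _ _
    have b6 := mul_le_mul_of_nonneg_left b4 (sq_nonneg M)
    have b7 := mul_le_mul_of_nonneg_right b3 b5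
    simp only [hw4, hp] at *
    nlinarith
  have s2 : ∑ o ∈ B, ∑ x ∈ X, ∑ z ∈ B, w4 x z * ∑ w ∈ B, tt J β B x w * tt J β B w z * p w o ≤ 1 / 8 * ∑ w ∈ B, Mp J β h B w := by
    calc _ = ∑ w ∈ B, ∑ o ∈ B, ∑ x ∈ X, ∑ z ∈ B, w4 x z * (tt J β B x w * tt J β B w z * p w o) := by
          rw [sum_comm (s := B) (t := B) (f := fun w o => ∑ x ∈ X, ∑ z ∈ B, w4 x z * (tt J β B x w * tt J β B w z * p w o))]
          refine sum_congr rfl fun o _ => ?_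
          rw [sum_comm (s := B) (t := X) (f := fun w x => ∑ z ∈ B, w4 x z * (tt J β B x w * tt J β B w z * p w o))]
          refine sum_congr rfl fun x _ => ?_
          rw [sum_comm (s := B) (t := B) (f := fun w z => w4 x z * (tt J β B x w * tt J β B w z * p w o))]
          exact sum_congr rfl fun z _ => mul_sum _ _ _
      _ ≤ ∑ w ∈ B, 1 / 8 * Mp J β h B w := sum_le_sum fun w _ => by
          rw [← hmp w, mul_sum]
          refine sum_le_sum fun o _ => ?_
          have a1 := ht2 w; have a2 := ht3 w
          have : ∑ x ∈ X, ∑ z ∈ B, w4 x z * (tt J β B x w * tt J β B w z * p w o) =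
              (∑ x ∈ X, ∑ z ∈ B, tt J β B x w * tt J β B w z * tt J β B (x + e) z + ∑ x ∈ X, ∑ z ∈ B, tt J β B x w * tt J β B w z * tt J β B (x + (e + e)) z) * p w o := by
            rw [← sum_add_distrib, sum_mul]
            refine sum_congr rfl fun x _ => ?_
            rw [← sum_add_distrib, sum_mul]
            exact sum_congr rfl fun z _ => by simp only [hw4]; ring
          rw [this]
          exact mul_le_mul_of_nonneg_right (by linarith) (Pr_nonneg hr _ _)
      _ = _ := by rw [← mul_sum]
  have s1 : ∑ o ∈ B, ∑ x ∈ X, p o x = ∑ x ∈ X, Mp J β h B x := by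
    rw [sum_comm]; refine sum_congr rfl fun x _ => ?_
    rw [← hmp x]; exact sum_congr rfl fun o _ => hpc o x
  have f1 : ∑ o ∈ B, q * ∑ x ∈ X, M ^ 2 * ((0.81 - 1 / 16) * p o x - ∑ z ∈ B, w4 x z * ∑ w ∈ B, tt J β B x w * tt J β B w z * p w o) ≤ B.card * M := by
    refine (sum_le_sum fun o ho => (mul_le_mul_of_nonneg_left (sum_le_sum fun x hx => key o x hx) hq0.le).trans (hins o ho)).trans ?_
    rw [sum_const, nsmul_eq_mul]
  simp only [← mul_sum, Finset.sum_sub_distrib] at f1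
  rw [s1] at f1
  have f2 : q * (M ^ 2 * ((0.81 - 1 / 16) * ∑ x ∈ X, Mp J β h B x - 1 / 8 * ∑ w ∈ B, Mp J β h B w)) ≤ B.card * M :=
    le_trans (mul_le_mul_of_nonneg_left (mul_le_mul_of_nonneg_left (sub_le_sub_left s2 _) (sq_nonneg M)) hq0.le) f1
  refine le_of_mul_le_mul_right (le_trans (le_of_eq ?_) f2) hM0
  ring
end boot

section magn
open scoped Classical
variable {d : ℕ} {J : V d → V d → ℝ} {α c C : ℝ} {β h : ℝ}
noncomputable def Ms (J : V d → V d → ℝ) (β h : ℝ) : ℝ := ⨆ p : Finset (V d) × V d, ph (Rt J β h) p.1 p.2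
theorem le_Ms (hJ : KernelHyp d J α c C) (hβ : 0 ≤ β) (hh : 0 ≤ h) (B : Finset (V d)) (x : V d) : ph (Rt J β h) B x ≤ Ms J β h :=
  le_ciSup (f := fun p : Finset (V d) × V d => ph (Rt J β h) p.1 p.2) ⟨1, by rintro _ ⟨p, rfl⟩; exact Pr_le_one (Rt_nonneg hJ hβ hh) _ _⟩ (B, x)
theorem Ms_le {a : ℝ} (ha : ∀ B x, ph (Rt J β h) B x ≤ a) : Ms J β h ≤ a := ciSup_le fun p => ha p.1 p.2
theorem Ms_nonneg (hJ : KernelHyp d J α c C) (hβ : 0 ≤ β) (hh : 0 ≤ h) : 0 ≤ Ms J β h :=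
  (ph_nonneg (Rt_nonneg hJ hβ hh) (B := ∅) 0).trans (le_Ms hJ hβ hh ∅ 0)
theorem Ms_pos (hJ : KernelHyp d J α c C) (hβ : 0 ≤ β) (hh : 0 < h) : 0 < Ms J β h := by
  refine lt_of_lt_of_le ?_ (le_Ms hJ hβ hh.le {0} 0)
  have hm : s((0 : V d), 0) ∈ ({0} : Finset (V d)).sym2 := mk_mem_sym2_iff.2 (by simp)
  have h1 := Pr_mem (r := Rt J β h) hm
  rw [Rt_loop] at h1
  refine lt_of_lt_of_le ?_ (Pr_mono (Rt_nonneg hJ hβ hh.le) (A := fun T => s((0 : V d), 0) ∈ T) fun T _ hT => ⟨0, cn_refl (by simp), hT⟩)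
  rw [h1]; linarith [(fun a (ha : a < 0) => Real.exp_zero ▸ Real.exp_lt_exp.2 ha : ∀ a : ℝ, a < 0 → Real.exp a < 1) _ (neg_lt_zero.2 hh)]
theorem near (hJ : KernelHyp d J α c C) (hβ : 0 ≤ β) (hh : 0 ≤ h) {a : ℝ} (ha : a < Ms J β h) :
    ∃ k : ℕ, ∀ (x : V d) (B : Finset (V d)), (∀ y, normInf y ≤ k → y + x ∈ B) → a ≤ ph (Rt J β h) B x := by
  obtain ⟨⟨B, x⟩, hp⟩ := exists_lt_of_lt_ciSup ha
  obtain ⟨k, hk⟩ := sub_bx (B.map (sh (-x)))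
  refine ⟨k, fun y B' hB' => hp.le.trans ?_⟩
  have := ph_sh (J := J) (β := β) (h := h) (B := B) (x := x) hJ (-x + y)
  rw [show x + (-x + y) = y by abel] at this
  dsimp only; rw [← this]
  refine ph_mono (Rt_nonneg hJ hβ hh) (fun z hz => ?_) y
  obtain ⟨b, hb, rfl⟩ := mem_map.1 hz
  have := hB' (b + -x) (mem_bx.1 (hk (mem_map.2 ⟨b, hb, rfl⟩)))
  rw [sh_apply, ← add_assoc]; exact this
theorem box_ratio (k : ℕ) {η : ℝ} (hη : 0 < η) : ∃ m : ℕ, ((bx d (m + k)).card : ℝ) ≤ (1 + η) * (bx d m).card := by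
  have h1 : Filter.Tendsto (fun m : ℕ => (1 + 2 * (k:ℝ) / (2 * (m:ℝ) + 1)) ^ d) Filter.atTop (nhds ((1 + 0) ^ d)) := by
    refine (Filter.Tendsto.const_add 1 (Filter.Tendsto.const_div_atTop ?_ _)).pow d
    exact Filter.tendsto_atTop_add_const_right _ _ ((tendsto_natCast_atTop_atTop (R := ℝ)).const_mul_atTop (by norm_num))
  obtain ⟨m, hm⟩ := (h1.eventually (gt_mem_nhds (show ((1:ℝ) + 0) ^ d < 1 + η by simpa using hη))).exists
  refine ⟨m, ?_⟩
  rw [card_bx, card_bx]; push_cast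
  have hp : (0:ℝ) < 2 * m + 1 := by positivity
  have : (2 * ((m:ℝ) + k) + 1) = (1 + 2 * (k:ℝ) / (2 * (m:ℝ) + 1)) * (2 * m + 1) := by field_simp; ring
  rw [this, mul_pow]
  exact mul_le_mul_of_nonneg_right hm.le (by positivity)

theorem step (hJ : KernelHyp d J α c C) (hβ : 0 ≤ β) (hh : 0 < h) {q K : ℝ} {e : V d} (hK0 : 0 < K) (hK : Chi J β K)
    (ht1 : ∀ (B' : Finset (V d)) (x : V d), ∑ z ∈ B', ∑ w ∈ B', tt J β B' (x + e) w * tt J β B' w z * tt J β B' (x + (e + e)) z ≤ 1 / 16)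
    (ht2 : ∀ (B X : Finset (V d)) w, ∑ x ∈ X, ∑ z ∈ B, tt J β B x w * tt J β B w z * tt J β B (x + e) z ≤ 1 / 16)
    (ht3 : ∀ (B X : Finset (V d)) w, ∑ x ∈ X, ∑ z ∈ B, tt J β B x w * tt J β B w z * tt J β B (x + (e + e)) z ≤ 1 / 16) (he : e ≠ 0) (hq0 : 0 < q)
    (hq : ∀ x : V d, q ≤ (1 - Real.exp (-Rt J β h s(x, x + e))) * (1 - Real.exp (-Rt J β h s(x, x + (e + e))))) :
    0.9 * Ms J β (2 * h) ≤ Ms J β h + h * ((4 / q) / Ms J β h) := by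
  have hM := Ms_pos hJ hβ hh
  have hM2 := Ms_pos hJ hβ (show 0 < 2 * h by linarith)
  obtain ⟨k1, hk1⟩ := near hJ hβ hh.le (show 0.9 * Ms J β h < Ms J β h by norm_num; linarith)
  obtain ⟨k2, hk2⟩ := near hJ hβ (show 0 ≤ 2 * h by linarith) (show 0.9 * Ms J β (2 * h) < Ms J β (2 * h) by norm_num; linarith)
  set M := Ms J β h with hMd
  have hηp : 0 < min 1 (1 / (K * M * q)) := lt_min one_pos (by positivity)
  obtain ⟨m, hm⟩ := box_ratio (d := d) (max k1 k2 + 2 * normInf e) hηp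
  set B := bx d (m + (max k1 k2 + 2 * normInf e)) with hB
  have hin : ∀ k ≤ max k1 k2, ∀ x ∈ bx d m, ∀ f : V d, normInf f ≤ 2 * normInf e → ∀ y, normInf y ≤ k → y + (x + f) ∈ B := by
    intro k hk x hx f hf y hy
    have a1 := normInf_add y (x + f); have a2 := normInf_add x f; have a3 := mem_bx.1 hx
    exact mem_bx.2 (by omega)
  have hee := normInf_add e e
  have ex : ∃ x ∈ bx d m, Mp J β h B x < 4 / q / M := by
    by_contra hc; push Not at hc
    have h1 := avg_ins hJ hβ hh.le hM (le_Ms hJ hβ hh.le) (B := B) (X := bx d m) ht1 (ht2 _ _) (ht3 _ _) he hq0 hq (fun x hx =>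
      ⟨hk1 _ _ (hin k1 (le_max_left _ _) x hx e (by omega)), hk1 _ _ (hin k1 (le_max_left _ _) x hx (e + e) (by omega))⟩)
    have hsub : bx d m ⊆ B := bx_mono (by omega)
    rw [← Finset.sum_sdiff hsub] at h1
    have h2 : ∑ w ∈ B \ bx d m, Mp J β h B w ≤ min 1 (1 / (K * M * q)) * (bx d m).card * K := by
      refine (sum_le_sum fun w _ => Mp_le hJ hβ hh.le hK).trans ?_
      rw [sum_const, nsmul_eq_mul]
      refine mul_le_mul_of_nonneg_right ?_ hK0.le
      rw [Finset.card_sdiff_of_subset hsub, Nat.cast_sub (card_le_card hsub)]; linarith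
    have hX : (0:ℝ) < (bx d m).card := by exact_mod_cast card_pos.2 ⟨0, zero_mem_bx m⟩
    have h3 : (bx d m).card * (4 / q / M) ≤ ∑ x ∈ bx d m, Mp J β h B x := by
      rw [← nsmul_eq_mul, ← sum_const]; exact sum_le_sum hc
    set S := ∑ x ∈ bx d m, Mp J β h B x
    set S' := ∑ w ∈ B \ bx d m, Mp J β h B w
    set X : ℝ := ((bx d m).card : ℝ)
    have h4 : q * M * S' ≤ X := by
      have : min 1 (1 / (K * M * q)) * X * K ≤ 1 / (K * M * q) * X * K := by gcongr; exact min_le_right _ _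
      calc q * M * S' ≤ q * M * (1 / (K * M * q) * X * K) := mul_le_mul_of_nonneg_left (h2.trans this) (by positivity)
        _ = X := by field_simp
    have h5 : 4 * X ≤ q * M * S := by
      calc 4 * X = q * M * (X * (4 / q / M)) := by field_simp
        _ ≤ _ := mul_le_mul_of_nonneg_left h3 (by positivity)
    have h6 : (B.card : ℝ) ≤ 2 * X := hm.trans (by have := min_le_left 1 (1 / (K * M * q)); nlinarith)
    norm_num at h1
    nlinarith
  obtain ⟨x, hx, hlt⟩ := ex
  have a1 := hk2 x B (by simpa using hin k2 (le_max_right _ _) x hx 0 (by simp [normInf_zero]))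
  have a2 := ph_two (B := B) (x := x) hJ hβ hh.le
  have a3 := le_Ms hJ hβ hh.le B x
  have a4 := mul_le_mul_of_nonneg_left hlt.le hh.le
  linarith

theorem sqrt_bound (hJ : KernelHyp d J α c C) (hα : α < 1) (h3 : 3 * α < d) {β₀ β₁ : ℝ} (hβ₀ : 0 < β₀) (h01 : β₀ ≤ β₁) :
    ∃ D : ℝ, 0 < D ∧ ∀ β, β₀ ≤ β → β ≤ β₁ → (∃ K, 0 < K ∧ Chi J β K) → ∀ h, 0 < h → Ms J β h ≤ D * √h := by
  obtain ⟨A, hA, htp⟩ := two_point hJ hα hβ₀ h01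
  obtain ⟨L, hL, htri⟩ := tri hJ h3 hA
  have hd := hJ.d_pos
  have hlim : Filter.Tendsto (fun n : ℕ => L * (n:ℝ) ^ (-((d:ℝ) - 3 * α))) Filter.atTop (nhds (L * 0)) :=
    ((tendsto_rpow_neg_atTop (by linarith : 0 < (d:ℝ) - 3 * α)).comp tendsto_natCast_atTop_atTop).const_mul L
  obtain ⟨N, hN, hN1⟩ := ((hlim.eventually (gt_mem_nhds (show L * 0 < 1 / 16 by norm_num))).and (Filter.eventually_ge_atTop 1)).exists
  set e : V d := fun _ => (N:ℤ) with he
  have hNe : normInf e = N := by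
    have : (Finset.univ : Finset (Fin d)).Nonempty := ⟨⟨0, by omega⟩, mem_univ _⟩
    simp only [normInf, he, Int.natAbs_natCast]; exact Finset.sup_const this _
  have hNee : normInf (e + e) = 2 * N := by
    have : (Finset.univ : Finset (Fin d)).Nonempty := ⟨⟨0, by omega⟩, mem_univ _⟩
    simp only [normInf, he, Pi.add_apply, ← Nat.cast_add, Int.natAbs_natCast]; rw [Finset.sup_const this]; omega
  have he0 : e ≠ 0 := by rintro h; rw [h, normInf_zero] at hNe; omega
  have hee0 : e + e ≠ 0 := by rintro h; rw [h, normInf_zero] at hNee; omega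
  have b1 : L * nn e ^ (-(d:ℝ) + 3 * α) ≤ 1 / 16 := by
    rw [nn_eq (by omega), hNe, show -(d:ℝ) + 3 * α = -((d:ℝ) - 3 * α) by ring]; exact hN.le
  have b2 : L * nn (e + e) ^ (-(d:ℝ) + 3 * α) ≤ 1 / 16 := by
    refine le_trans (mul_le_mul_of_nonneg_left ?_ hL.le) b1
    refine Real.rpow_le_rpow_of_nonpos (nn_pos e) ?_ (by linarith)
    rw [nn_eq (by omega), nn_eq (by omega), hNe, hNee]; push_cast; linarith [Nat.cast_nonneg (α := ℝ) N]
  have Jp : ∀ f : V d, f ≠ 0 → 0 < J 0 f := fun f hf => by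
    refine lt_of_lt_of_le ?_ (hJ.lower 0 f hf.symm)
    have : 1 ≤ normInf (0 - f) := normInf_pos (by simpa using hf)
    have : (0:ℝ) < normInf (0 - f) := by exact_mod_cast this
    have := hJ.c_pos; positivity
  set q : ℝ := (1 - Real.exp (-(β₀ * J 0 e))) * (1 - Real.exp (-(β₀ * J 0 (e + e)))) with hq
  have q1 : ∀ f : V d, f ≠ 0 → 0 < 1 - Real.exp (-(β₀ * J 0 f)) := fun f hf => by
    have := Jp f hf; linarith [(fun a (ha : a < 0) => Real.exp_zero ▸ Real.exp_lt_exp.2 ha : ∀ a : ℝ, a < 0 → Real.exp a < 1) _ (neg_lt_zero.2 (mul_pos hβ₀ this))]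
  have hq0 : 0 < q := mul_pos (q1 e he0) (q1 _ hee0)
  refine ⟨√(20 * (4 / q)), by positivity, fun β h0 h1 ⟨K, hK0, hK⟩ h hh => ?_⟩
  have hβ : 0 ≤ β := hβ₀.le.trans h0
  have T := fun B X => htri (fun x y => tt J β B x y) (fun x y => tt_nonneg hJ hβ) (htp β h0 h1 ⟨K, hK⟩ B) B X
  have hqx : ∀ h (x : V d), q ≤ (1 - Real.exp (-Rt J β h s(x, x + e))) * (1 - Real.exp (-Rt J β h s(x, x + (e + e)))) := by
    intro h x
    have r1 : ∀ f : V d, f ≠ 0 → 1 - Real.exp (-(β₀ * J 0 f)) ≤ 1 - Real.exp (-Rt J β h s(x, x + f)) := fun f hf => by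
      rw [Rt_mk hJ β h (by simpa using hf), show J x (x + f) = J 0 f by have := hJ.transInv 0 f x; rwa [zero_add, add_comm f] at this]
      have := mul_le_mul_of_nonneg_right h0 (Jp f hf).le
      linarith [Real.exp_le_exp.2 (neg_le_neg this)]
    exact mul_le_mul (r1 e he0) (r1 _ hee0) (q1 _ hee0).le ((q1 e he0).le.trans (r1 e he0))
  have := boot (G := Ms J β) (K := K) (C' := 4 / q) (by positivity) (fun h hh => Ms_pos hJ hβ hh)
    (fun h hh => Ms_le fun B x => ph_le_chi hJ hβ hh.le hK)
    (fun h hh => Ms_le fun B x => (ph_dbl hJ hβ hh.le).trans (mul_le_mul_of_nonneg_left (le_Ms hJ hβ hh.le B x) (by norm_num)))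
    (fun h hh => step (e := e) hJ hβ hh hK0 hK (fun B' x => ((T B' B').1 _ _).trans (by
      rw [nn_symm, show x + (e + e) - (x + e) = e by abel]; exact b1)) (fun B X w => ((T B X).2 w e).trans b1)
      (fun B X w => ((T B X).2 w (e + e)).trans b2) he0 hq0 (hqx h)) hh
  rw [← Real.sqrt_mul (by positivity)]
  exact Real.le_sqrt_of_sq_le this
end magn

section final
open scoped Classical
variable {d : ℕ} {J : V d → V d → ℝ} {α c C : ℝ} {β h : ℝ}
theorem sprinkle (hJ : KernelHyp d J α c C) (hβ : 0 ≤ β) (hh : 0 ≤ h) {δ : ℝ} (hδ : 0 ≤ δ) (B : Finset (V d)) (x : V d) :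
    ph (Rt J (β + δ) h) B x ≤ ph (Rt J β h) B x + Ex (Rt J β 0) B.sym2 (fun T => min 1 (δ * jt J * Ms J (β + δ) h * (cl T B x).card)) := by
  set m := Ms J (β + δ) h with hm
  have hr := Rt_nonneg hJ hβ hh
  have hr' := Rt_nonneg hJ hδ (le_refl (0:ℝ))
  have hadd : Rt J (β + δ) h = fun e => Rt J β h e + Rt J δ 0 e := by rw [← Rt_add, add_zero]
  have m0 : 0 ≤ m := Ms_nonneg hJ (by linarith) hh
  set Q : Finset (V d) → V d → V d → Finset (Sym2 (V d)) → Finset (Sym2 (V d)) → Prop := fun D a b T T' => s(a, b) ∈ T' ∧ hit (T ∪ T') (B \ D) b with hQ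
  set F : Finset (V d) → Finset (Sym2 (V d)) → ℝ := fun D T => Ex (Rt J δ 0) B.sym2 (fun T' => ind (∃ a ∈ D, ∃ b ∈ B \ D, Q D a b T T')) with hF
  have hQd : ∀ D T T2, (∀ e, e ∈ (B \ D).sym2 → (e ∈ T ↔ e ∈ T2)) → F D T = F D T2 := by
    intro D T T2 hT
    refine Ex_congr fun T' _ => ?_
    have : ∀ b, hit (T ∪ T') (B \ D) b = hit (T2 ∪ T') (B \ D) b := fun b =>
      hit_dep (B \ D) b _ _ fun e he => by simp only [mem_union, hT e he]
    simp only [hQ, this]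
  have hFle : ∀ D ⊆ B, Ex (Rt J β h) B.sym2 (F D) ≤ min 1 (δ * jt J * m * D.card) := by
    intro D hD
    refine le_min ?_ ?_
    · calc _ ≤ Ex (Rt J β h) B.sym2 (fun _ => (1:ℝ)) := Ex_mono hr fun T _ => Pr_le_one hr' _ _
        _ = 1 := Ex_const _ _ _
    · have q1 : ∀ T, F D T ≤ ∑ a ∈ D, ∑ b ∈ B \ D, δ * J a b * Ex (Rt J δ 0) B.sym2 (fun T' => ind (hit (T ∪ T') (B \ D) b)) := by
        intro T
        refine (Pr_exists_le hr' B.sym2 D (fun a T' => ∃ b ∈ B \ D, Q D a b T T') _ fun T' _ h => h).trans (sum_le_sum fun a ha => ?_)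
        refine (Pr_exists_le hr' B.sym2 (B \ D) (fun b T' => Q D a b T T') _ fun T' _ h => h).trans (sum_le_sum fun b hb => ?_)
        have hab : a ≠ b := by rintro rfl; exact (mem_sdiff.1 hb).2 ha
        rw [hQ, Pr_indep (π := fun e => e = s(a, b)) (A := fun T' => s(a, b) ∈ T') (B := fun T' => hit (T ∪ T') (B \ D) b)
          (fun T1 T2 h => propext (h _ rfl)) (fun T1 T2 h => hit_dep (B \ D) b _ _ fun e he => by
            rw [mem_union, mem_union, h e fun hh => sdiff_not_touch he (hh ▸ touch_left ha)])]
        refine mul_le_mul_of_nonneg_right ((Pr_mem_le hr').trans (le_of_eq (Rt_mk hJ δ 0 hab))) (Pr_nonneg hr' _ _)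
      refine (Ex_mono hr fun T _ => q1 T).trans ?_
      rw [Ex_sum]; simp_rw [Ex_sum, Ex_mul]
      have q2 : ∀ b, Ex (Rt J β h) B.sym2 (fun T => Ex (Rt J δ 0) B.sym2 (fun T' => ind (hit (T ∪ T') (B \ D) b))) ≤ m := fun b => by
        rw [← Ex_sprinkle (Rt J β h) (Rt J δ 0) B.sym2 (fun T => ind (hit T (B \ D) b)), ← hadd]
        exact (Pr_hit (sym2_mono sdiff_subset) b).le.trans (le_Ms hJ (by linarith) hh _ _)
      calc _ ≤ ∑ a ∈ D, ∑ b ∈ B \ D, δ * m * J a b := sum_le_sum fun a _ => sum_le_sum fun b _ => by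
            have := mul_le_mul_of_nonneg_left (q2 b) (mul_nonneg hδ (hJ.nonneg a b)); linarith
        _ ≤ ∑ a ∈ D, δ * m * jt J := sum_le_sum fun a _ => by
            rw [← mul_sum]; exact mul_le_mul_of_nonneg_left (sum_J_le hJ a _) (mul_nonneg hδ m0)
        _ = _ := by rw [sum_const, nsmul_eq_mul]; ring
  have main : ph (Rt J (β + δ) h) B x ≤ ph (Rt J β h) B x + Ex (Rt J β h) B.sym2 (fun T => F (cl T B x) T) := by
    unfold ph Pr; rw [hadd, Ex_sprinkle, ← Ex_add]
    refine Ex_mono hr fun T hT => ?_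
    have z : Pr (Rt J δ 0) B.sym2 (fun T' => ∃ g ∈ B, s(g, g) ∈ T') ≤ 0 := by
      refine (Pr_exists_le hr' B.sym2 B (fun g T' => s(g, g) ∈ T') _ fun T' _ h => h).trans (Finset.sum_nonpos fun g _ => ?_)
      exact (Pr_mem_le hr').trans (Rt_loop δ 0 g).le
    refine le_trans ?_ (add_le_add le_rfl (le_of_eq (add_zero _)))
    refine le_trans ?_ (add_le_add le_rfl (add_le_add le_rfl z))
    rw [← Ex_const (Rt J δ 0) B.sym2 (ind (hit T B x)), hF]
    unfold Pr
    rw [← Ex_add, ← Ex_add]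
    refine Ex_mono hr' fun T' _ => ?_
    refine le_trans (ind_mono fun hx => ?_) ((ind_or_le _ _).trans (add_le_add le_rfl (ind_or_le _ _)))
    by_cases h1 : hit T B x
    · exact Or.inl h1
    refine Or.inr ?_
    obtain ⟨g, hg, hgl⟩ := hx
    by_cases hgK : g ∈ cl T B x
    · have hgT' : s(g, g) ∈ T' := (mem_union.1 hgl).resolve_left fun h => h1 (hit_cl.2 ⟨g, hgK, h⟩)
      exact Or.inr ⟨g, hg.right, hgT'⟩
    · obtain ⟨a, ha, b, hb, hab, h2, h3⟩ := hg.last_exit (mem_cl.2 (cn_refl hg.left)) hgK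
      refine Or.inl ⟨a, ha, b, hb, (mem_union.1 hab).resolve_left fun h => ?_, g, h3, hgl⟩
      exact (mem_sdiff.1 hb).2 (mem_cl.2 ((mem_cl.1 ha).step (mem_sdiff.1 hb).1 h))
  refine main.trans (add_le_add le_rfl ?_)
  rw [Ex_cond B.powerset (fun T => cl T B x) (fun T _ => mem_powerset.2 (cl_sub _ _ _)) F fun D _ =>
    ⟨_, cl_dep B x, fun T T2 hT => hQd D T T2 fun e he => hT e fun h => sdiff_not_touch he h.2⟩]
  refine (Ex_mono hr fun T _ => hFle _ (cl_sub _ _ _)).trans (le_of_eq ?_)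
  refine Ex_dep_congr (π := inner B) (fun T T2 hT => ?_) (fun _ _ => Iff.rfl) fun e _ he => by simp [Rt, he.2]
  have : cl T B x = cl T2 B x := by ext y; rw [mem_cl, mem_cl]; exact (cn_dep B x y T T2 hT).to_iff
  simp only [this]

theorem upper_final (hJ : KernelHyp d J α c C) {P : ℝ → Measure (Config d)} (hP : IsLRP J P) (hα : α < 1) (h3 : 3 * α < d) (hb : 0 < betaC P) :
    ∃ C₁ : ℝ, ∀ ε, 0 < ε → ε < betaC P / 2 → P (betaC P + ε) {ω | (cluster ω 0).Infinite} ≤ ENNReal.ofReal (C₁ * ε) := by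
  obtain ⟨D, hD, hs⟩ := sqrt_bound hJ hα h3 (β₀ := betaC P / 2) (β₁ := betaC P) (by linarith) (by linarith)
  refine ⟨2 * (2 * D + 8 * D ^ 2 * jt J), fun ε h0 h1 => ?_⟩
  have hβ : 0 < betaC P - ε := by linarith
  obtain ⟨K, hK0, hK⟩ := (sub_of_lt hJ hP hβ (by linarith)).chi hJ hβ.le
  have hj := jt_nonneg hJ
  have hm : ∀ h, 0 < h → Ms J (betaC P + ε) h ≤ 2 * D * √h + 8 * D ^ 2 * jt J * ε := by
    intro h hh
    set m := Ms J (betaC P + ε) h with hmd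
    have e1 : betaC P + ε = (betaC P - ε) + 2 * ε := by ring
    have m0 : 0 < m := Ms_pos hJ (by linarith) hh
    have hb := hs (betaC P - ε) (by linarith) (by linarith) ⟨K, hK0, hK⟩
    have key : m ≤ D * √h + (m / 2 + 4 * D ^ 2 * jt J * ε) := by
      rw [hmd]; refine Ms_le fun B x => ?_
      rw [e1]
      refine (sprinkle hJ hβ.le hh.le (by linarith) B x).trans (add_le_add ((le_Ms hJ hβ.le hh.le B x).trans (hb h hh)) ?_)
      rw [← e1, ← hmd]
      refine (min_le_ph hJ hβ.le (by positivity)).trans ?_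
      set s := 2 * ε * jt J * m with hsd
      have s0 : 0 ≤ s := by positivity
      have hl : ph (Rt J (betaC P - ε) s) B x ≤ D * √s := by
        rcases s0.lt_or_eq with hp | hp
        · exact (le_Ms hJ hβ.le s0 B x).trans (hb s hp)
        · rw [← hp]; have := ph_le_chi (B := B) (x := x) hJ hβ.le le_rfl hK; simpa using this
      have hj2 : √s = √(4 * ε * jt J) * √(m / 2) := by rw [← Real.sqrt_mul (by positivity), hsd]; congr 1; ring
      have u1 := Real.sq_sqrt (show 0 ≤ 4 * ε * jt J by positivity)
      have u2 := Real.sq_sqrt (show 0 ≤ m / 2 by positivity)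
      rw [hj2] at hl
      nlinarith [sq_nonneg (D * √(4 * ε * jt J) - √(m / 2))]
    linarith
  have hh : 0 < ε ^ 2 := by positivity
  obtain ⟨n, hn⟩ := exists_nat_gt (1 / ε ^ 2)
  refine measure_up (h := 0) hJ hP (by linarith) (n := n) fun k => ?_
  have t1 := ph_tail (B := bx d k) (x := (0 : V d)) hJ (show 0 ≤ betaC P + ε by linarith) hh.le n
  have t2 := (le_Ms hJ (show 0 ≤ betaC P + ε by linarith) hh.le (bx d k) 0).trans (hm _ hh)
  rw [Real.sqrt_sq h0.le] at t2
  have t3 : Real.exp (-(ε ^ 2 * n)) ≤ 1 / 2 := by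
    rw [div_lt_iff₀ hh] at hn
    have a : Real.exp (-(ε ^ 2 * n)) ≤ Real.exp (-1) := Real.exp_le_exp.2 (by linarith)
    have b := Real.add_one_le_exp (1:ℝ)
    rw [Real.exp_neg 1] at a
    refine a.trans ?_
    rw [one_div]; exact inv_anti₀ (by norm_num) (by linarith)
  have t4 := Pr_nonneg (Rt_nonneg hJ (show 0 ≤ betaC P + ε by linarith) (le_refl (0:ℝ))) (bx d k).sym2 (fun T => n ≤ (cl T (bx d k) 0).card)
  nlinarith
end final

end helpers
/-- If `0 < α < d` and `α < min(1, d/3)` then the percolation probability has mean-field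
behaviour near criticality: `ℙ_{β_c + ε}(|K| = ∞) ≍ ε`. -/
theorem percolation_probability_mean_field {d : ℕ} {J : V d → V d → ℝ} {α c C : ℝ}
    (hJ : KernelHyp d J α c C)
    (P : ℝ → Measure (Config d)) (hP : IsLRP J P)
    (hα : α < min 1 ((d : ℝ) / 3)) :
    ∃ c₁ C₁ ε₀ : ℝ, 0 < c₁ ∧ c₁ ≤ C₁ ∧ 0 < ε₀ ∧ ∀ ε : ℝ, 0 < ε → ε < ε₀ →
      ENNReal.ofReal (c₁ * ε) ≤ P (betaC P + ε) {ω | (cluster ω 0).Infinite} ∧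
      P (betaC P + ε) {ω | (cluster ω 0).Infinite} ≤ ENNReal.ofReal (C₁ * ε) := by
  have hne := PS_nonempty hJ hP
  have hb := betaC_pos hJ hP hne
  obtain ⟨C₁, hC⟩ := upper_final hJ hP (lt_of_lt_of_le hα (min_le_left _ _)) (by have := lt_of_lt_of_le hα (min_le_right _ _); linarith) hb
  refine ⟨1 / (16 * betaC P), max C₁ (1 / (16 * betaC P)), betaC P / 2, by positivity, le_max_right _ _, by positivity, fun ε h0 h1 => ⟨lower_final hJ hP hne h0 (by linarith), ?_⟩⟩
  exact (hC ε h0 h1).trans (ENNReal.ofReal_le_ofReal (mul_le_mul_of_nonneg_right (le_max_left _ _) h0.le))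
end LRP
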